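/- For every 0 < ξ < 1 and all integers k ≥ 4 and 1 ≤ ℓ < k/2 there exists γ > 0 such that the following holds for all sufficiently large n: if H is a k-uniform hypergraph on n vertices with n divisible by k−ℓ, H is not (ℓ,ξ)-extremal, and δ_{k−2}(H) ≥ ((4(k−ℓ)−1)/(4(k−ℓ)²) − γ)·C(n,2), then H contains a Hamiltonian ℓ-cycle. -/

import Mathlib

open Finset

/-- Number of edges of the hypergraph `E` containing the vertex set `S`. -/
def degH {n : ℕ} (E : Finset (Finset (Fin n))) (S : Finset (Fin n)) : ℕ :=
  (E.filter fun e => S ⊆ e).card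

/-- `E` contains a Hamiltonian ℓ-cycle. -/
def HasHamCycle {n : ℕ} (k l : ℕ) (E : Finset (Finset (Fin n))) : Prop :=
  ∃ vs : List (Fin n), vs.Nodup ∧ (∀ v, v ∈ vs) ∧ 1 ≤ vs.length / (k - l) ∧
    ∀ i < vs.length / (k - l), ((vs.rotate (i * (k - l))).take k).toFinset ∈ E

/-- `E` is `(ℓ,ξ)`-extremal: there is a vertex set `B` of size
`⌊(2(k-ℓ)-1)n/(2(k-ℓ))⌋` spanning at most `ξ·C(n,k)` edges. -/
def IsExtremal {n : ℕ} (k l : ℕ) (ξ : ℝ) (E : Finset (Finset (Fin n))) : Prop :=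
  ∃ B : Finset (Fin n), B.card = (2 * (k - l) - 1) * n / (2 * (k - l)) ∧
    ((E.filter fun e => e ⊆ B).card : ℝ) ≤ ξ * (Nat.choose n k)

set_option linter.unusedSectionVars false

/-! ### Loose paths as lists -/

section Paths

variable {α β : Type*} {k l : ℕ}

/-- Every window of `k` entries starting at a multiple of `k - l` satisfies `Q`. -/
def IsPath (k l : ℕ) (Q : List α → Prop) (vs : List α) : Prop :=
  ∀ i, i * (k - l) + k ≤ vs.length → Q ((vs.drop (i * (k - l))).take k)

/-- A path, possibly consisting of a bare overlap, without superfluous entries. -/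
def IsSeg (k l : ℕ) (Q : List α → Prop) (vs : List α) : Prop :=
  (∃ q, vs.length = l + q * (k - l)) ∧ IsPath k l Q vs

theorem IsPath.mono {Q Q' : List α → Prop} {vs : List α} (h : IsPath k l Q vs)
    (hQ : ∀ w, w <:+: vs → Q w → Q' w) : IsPath k l Q' vs := fun i hi =>
  hQ _ (((List.take_prefix _ _).isInfix).trans (List.drop_suffix _ _).isInfix) (h i hi)

theorem isPath_map (f : α → β) {Q : List β → Prop} {vs : List α} :
    IsPath k l Q (vs.map f) ↔ IsPath k l (fun w => Q (w.map f)) vs := by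
  simp [IsPath, List.map_take, List.map_drop]

theorem isPath_of_length_lt {Q : List α → Prop} {vs : List α} (h : vs.length < k) :
    IsPath k l Q vs := fun i hi => by omega

theorem IsPath.append {Q : List α → Prop} {u o w : List α} (hlk : l < k) (ho : o.length = l)
    (hu : (k - l) ∣ u.length) (h₁ : IsPath k l Q (u ++ o)) (h₂ : IsPath k l Q (o ++ w)) :
    IsPath k l Q (u ++ o ++ w) := by
  obtain ⟨a, ha⟩ := hu
  intro i hi
  rcases lt_or_ge i a with hia | hia
  · have hle : i * (k - l) + k ≤ (u ++ o).length := by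
      have : (i + 1) * (k - l) ≤ a * (k - l) := Nat.mul_le_mul_right _ hia
      have h3 : (i + 1) * (k - l) = i * (k - l) + (k - l) := by ring
      have h4 : a * (k - l) = (k - l) * a := mul_comm _ _
      simp only [List.length_append]
      omega
    have := h₁ i hle
    rw [List.drop_append_of_le_length (by omega), List.take_append_of_le_length]
    · exact this
    · simp only [List.length_drop]; omega
  · obtain ⟨j, rfl⟩ := Nat.exists_eq_add_of_le hia
    have e : (a + j) * (k - l) = u.length + j * (k - l) := by rw [ha]; ring
    have := h₂ j (by simp only [List.length_append] at hi ⊢; omega)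
    rw [e, List.append_assoc, List.drop_append, List.drop_eq_nil_of_le (by omega)]
    simpa using this

theorem IsSeg.append {Q : List α → Prop} {u o w : List α} (hlk : l < k) (ho : o.length = l)
    (h₁ : IsSeg k l Q (u ++ o)) (h₂ : IsSeg k l Q (o ++ w)) : IsSeg k l Q (u ++ o ++ w) := by
  obtain ⟨⟨q₁, hq₁⟩, h₁⟩ := h₁
  obtain ⟨⟨q₂, hq₂⟩, h₂⟩ := h₂
  simp only [List.length_append, ho] at hq₁ hq₂
  refine ⟨⟨q₁ + q₂, ?_⟩, h₁.append hlk ho ⟨q₁, ?_⟩ h₂⟩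
  · simp only [List.length_append, ho]
    have : (q₁ + q₂) * (k - l) = q₁ * (k - l) + q₂ * (k - l) := by ring
    omega
  · rw [mul_comm]; omega

theorem isSeg_of_length_eq {Q : List α → Prop} {vs : List α} (hlk : l < k) (h : vs.length = l) :
    IsSeg k l Q vs := ⟨⟨0, by omega⟩, isPath_of_length_lt (by omega)⟩

theorem isSeg_edge {Q : List α → Prop} {vs : List α} (hlk : l < k) (h : vs.length = k)
    (hQ : Q vs) : IsSeg k l Q vs := by
  refine ⟨⟨1, by omega⟩, fun i hi => ?_⟩
  have : i = 0 := by
    rcases Nat.eq_zero_or_pos i with h0 | h0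
    · exact h0
    · have : 1 * (k - l) ≤ i * (k - l) := Nat.mul_le_mul_right _ h0
      omega
  subst this
  simpa [← h] using hQ

/-- The last `l` entries. -/
def lastPart (l : ℕ) (s : List α) : List α := s.drop (s.length - l)

theorem length_lastPart {s : List α} (h : l ≤ s.length) : (lastPart l s).length = l := by
  simp [lastPart]; omega

theorem lastPart_append {u o : List α} (ho : o.length = l) : lastPart l (u ++ o) = o := by
  simp [lastPart, ho]

theorem lastPart_eq {s : List α} : s.take (s.length - l) ++ lastPart l s = s :=
  List.take_append_drop _ _

theorem IsSeg.le_length {Q : List α → Prop} {s : List α} (h : IsSeg k l Q s) : l ≤ s.length := by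
  obtain ⟨q, hq⟩ := h.1; omega

/-- The first overlap of the first segment, or `z` if there is none. -/
def nextHead (l : ℕ) (z : List α) : List (List α) → List α
  | [] => z
  | s :: _ => s.take l

/-- The pairs of overlaps that have to be connected to string the segments together. -/
def linkReqs (l : ℕ) (z : List α) : List (List α) → List (List α × List α)
  | [] => []
  | s :: ss => (lastPart l s, nextHead l z ss) :: linkReqs l z ss

/-- Two segments with the same first and last overlaps. -/
def SameEnds (l : ℕ) (s t : List α) : Prop := s.take l = t.take l ∧ lastPart l s = lastPart l t

theorem nextHead_congr {z : List α} {ss tt : List (List α)}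
    (h : List.Forall₂ (SameEnds l) ss tt) : nextHead l z ss = nextHead l z tt := by
  cases h with
  | nil => rfl
  | cons h _ => exact h.1

theorem linkReqs_congr {z : List α} {ss tt : List (List α)}
    (h : List.Forall₂ (SameEnds l) ss tt) : linkReqs l z ss = linkReqs l z tt := by
  induction h with
  | nil => rfl
  | cons h ht ih => simp only [linkReqs, h.2, ih, nextHead_congr ht]

theorem linkReqs_append {z : List α} (ss tt : List (List α)) :
    linkReqs l z (ss ++ tt) = linkReqs l (nextHead l z tt) ss ++ linkReqs l z tt := by
  induction ss with
  | nil => rfl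
  | cons s ss ih =>
    simp only [List.cons_append, linkReqs, ih, List.cons.injEq, and_true, Prod.mk.injEq, true_and]
    cases ss <;> rfl

theorem length_linkReqs {z : List α} (ss : List (List α)) : (linkReqs l z ss).length = ss.length := by
  induction ss with
  | nil => rfl
  | cons s ss ih => simp [linkReqs, ih]

/-- Segments can be strung together through connectors. -/
theorem exists_isSeg_of_links {Q : List α → Prop} (hlk : l < k) {z : List α} (hz : z.length = l)
    (ss cs : List (List α)) (hs : ∀ s ∈ ss, IsSeg k l Q s)
    (hc : List.Forall₂ (fun r c => IsSeg k l Q (r.1 ++ c ++ r.2)) (linkReqs l z ss) cs) :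
    ∃ vs : List α, vs.Perm (ss.flatten ++ cs.flatten) ∧ IsSeg k l Q (vs ++ z) ∧
      (vs ++ z).take l = nextHead l z ss := by
  induction ss generalizing cs with
  | nil =>
    cases hc
    exact ⟨[], by simp, isSeg_of_length_eq hlk hz, by simp [nextHead, hz]⟩
  | cons s ss ih =>
    cases hc with
    | @cons _ c _ cs hc hcs =>
    obtain ⟨vs, hp, hseg, hhd⟩ := ih cs (fun s hs' => hs s (by simp [hs'])) hcs
    have hsS := hs s (by simp)
    refine ⟨s ++ c ++ vs, ?_, ?_, ?_⟩
    · simp only [List.flatten_cons]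
      have h1 : (s ++ c ++ vs).Perm (s ++ c ++ (ss.flatten ++ cs.flatten)) := hp.append_left _
      refine h1.trans ?_
      simp only [List.append_assoc]
      refine List.Perm.append_left _ ?_
      rw [← List.append_assoc, ← List.append_assoc]
      exact List.Perm.append_right _ List.perm_append_comm
    · have hl2 : ((vs ++ z).take l).length = l := by simp [hz]
      have h2 : IsSeg k l Q (lastPart l s ++ c ++ (vs ++ z).take l ++ (vs ++ z).drop l) := by
        refine IsSeg.append hlk hl2 ?_ ?_
        · rw [hhd]; exact hc
        · rw [List.take_append_drop]; exact hseg
      rw [List.append_assoc, List.take_append_drop, List.append_assoc] at h2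
      have h3 := IsSeg.append (u := s.take (s.length - l)) hlk (length_lastPart hsS.le_length)
        (by rw [lastPart_eq]; exact hsS) h2
      rw [lastPart_eq] at h3
      simpa using h3
    · rw [nextHead, List.append_assoc, List.append_assoc, List.take_append_of_le_length hsS.le_length]

theorem take_drop_append_eq {vs : List α} {j : ℕ} (hlk : l < k) (hj : j + (k - l) ≤ vs.length)
    (hk : k ≤ vs.length) : ((vs ++ vs.take l).drop j).take k = (vs.rotate j).take k := by
  rw [List.rotate_eq_drop_append_take (by omega), List.drop_append_of_le_length (by omega)]
  simp only [List.take_append, List.length_drop, List.take_take]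
  congr 2
  omega

theorem hasHamCycle_of_links {n : ℕ} {E : Finset (Finset (Fin n))} (hlk : l < k)
    (s : List (Fin n)) (ss cs : List (List (Fin n)))
    (hsk : k ≤ s.length)
    (hs : ∀ t ∈ s :: ss, IsSeg k l (fun w => w.toFinset ∈ E) t)
    (hc : List.Forall₂ (fun r c => IsSeg k l (fun w => w.toFinset ∈ E) (r.1 ++ c ++ r.2))
      (linkReqs l (s.take l) (s :: ss)) cs)
    (hnd : ((s :: ss).flatten ++ cs.flatten).Nodup)
    (hall : ∀ v, v ∈ (s :: ss).flatten ++ cs.flatten) : HasHamCycle k l E := by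
  have hz : (s.take l).length = l := by simp; omega
  obtain ⟨vs, hp, ⟨⟨q, hq⟩, hpath⟩, hhd⟩ := exists_isSeg_of_links hlk hz (s :: ss) cs hs hc
  have hlen : vs.length = q * (k - l) := by simp only [List.length_append] at hq; omega
  have hk : k ≤ vs.length := by
    rw [hp.length_eq]; simp only [List.flatten_cons, List.length_append]; omega
  have hvl : vs.take l = s.take l := by
    rw [List.take_append_of_le_length (by omega)] at hhd
    simpa [nextHead] using hhd
  have hdiv : vs.length / (k - l) = q := by rw [hlen]; exact Nat.mul_div_cancel _ (by omega)
  refine ⟨vs, hp.symm.nodup hnd, fun v => (hp.symm.mem_iff).1 (hall v), ?_, fun i hi => ?_⟩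
  · rw [hdiv]
    rcases Nat.eq_zero_or_pos q with h0 | h0
    · subst h0; omega
    · exact h0
  · rw [hdiv] at hi
    have h1 : (i + 1) * (k - l) ≤ q * (k - l) := Nat.mul_le_mul_right _ hi
    have h2 : (i + 1) * (k - l) = i * (k - l) + (k - l) := by ring
    rw [← hvl] at hpath
    have := hpath i (by simp only [List.length_append, List.length_take]; omega)
    rwa [take_drop_append_eq hlk (by omega) hk] at this

end Paths

/-! ### Blow-ups of dense partite systems -/

section Blowup

variable {ι V X : Type*} [Fintype ι] [DecidableEq ι] [Fintype V] [DecidableEq V] [Fintype X]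

theorem sum_update_eq (i : ι) (g : (ι → V) → ℝ) :
    ∑ z : ι → V, ∑ v : V, g (Function.update z i v) = Fintype.card V * ∑ z, g z := by
  have hinv : Function.Involutive
      (fun p : (ι → V) × V => (Function.update p.1 i p.2, p.1 i)) := by
    rintro ⟨z, v⟩
    simp
  have h := Equiv.sum_comp hinv.toPerm (fun p : (ι → V) × V => g p.1)
  simp only [Function.Involutive.coe_toPerm] at h
  rw [Fintype.sum_prod_type, Fintype.sum_prod_type] at h
  rw [h, mul_sum]
  simp

theorem sq_sum_le_sum_update (i : ι) (b : (ι → V) → X → ℝ) :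
    (∑ z, ∑ C, b z C) ^ 2 * Fintype.card V ≤
      (Fintype.card V : ℝ) ^ Fintype.card ι * Fintype.card X *
        ∑ z, ∑ C, ∑ v, b z C * b (Function.update z i v) C := by
  rcases Nat.eq_zero_or_pos (Fintype.card V) with h0 | h0
  · have : IsEmpty V := Fintype.card_eq_zero_iff.1 h0
    have : IsEmpty (ι → V) := ⟨fun z => isEmptyElim (z i)⟩
    simp
  set n : ℝ := (Fintype.card V : ℝ)
  have hn : 0 < n := by simpa [n] using h0
  set f : (ι → V) → X → ℝ := fun z C => ∑ v, b (Function.update z i v) C with hf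
  have hfu : ∀ z v C, f (Function.update z i v) C = f z C := by
    intro z v C; simp [hf]
  have h1 : ∑ z, ∑ C, f z C = n * ∑ z, ∑ C, b z C := by
    rw [sum_comm, sum_comm (f := fun z C => b z C), mul_sum]
    exact sum_congr rfl fun C _ => sum_update_eq i (fun z => b z C)
  have h2 : ∑ z, ∑ C, f z C ^ 2 = n * ∑ z, ∑ C, ∑ v, b z C * b (Function.update z i v) C := by
    rw [sum_comm, sum_comm (f := fun z C => ∑ v, b z C * b (Function.update z i v) C), mul_sum]
    refine sum_congr rfl fun C _ => ?_
    have := sum_update_eq i (fun z => b z C * f z C)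
    simp only [hfu] at this
    simp only [← mul_sum]
    rw [← this]
    refine sum_congr rfl fun z _ => ?_
    rw [← sum_mul, sq]
  have h3 := sq_sum_le_card_mul_sum_sq (s := (univ : Finset ((ι → V) × X)))
    (f := fun p => f p.1 p.2)
  rw [Fintype.sum_prod_type, Fintype.sum_prod_type, h1, h2] at h3
  simp only [card_univ, Fintype.card_prod, Fintype.card_fun, Nat.cast_mul, Nat.cast_pow] at h3
  have h4 : n * ((∑ z, ∑ C, b z C) ^ 2 * n) ≤ n * (n ^ Fintype.card ι * Fintype.card X *
        ∑ z, ∑ C, ∑ v, b z C * b (Function.update z i v) C) := by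
    calc _ = (n * ∑ z, ∑ C, b z C) ^ 2 := by ring
      _ ≤ _ := h3
      _ = _ := by ring
  exact le_of_mul_le_mul_left h4 hn

/-- Every mixture of the tuple `z` and the clones `C` lies in `G`. -/
def MixIn {κ : Type*} (G : Finset (ι → V)) (c : κ → ι) (z : ι → V) (C : κ → V) : Prop :=
  ∀ z' : ι → V, (∀ i, z' i = z i ∨ ∃ p, c p = i ∧ z' i = C p) → z' ∈ G

open Classical in
theorem card_mixIn_ge [Nonempty V] (G : Finset (ι → V)) {d : ℝ} (hd : 0 ≤ d)
    (hG : d * (Fintype.card V : ℝ) ^ Fintype.card ι ≤ #G) (s : ℕ) (c : Fin s → ι) :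
    d ^ 2 ^ s * (Fintype.card V : ℝ) ^ (Fintype.card ι + s) ≤
      ∑ z : ι → V, ∑ C : Fin s → V, if MixIn G c z C then (1 : ℝ) else 0 := by
  set n : ℝ := (Fintype.card V : ℝ)
  have hn : 0 < n := by simp [n, Fintype.card_pos]
  induction s with
  | zero =>
    have : ∀ z (C : Fin 0 → V), MixIn G c z C ↔ z ∈ G := by
      intro z C
      refine ⟨fun h => h z fun i => Or.inl rfl, fun h z' hz' => ?_⟩
      have : z' = z := by
        funext i
        rcases hz' i with h | ⟨p, -⟩
        · exact h
        · exact p.elim0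
      rwa [this]
    simpa [this] using hG
  | succ s ih =>
    have ih := ih (fun p => c p.castSucc)
    set b : (ι → V) → (Fin s → V) → ℝ := fun z C =>
      if MixIn G (fun p : Fin s => c p.castSucc) z C then (1 : ℝ) else 0 with hb
    have hcs := sq_sum_le_sum_update (c (Fin.last s)) b
    set S := ∑ z, ∑ C, b z C
    set T := ∑ z, ∑ C, ∑ v, b z C * b (Function.update z (c (Fin.last s)) v) C
    have hT : T ≤ ∑ z : ι → V, ∑ C : Fin (s + 1) → V, if MixIn G c z C then (1 : ℝ) else 0 := by
      refine sum_le_sum fun z _ => ?_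
      rw [← (Fin.snocEquiv (fun _ : Fin (s + 1) => V)).sum_comp, Fintype.sum_prod_type, sum_comm]
      refine sum_le_sum fun v _ => sum_le_sum fun C _ => ?_
      simp only [hb, Fin.snocEquiv, Equiv.coe_fn_mk]
      by_cases h1 : MixIn G (fun p : Fin s => c p.castSucc) z C
      · by_cases h2 : MixIn G (fun p : Fin s => c p.castSucc)
            (Function.update z (c (Fin.last s)) v) C
        · have h3 : MixIn G c z (Fin.snoc (α := fun _ => V) C v) := by
            intro z' hz'
            by_cases h4 : z' (c (Fin.last s)) = v
            · refine h2 z' fun i => ?_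
              by_cases hi : i = c (Fin.last s)
              · left; rw [hi, h4]; simp
              · rw [Function.update_of_ne hi]
                rcases hz' i with h | ⟨p, hp, hp'⟩
                · exact Or.inl h
                · induction p using Fin.lastCases with
                  | last => exact absurd hp.symm hi
                  | cast p => exact Or.inr ⟨p, hp, by simpa using hp'⟩
            · refine h1 z' fun i => ?_
              rcases hz' i with h | ⟨p, hp, hp'⟩
              · exact Or.inl h
              · induction p using Fin.lastCases with
                | last => rw [← hp] at hp'; simp at hp'; exact absurd hp' h4
                | cast p => exact Or.inr ⟨p, hp, by simpa using hp'⟩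
          simp [h1, h2, h3]
        · simp only [h2, if_false, mul_zero]; positivity
      · simp only [h1, if_false, zero_mul]; positivity
    refine le_trans ?_ hT
    have hX : (Fintype.card (Fin s → V) : ℝ) = n ^ s := by simp [n]
    rw [hX] at hcs
    have h5 : (d ^ 2 ^ s * n ^ (Fintype.card ι + s)) ^ 2 ≤ S ^ 2 := by gcongr
    have h6 : n ^ (Fintype.card ι) * n ^ s * (d ^ 2 ^ (s + 1) * n ^ (Fintype.card ι + (s + 1))) ≤
        n ^ (Fintype.card ι) * n ^ s * T := by
      refine le_trans (le_of_eq ?_) ((mul_le_mul_of_nonneg_right h5 hn.le).trans hcs)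
      ring
    exact le_of_mul_le_mul_left h6 (by positivity)

/-- The tuple `C` of clones is such that every rainbow subset of it is part of a member of `G`. -/
def IsBlowup {κ : Type*} (G : Finset (ι → V)) (c : κ → ι) (C : κ → V) : Prop :=
  ∀ J : Finset κ, Set.InjOn c J → ∃ z ∈ G, ∀ p ∈ J, C p = z (c p)

theorem MixIn.isBlowup {κ : Type*} {G : Finset (ι → V)} {c : κ → ι} {z : ι → V} {C : κ → V}
    (h : MixIn G c z C) : IsBlowup G c C := by
  classical
  intro J hJ
  refine ⟨fun i => if h : ∃ p ∈ J, c p = i then C h.choose else z i, h _ fun i => ?_, ?_⟩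
  · by_cases hi : ∃ p ∈ J, c p = i
    · right
      simp only [hi, dif_pos]
      exact ⟨_, hi.choose_spec.2, rfl⟩
    · left; simp [hi]
  · intro p hp
    have hi : ∃ q ∈ J, c q = c p := ⟨p, hp, rfl⟩
    simp only [hi, dif_pos]
    exact congrArg C (hJ hp hi.choose_spec.1 hi.choose_spec.2.symm)

open Classical in
theorem card_isBlowup_ge {κ : Type*} [Fintype κ] [Nonempty V] (G : Finset (ι → V)) {d : ℝ}
    (hd : 0 ≤ d) (hG : d * (Fintype.card V : ℝ) ^ Fintype.card ι ≤ #G) (c : κ → ι) :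
    d ^ 2 ^ Fintype.card κ * (Fintype.card V : ℝ) ^ Fintype.card κ ≤
      #{C : κ → V | IsBlowup G c C} := by
  set s := Fintype.card κ
  let e : κ ≃ Fin s := Fintype.equivFin κ
  set n : ℝ := (Fintype.card V : ℝ)
  have hn : 0 < n := by simp [n, Fintype.card_pos]
  have h := card_mixIn_ge G hd hG s (fun p => c (e.symm p))
  have h2 : ∑ z : ι → V, ∑ C : Fin s → V,
      (if MixIn G (fun p => c (e.symm p)) z C then (1 : ℝ) else 0) ≤
      ∑ z : ι → V, (#{C : κ → V | IsBlowup G c C} : ℝ) := by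
    refine sum_le_sum fun z _ => ?_
    rw [← sum_boole, ← (Equiv.arrowCongr e (Equiv.refl V)).sum_comp]
    refine sum_le_sum fun C _ => ?_
    by_cases hm : MixIn G (fun p => c (e.symm p)) z ((e.arrowCongr (Equiv.refl V)) C)
    · have : IsBlowup G c C := by
        refine MixIn.isBlowup (z := z) fun z' hz' => hm z' fun i => ?_
        rcases hz' i with h | ⟨p, hp, hp'⟩
        · exact Or.inl h
        · exact Or.inr ⟨e p, by simpa using hp, by simpa using hp'⟩
      simp [hm, this]
    · simp only [hm, if_false]; split_ifs <;> norm_num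
  have h3 := h.trans h2
  simp only [sum_const, card_univ, Fintype.card_fun, nsmul_eq_mul, Nat.cast_pow] at h3
  have h4 : n ^ Fintype.card ι * (d ^ 2 ^ s * n ^ s) ≤
      n ^ Fintype.card ι * (#{C : κ → V | IsBlowup G c C} : ℝ) := by
    refine le_trans (le_of_eq ?_) h3
    ring
  exact le_of_mul_le_mul_left h4 (by positivity)

end Blowup

theorem IsBlowup.list {ι V κ : Type*} {G : Finset (ι → V)} {c : κ → ι} {C : κ → V}
    (h : IsBlowup G c C) (ps : List κ) (hps : (ps.map c).Nodup) :
    ∃ z ∈ G, ∀ p ∈ ps, C p = z (c p) := by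
  classical
  obtain ⟨z, hz, hz'⟩ := h ps.toFinset (by
    intro p hp q hq hpq
    exact List.inj_on_of_nodup_map hps (by simpa using hp) (by simpa using hq) hpq)
  exact ⟨z, hz, fun p hp => hz' p (by simpa using hp)⟩

/-! ### Greedy selection of disjoint tuples -/

section Greedy

variable {κ V τ β : Type*} [Fintype κ] [DecidableEq κ] [Fintype V] [DecidableEq V]

/-- The entries of a tuple as a list. -/
noncomputable def tupList (C : κ → V) : List V := (univ : Finset κ).toList.map C

theorem mem_tupList {C : κ → V} {v : V} : v ∈ tupList C ↔ ∃ p, C p = v := by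
  simp [tupList]

theorem nodup_tupList {C : κ → V} (h : Function.Injective C) : (tupList C).Nodup :=
  (Finset.nodup_toList _).map h

theorem length_tupList {C : κ → V} : (tupList C).length = Fintype.card κ := by
  simp [tupList]

theorem card_mul_le_of_agree (p : κ) (S : Finset (κ → V))
    (hS : ∀ C ∈ S, ∀ D ∈ S, (∀ q, q ≠ p → C q = D q) → C = D) :
    #S * Fintype.card V ≤ Fintype.card V ^ Fintype.card κ := by
  have := card_le_card_of_injOn (s := S ×ˢ (univ : Finset V)) (t := (univ : Finset (κ → V)))
    (fun x => Function.update x.1 p x.2) (fun _ _ => mem_univ _) (by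
      rintro ⟨C, v⟩ hC ⟨D, w⟩ hD h
      simp only [coe_product, Set.mem_prod, mem_coe] at hC hD
      have hq : ∀ q, q ≠ p → C q = D q := fun q hq => by
        have := congrFun h q
        simpa [Function.update_of_ne hq] using this
      have hv : v = w := by simpa using congrFun h p
      rw [hS C hC.1 D hD.1 hq, hv])
  simpa [card_product] using this

theorem card_bad_tuples_le (F : Finset V) :
    #{C : κ → V | ¬ (Function.Injective C ∧ ∀ p, C p ∉ F)} * Fintype.card V ≤
      Fintype.card κ * (#F + Fintype.card κ) * Fintype.card V ^ Fintype.card κ := by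
  set n := Fintype.card V
  set s := Fintype.card κ
  have hsub : ({C : κ → V | ¬ (Function.Injective C ∧ ∀ p, C p ∉ F)} : Finset (κ → V)) ⊆
      (univ : Finset κ).biUnion (fun p =>
        (F.biUnion fun v => {C : κ → V | C p = v}) ∪
          ((univ.erase p).biUnion fun q => {C : κ → V | C p = C q})) := by
    intro C hC
    simp only [mem_filter, mem_univ, true_and, not_and_or, not_forall, not_not] at hC
    simp only [mem_biUnion, mem_univ, true_and, mem_union, mem_filter, mem_erase, and_true]
    rcases hC with hC | ⟨p, hp⟩
    · simp only [Function.Injective, not_forall] at hC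
      obtain ⟨p, q, h, hne⟩ := hC
      exact ⟨p, Or.inr ⟨q, Ne.symm hne, h⟩⟩
    · exact ⟨p, Or.inl ⟨C p, hp, rfl⟩⟩
  have h1 : ∀ p v, #{C : κ → V | C p = v} * n ≤ n ^ s := by
    intro p v
    refine card_mul_le_of_agree p _ fun C hC D hD h => ?_
    simp only [mem_filter, mem_univ, true_and] at hC hD
    funext q
    by_cases hq : q = p
    · rw [hq, hC, hD]
    · exact h q hq
  have h2 : ∀ p q, q ≠ p → #{C : κ → V | C p = C q} * n ≤ n ^ s := by
    intro p q hqp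
    refine card_mul_le_of_agree p _ fun C hC D hD h => ?_
    simp only [mem_filter, mem_univ, true_and] at hC hD
    funext r
    by_cases hr : r = p
    · rw [hr, hC, hD, h q hqp]
    · exact h r hr
  have h3 : ∀ p, #((F.biUnion fun v => ({C : κ → V | C p = v} : Finset (κ → V))) ∪
          ((univ.erase p).biUnion fun q => ({C : κ → V | C p = C q} : Finset (κ → V)))) * n ≤
          (#F + s) * n ^ s := by
    intro p
    have ha : #(F.biUnion fun v => ({C : κ → V | C p = v} : Finset (κ → V))) * n ≤
        #F * n ^ s := by
      refine (Nat.mul_le_mul_right _ card_biUnion_le).trans ?_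
      rw [sum_mul]
      exact (sum_le_card_nsmul _ _ _ fun v _ => h1 p v).trans (by simp)
    have hb : #((univ.erase p).biUnion fun q => ({C : κ → V | C p = C q} : Finset (κ → V))) * n ≤
        s * n ^ s := by
      refine (Nat.mul_le_mul_right _ card_biUnion_le).trans ?_
      rw [sum_mul]
      refine (sum_le_card_nsmul _ _ _ fun q hq => h2 p q (ne_of_mem_erase hq)).trans ?_
      simp only [smul_eq_mul]
      exact Nat.mul_le_mul_right _ (card_le_univ _)
    calc _ ≤ _ := Nat.mul_le_mul_right _ (card_union_le _ _)
      _ ≤ _ := by rw [add_mul, add_mul]; exact add_le_add ha hb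
  calc _ ≤ _ := Nat.mul_le_mul_right _ ((card_le_card hsub).trans card_biUnion_le)
    _ ≤ _ := by
      rw [sum_mul]
      refine (sum_le_card_nsmul _ _ _ fun p _ => h3 p).trans (le_of_eq ?_)
      simp only [card_univ, smul_eq_mul, s]; ring

theorem card_good_tuples_ge [Nonempty V] (F : Finset V) (A : Finset (κ → V)) {α α' : ℝ}
    (hA : α * (Fintype.card V : ℝ) ^ Fintype.card κ ≤ #A)
    (hF : (Fintype.card κ : ℝ) * (#F + Fintype.card κ) ≤ α' * Fintype.card V) :
    (α - α') * (Fintype.card V : ℝ) ^ Fintype.card κ ≤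
      #{C ∈ A | Function.Injective C ∧ ∀ p, C p ∉ F} := by
  set n : ℝ := (Fintype.card V : ℝ)
  have hn : 0 < n := by simp [n, Fintype.card_pos]
  have h1 : (#A : ℝ) ≤ #{C ∈ A | Function.Injective C ∧ ∀ p, C p ∉ F} +
      #{C : κ → V | ¬ (Function.Injective C ∧ ∀ p, C p ∉ F)} := by
    rw [← card_filter_add_card_filter_not (s := A)
      (fun C => Function.Injective C ∧ ∀ p, C p ∉ F)]
    push_cast
    gcongr
    exact subset_univ _
  have h2 : (#{C : κ → V | ¬ (Function.Injective C ∧ ∀ p, C p ∉ F)} : ℝ) * n ≤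
      α' * n ^ Fintype.card κ * n := by
    have := card_bad_tuples_le (κ := κ) F
    have h3 : (#{C : κ → V | ¬ (Function.Injective C ∧ ∀ p, C p ∉ F)} : ℝ) * n ≤
      Fintype.card κ * (#F + Fintype.card κ) * n ^ Fintype.card κ := by
      simp only [n]; exact_mod_cast this
    refine h3.trans ?_
    rw [mul_right_comm α']
    gcongr
  have h3 := le_of_mul_le_mul_right h2 hn
  linarith

theorem exists_good_tuple [Nonempty V] (F : Finset V) (A : Finset (κ → V)) {α : ℝ}
    (hA : α * (Fintype.card V : ℝ) ^ Fintype.card κ ≤ #A)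
    (hF : (Fintype.card κ : ℝ) * (#F + Fintype.card κ) < α * Fintype.card V) :
    ∃ C ∈ A, Function.Injective C ∧ ∀ p, C p ∉ F := by
  have hn : (0 : ℝ) < Fintype.card V := by simp [Fintype.card_pos]
  have h := card_good_tuples_ge F A (α' := (Fintype.card κ : ℝ) * (#F + Fintype.card κ) /
    Fintype.card V) hA (by field_simp; rfl)
  have h2 : (0 : ℝ) < (α - (Fintype.card κ : ℝ) * (#F + Fintype.card κ) /
    Fintype.card V) * (Fintype.card V : ℝ) ^ Fintype.card κ := by
    refine mul_pos ?_ (by positivity)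
    rw [sub_pos, div_lt_iff₀ hn]
    exact hF
  have h3 := h2.trans_le h
  rw [Nat.cast_pos, card_pos] at h3
  obtain ⟨C, hC⟩ := h3
  rw [mem_filter] at hC
  exact ⟨C, hC.1, hC.2⟩

theorem exists_disjoint_tuples [Nonempty V] (As : List (Finset (κ → V))) (F : Finset V) {α : ℝ}
    (hA : ∀ A ∈ As, α * (Fintype.card V : ℝ) ^ Fintype.card κ ≤ #A)
    (hF : (Fintype.card κ : ℝ) * (#F + Fintype.card κ * As.length + Fintype.card κ) <
      α * Fintype.card V) :
    ∃ Cs : List (κ → V), List.Forall₂ (fun A C => C ∈ A) As Cs ∧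
      (Cs.flatMap tupList).Nodup ∧ ∀ v ∈ Cs.flatMap tupList, v ∉ F := by
  induction As generalizing F with
  | nil => exact ⟨[], .nil, by simp, by simp⟩
  | cons A As ih =>
    simp only [List.length_cons, Nat.cast_add, Nat.cast_one] at hF
    set s : ℝ := (Fintype.card κ : ℝ) with hs
    have hs0 : 0 ≤ s := by positivity
    obtain ⟨C, hC, hinj, hav⟩ := exists_good_tuple F A (hA A (by simp)) (by
      refine lt_of_le_of_lt ?_ hF
      have : (0 : ℝ) ≤ As.length := by positivity
      rw [← hs]
      gcongr
      nlinarith)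
    obtain ⟨Cs, h1, h2, h3⟩ := ih (F ∪ (tupList C).toFinset)
      (fun B hB => hA B (by simp [hB])) (by
      refine lt_of_le_of_lt ?_ hF
      have h4 : (#(F ∪ (tupList C).toFinset) : ℝ) ≤ #F + s := by
        have := (card_union_le F (tupList C).toFinset).trans
          (Nat.add_le_add_left (List.toFinset_card_le _) _)
        rw [length_tupList] at this
        simp only [s]
        exact_mod_cast this
      have : s * (#(F ∪ (tupList C).toFinset) + s * As.length + s) ≤
        s * (#F + s + s * As.length + s) := by gcongr
      exact this.trans (le_of_eq (by ring)))
    refine ⟨C :: Cs, .cons hC h1, ?_, ?_⟩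
    · rw [List.flatMap_cons, List.nodup_append']
      refine ⟨nodup_tupList hinj, h2, ?_⟩
      intro v hv hv'
      have := h3 v hv'
      simp only [mem_union, List.mem_toFinset, not_or] at this
      exact this.2 hv
    · intro v hv
      rw [List.flatMap_cons, List.mem_append] at hv
      rcases hv with hv | hv
      · obtain ⟨p, rfl⟩ := mem_tupList.1 hv
        exact hav p
      · have := h3 v hv
        simp only [mem_union, not_or] at this
        exact this.1

open Classical in
/-- Number of members of the list that lie in `A`. -/
noncomputable def cntIn (A : Finset (κ → V)) (Xs : List (κ → V)) : ℕ :=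
  Xs.countP fun C => C ∈ A

theorem exists_family_aux [Nonempty V] (T : Finset τ) (hT : T.Nonempty)
    (A : τ → Finset (κ → V)) {α : ℝ} (hα : 0 < α)
    (hA : ∀ t ∈ T, α * (Fintype.card V : ℝ) ^ Fintype.card κ ≤ #(A t)) (F : Finset V) (N : ℕ)
    (hF : (Fintype.card κ : ℝ) * (#F + Fintype.card κ * N + Fintype.card κ) ≤
      α / 2 * Fintype.card V) :
    ∃ Xs : List (κ → V), Xs.length = N ∧ (Xs.flatMap tupList).Nodup ∧
      (∀ v ∈ Xs.flatMap tupList, v ∉ F) ∧ (∀ X ∈ Xs, ∃ t ∈ T, X ∈ A t) ∧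
      ∑ t ∈ T, (1 / 2 : ℝ) ^ cntIn (A t) Xs ≤ #T * (1 - α / 4) ^ N := by
  classical
  induction N with
  | zero => exact ⟨[], rfl, by simp, by simp, by simp, by simp [cntIn]⟩
  | succ N ih =>
    set s : ℝ := (Fintype.card κ : ℝ) with hs
    set n : ℝ := (Fintype.card V : ℝ) with hn
    have hs0 : 0 ≤ s := by positivity
    have hn0 : 0 < n := by simp [n, Fintype.card_pos]
    obtain ⟨Xs, hlen, hnd, hav, hmem, hsum⟩ := ih (by
      refine le_trans ?_ hF
      push_cast
      gcongr
      linarith)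
    set F' := F ∪ (Xs.flatMap tupList).toFinset with hF'
    have hF'c : (#F' : ℝ) ≤ #F + s * N := by
      have := (card_union_le F (Xs.flatMap tupList).toFinset).trans
          (Nat.add_le_add_left (List.toFinset_card_le _) _)
      have h2 : (Xs.flatMap tupList).length = N * Fintype.card κ := by
        simp [List.length_flatMap, length_tupList, hlen]
      rw [h2] at this
      rw [mul_comm, hs]
      exact_mod_cast this
    set G : τ → Finset (κ → V) := fun t =>
      {C ∈ A t | Function.Injective C ∧ ∀ p, C p ∉ F'} with hG
    have hGc : ∀ t ∈ T, α / 2 * n ^ Fintype.card κ ≤ #(G t) := by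
      intro t ht
      have := card_good_tuples_ge F' (A t) (α' := α / 2) (hA t ht) (by
        refine le_trans ?_ hF
        rw [← hs]
        gcongr
        push_cast
        nlinarith)
      rwa [sub_half] at this
    set w : τ → ℝ := fun t => (1 / 2 : ℝ) ^ cntIn (A t) Xs with hw
    have hw0 : ∀ t, 0 < w t := fun t => by positivity
    have hW : 0 < ∑ t ∈ T, w t := sum_pos (fun t _ => hw0 t) hT
    have hex : ∃ C : κ → V, C ∈ (univ : Finset (κ → V)) ∧
        α / 2 * ∑ t ∈ T, w t ≤ ∑ t ∈ T, if C ∈ G t then w t else 0 := by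
      refine exists_le_of_sum_le univ_nonempty ?_
      rw [sum_comm]
      simp only [sum_const, card_univ, Fintype.card_fun, nsmul_eq_mul, Nat.cast_pow]
      rw [mul_sum, mul_sum]
      refine sum_le_sum fun t ht => ?_
      rw [← sum_filter, sum_const, nsmul_eq_mul, filter_mem_eq_inter, univ_inter]
      calc _ = α / 2 * n ^ Fintype.card κ * w t := by ring
        _ ≤ _ := mul_le_mul_of_nonneg_right (hGc t ht) (hw0 t).le
    obtain ⟨C, -, hC⟩ := hex
    have hCpos : 0 < ∑ t ∈ T, if C ∈ G t then w t else 0 :=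
      lt_of_lt_of_le (by positivity) hC
    obtain ⟨t₀, ht₀, hCt₀⟩ : ∃ t ∈ T, C ∈ G t := by
      by_contra! hcon
      rw [sum_eq_zero fun t ht => if_neg (hcon t ht)] at hCpos
      exact lt_irrefl _ hCpos
    rw [hG, mem_filter] at hCt₀
    refine ⟨C :: Xs, by simp [hlen], ?_, ?_, ?_, ?_⟩
    · rw [List.flatMap_cons, List.nodup_append']
      refine ⟨nodup_tupList hCt₀.2.1, hnd, ?_⟩
      intro v hv hv'
      obtain ⟨p, rfl⟩ := mem_tupList.1 hv
      have := hCt₀.2.2 p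
      simp only [hF', mem_union, List.mem_toFinset, not_or] at this
      exact this.2 hv'
    · intro v hv
      rw [List.flatMap_cons, List.mem_append] at hv
      rcases hv with hv | hv
      · obtain ⟨p, rfl⟩ := mem_tupList.1 hv
        have := hCt₀.2.2 p
        simp only [hF', mem_union, not_or] at this
        exact this.1
      · exact hav v hv
    · intro X hX
      rcases List.mem_cons.1 hX with rfl | hX
      · exact ⟨t₀, ht₀, hCt₀.1⟩
      · exact hmem X hX
    · have hstep : ∀ t, (1 / 2 : ℝ) ^ cntIn (A t) (C :: Xs) ≤
          w t - 1 / 2 * if C ∈ G t then w t else 0 := by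
        intro t
        by_cases h : C ∈ A t
        · have h1 : cntIn (A t) (C :: Xs) = cntIn (A t) Xs + 1 := by
            simp [cntIn, h]
          rw [h1, pow_succ]
          have := (hw0 t).le
          split_ifs
          · simp only [hw]; linarith
          · simp only [hw] at this ⊢; linarith
        · have h1 : cntIn (A t) (C :: Xs) = cntIn (A t) Xs := by
            simp [cntIn, h]
          have h2 : C ∉ G t := fun hh => h (mem_filter.1 hh).1
          simp [h1, h2, hw]
      have h1 : (1 - α / 4) * ∑ t ∈ T, w t ≤ (1 - α / 4) * (#T * (1 - α / 4) ^ N) := by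
        by_cases hα4 : α ≤ 4
        · exact mul_le_mul_of_nonneg_left hsum (by linarith)
        · exfalso
          have h2 : (∑ t ∈ T, if C ∈ G t then w t else 0) ≤ ∑ t ∈ T, w t :=
            sum_le_sum fun t _ => by split_ifs <;> linarith [hw0 t]
          nlinarith
      calc _ ≤ ∑ t ∈ T, (w t - 1 / 2 * if C ∈ G t then w t else 0) :=
            sum_le_sum fun t _ => hstep t
        _ = ∑ t ∈ T, w t - 1 / 2 * ∑ t ∈ T, if C ∈ G t then w t else 0 := by
            rw [sum_sub_distrib, mul_sum]
        _ ≤ (1 - α / 4) * ∑ t ∈ T, w t := by linarith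
        _ ≤ _ := by rw [pow_succ]; linarith

/-- A small disjoint family containing many members of every `A t`. -/
theorem exists_family [Nonempty V] (T : Finset τ)
    (A : τ → Finset (κ → V)) {α : ℝ} (hα : 0 < α)
    (hA : ∀ t ∈ T, α * (Fintype.card V : ℝ) ^ Fintype.card κ ≤ #(A t)) (F : Finset V) (N : ℕ)
    (hF : (Fintype.card κ : ℝ) * (#F + Fintype.card κ * N + Fintype.card κ) ≤
      α / 2 * Fintype.card V) (hTN : (#T : ℝ) < Real.exp (α / 8 * N)) :
    ∃ Xs : List (κ → V), Xs.length ≤ N ∧ (Xs.flatMap tupList).Nodup ∧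
      (∀ v ∈ Xs.flatMap tupList, v ∉ F) ∧ (∀ X ∈ Xs, ∃ t ∈ T, X ∈ A t) ∧
      ∀ t ∈ T, α / 8 * N ≤ cntIn (A t) Xs := by
  rcases T.eq_empty_or_nonempty with rfl | hT
  · exact ⟨[], by simp, by simp, by simp, by simp, by simp⟩
  obtain ⟨Xs, hlen, hnd, hav, hmem, hsum⟩ := exists_family_aux T hT A hα hA F N hF
  refine ⟨Xs, hlen.le, hnd, hav, hmem, fun t ht => ?_⟩
  by_contra! hlt
  have hT0 : (0 : ℝ) < #T := by exact_mod_cast hT.card_pos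
  have h1 : (1 / 2 : ℝ) ^ cntIn (A t) Xs ≤ #T * (1 - α / 4) ^ N :=
    (single_le_sum (f := fun t => (1 / 2 : ℝ) ^ cntIn (A t) Xs)
      (fun _ _ => by positivity) ht).trans hsum
  have hα4 : 0 ≤ 1 - α / 4 := by
    have h2 := hA t ht
    have h3 : (#(A t) : ℝ) ≤ (Fintype.card V : ℝ) ^ Fintype.card κ := by
      have := card_le_univ (A t)
      simp only [Fintype.card_fun] at this
      exact_mod_cast this
    have h4 : 0 < (Fintype.card V : ℝ) ^ Fintype.card κ := by
      have : (0 : ℝ) < Fintype.card V := by simp [Fintype.card_pos]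
      positivity
    have h5 : α ≤ 1 := by
      by_contra! h
      nlinarith
    linarith
  have h2 : (1 - α / 4) ^ N ≤ Real.exp (-(α / 4 * N)) := by
    have h3 : 1 - α / 4 ≤ Real.exp (-(α / 4)) := by
      have := Real.add_one_le_exp (-(α / 4)); linarith
    calc _ ≤ Real.exp (-(α / 4)) ^ N := by gcongr
      _ = _ := by rw [← Real.exp_nat_mul]; ring_nf
  have h3 : Real.exp (-(cntIn (A t) Xs : ℝ)) ≤ (1 / 2 : ℝ) ^ cntIn (A t) Xs := by
    have h4 : Real.exp (-1) ≤ 1 / 2 := by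
      rw [Real.exp_neg, one_div]
      apply inv_anti₀ (by norm_num)
      have := Real.add_one_le_exp 1; linarith
    calc _ = Real.exp (-1) ^ cntIn (A t) Xs := by rw [← Real.exp_nat_mul]; ring_nf
      _ ≤ _ := by gcongr
  have h4 : Real.exp (-(α / 8 * N)) < Real.exp (-(cntIn (A t) Xs : ℝ)) :=
    Real.exp_lt_exp.2 (by linarith)
  have h5 : (#T : ℝ) * (1 - α / 4) ^ N < Real.exp (α / 8 * N) * Real.exp (-(α / 4 * N)) := by
    have : 0 < Real.exp (-(α / 4 * N)) := Real.exp_pos _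
    calc _ ≤ (#T : ℝ) * Real.exp (-(α / 4 * N)) := by gcongr
      _ < _ := by gcongr
  rw [← Real.exp_add] at h5
  have h6 : α / 8 * N + -(α / 4 * N) = -(α / 8 * N) := by ring
  rw [h6] at h5
  linarith

open Classical in
/-- Assign distinct members of a list to requests with many admissible members. -/
theorem exists_assignment (R : τ → β → Prop) (Ts : List τ) (Xs : List β)
    (h : ∀ t ∈ Ts, Ts.length ≤ Xs.countP fun X => R t X) :
    ∃ os : List (Option τ), List.Forall₂ (fun X o => ∀ t ∈ o, R t X) Xs os ∧
      os.reduceOption.Perm Ts := by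
  induction Ts generalizing Xs with
  | nil =>
    refine ⟨Xs.map fun _ => none, ?_, ?_⟩
    · rw [List.forall₂_map_right_iff, List.forall₂_same]
      simp
    · induction Xs with
      | nil => simp
      | cons X Xs ih => simp
  | cons t Ts ih =>
    have h0 := h t (by simp)
    have : 0 < Xs.countP fun X => R t X := by
      simp only [List.length_cons] at h0; omega
    rw [List.countP_pos_iff] at this
    obtain ⟨X, hX, hRX⟩ := this
    obtain ⟨a, b, rfl⟩ := List.append_of_mem hX
    obtain ⟨os, h1, h2⟩ := ih (a ++ b) (fun t' ht' => by
      have := h t' (by simp [ht'])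
      simp only [List.countP_append, List.countP_cons, List.length_cons] at this ⊢
      split_ifs at this <;> omega)
    have ha := List.forall₂_take_append _ _ _ h1.flip
    have hb := List.forall₂_drop_append _ _ _ h1.flip
    refine ⟨os.take a.length ++ some t :: os.drop a.length, ?_, ?_⟩
    · refine List.rel_append ha.flip (.cons ?_ hb.flip)
      intro t' ht'
      simp only [Option.mem_def, Option.some.injEq] at ht'
      rw [← ht']
      simpa using hRX
    · rw [List.reduceOption_append, List.reduceOption_cons_of_some]
      refine List.perm_middle.trans (List.Perm.cons _ ?_)
      rw [← List.reduceOption_append, List.take_append_drop]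
      exact h2

open Classical in
theorem exists_assignment_list (R : τ → β → Prop) (Ts : List τ) (Xs : List β)
    (h : ∀ t ∈ Ts, Ts.length ≤ Xs.countP fun X => R t X) :
    ∃ Ys rest : List β, List.Forall₂ R Ts Ys ∧ (Ys ++ rest).Perm Xs := by
  induction Ts generalizing Xs with
  | nil => exact ⟨[], Xs, .nil, by simp⟩
  | cons t Ts ih =>
    have h0 := h t (by simp)
    have : 0 < Xs.countP fun X => R t X := by
      simp only [List.length_cons] at h0; omega
    rw [List.countP_pos_iff] at this
    obtain ⟨X, hX, hRX⟩ := this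
    obtain ⟨a, b, rfl⟩ := List.append_of_mem hX
    obtain ⟨Ys, rest, h1, h2⟩ := ih (a ++ b) (fun t' ht' => by
      have := h t' (by simp [ht'])
      simp only [List.countP_append, List.countP_cons, List.length_cons] at this ⊢
      split_ifs at this <;> omega)
    exact ⟨X :: Ys, rest, .cons (by simpa using hRX) h1, (h2.cons X).trans List.perm_middle.symm⟩

end Greedy

/-! ### Extending small sets to edges -/

section Degree

variable {V : Type*} [Fintype V] [DecidableEq V]

theorem card_extend_ge {E : Finset (Finset V)} {k : ℕ} (hE : ∀ e ∈ E, #e = k) {c₀ : ℝ}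
    (hc₀ : 0 ≤ c₀)
    (hdeg : ∀ S : Finset V, #S = k - 2 → c₀ * (Fintype.card V : ℝ) ^ 2 ≤ #{e ∈ E | S ⊆ e})
    (hn : 2 * k ≤ Fintype.card V) (t : ℕ) (S : Finset V) (hS : #S + (t + 2) = k) :
    c₀ / 2 ^ t * (Fintype.card V : ℝ) ^ (t + 2) ≤
      #{h : Fin (t + 2) → V | S ∪ univ.image h ∈ E} := by
  induction t generalizing S with
  | zero =>
    have h1 := hdeg S (by omega)
    simp only [zero_add, pow_zero, div_one]
    refine h1.trans ?_
    have hex : ∀ e ∈ E, S ⊆ e → ∃ h : Fin 2 → V, S ∪ univ.image h = e := by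
      intro e he hSe
      have h2 : #(e \ S) = 2 := by rw [card_sdiff_of_subset hSe, hE e he]; omega
      obtain ⟨a, b, -, hab⟩ := card_eq_two.1 h2
      refine ⟨![a, b], ?_⟩
      have h3 : univ.image ![a, b] = e \ S := by
        rw [hab]; ext x; simp [Fin.exists_fin_two, eq_comm]
      rw [h3, union_sdiff_of_subset hSe]
    have : Nonempty (Fin 2 → V) := by
      have : 0 < Fintype.card V := by omega
      exact ⟨fun _ => (Fintype.card_pos_iff.1 this).some⟩
    choose! f hf using hex
    have := card_le_card_of_injOn (s := {e ∈ E | S ⊆ e})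
      (t := ({h : Fin 2 → V | S ∪ univ.image h ∈ E} : Finset _)) f (by
        intro e he
        simp only [coe_filter, Set.mem_ofPred_eq, mem_univ, true_and] at he ⊢
        rw [hf e he.1 he.2]; exact he.1) (by
        intro e he e' he' h
        simp only [coe_filter, Set.mem_ofPred_eq] at he he'
        rw [← hf e he.1 he.2, ← hf e' he'.1 he'.2, h])
    exact_mod_cast this
  | succ t ih =>
    set n : ℝ := (Fintype.card V : ℝ) with hnn
    have hinj : (∑ v ∈ Sᶜ, #{h : Fin (t + 2) → V | insert v S ∪ univ.image h ∈ E}) ≤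
        #{h : Fin (t + 1 + 2) → V | S ∪ univ.image h ∈ E} := by
      rw [← card_sigma]
      refine card_le_card_of_injOn (fun x => Fin.cons (α := fun _ => V) x.1 x.2) ?_ ?_
      · rintro ⟨v, h⟩ hx
        simp only [coe_sigma, Set.mem_sigma_iff, mem_coe, mem_filter, mem_univ, true_and] at hx ⊢
        have : S ∪ univ.image (Fin.cons (α := fun _ => V) v h) = insert v S ∪ univ.image h := by
          ext x
          simp only [mem_union, mem_image, mem_univ, true_and, mem_insert, Fin.exists_fin_succ,
            Fin.cons_zero, Fin.cons_succ]
          tauto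
        rw [this]; exact hx.2
      · rintro ⟨v, h⟩ - ⟨v', h'⟩ - heq
        have h1 := congrFun heq 0
        simp only [Fin.cons_zero] at h1
        subst h1
        have h2 : h = h' := Fin.cons_right_injective (α := fun _ => V) v heq
        rw [h2]
    have h1 : (n / 2) * (c₀ / 2 ^ t * n ^ (t + 2)) ≤
        ∑ v ∈ Sᶜ, (#{h : Fin (t + 2) → V | insert v S ∪ univ.image h ∈ E} : ℝ) := by
      have h2 : ∀ v ∈ Sᶜ, c₀ / 2 ^ t * n ^ (t + 2) ≤
          (#{h : Fin (t + 2) → V | insert v S ∪ univ.image h ∈ E} : ℝ) := by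
        intro v hv
        refine ih (insert v S) ?_
        rw [card_insert_of_notMem (by simpa using hv)]
        omega
      refine le_trans ?_ (card_nsmul_le_sum _ _ _ h2)
      rw [nsmul_eq_mul]
      have h3 : n / 2 ≤ (#Sᶜ : ℝ) := by
        rw [card_compl, Nat.cast_sub (card_le_univ _)]
        have : 2 * (#S : ℝ) ≤ n := by
          have : 2 * #S ≤ Fintype.card V := by omega
          simp only [n]; exact_mod_cast this
        linarith
      gcongr
    have h2 : (∑ v ∈ Sᶜ, (#{h : Fin (t + 2) → V | insert v S ∪ univ.image h ∈ E} : ℝ)) ≤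
        #{h : Fin (t + 1 + 2) → V | S ∪ univ.image h ∈ E} := by exact_mod_cast hinj
    refine le_trans (le_of_eq ?_) (h1.trans h2)
    rw [pow_succ 2 t]
    field_simp
    ring

theorem card_extend_list_ge {E : Finset (Finset V)} {k : ℕ} (hE : ∀ e ∈ E, #e = k) {c₀ : ℝ}
    (hc₀ : 0 ≤ c₀)
    (hdeg : ∀ S : Finset V, #S = k - 2 → c₀ * (Fintype.card V : ℝ) ^ 2 ≤ #{e ∈ E | S ⊆ e})
    (hn : 2 * k ≤ Fintype.card V) (t : ℕ) (ht : 2 ≤ t) (X : List V) (hX : X.Nodup)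
    (hXt : X.length + t = k) :
    c₀ / 2 ^ k * (Fintype.card V : ℝ) ^ t ≤
      #{h : Fin t → V | (X ++ List.ofFn h).toFinset ∈ E} := by
  obtain ⟨t, rfl⟩ := Nat.exists_eq_add_of_le' ht
  have h := card_extend_ge hE hc₀ hdeg hn t X.toFinset (by
    rw [List.toFinset_card_of_nodup hX]; exact hXt)
  have h2 : ∀ h : Fin (t + 2) → V, (X ++ List.ofFn h).toFinset = X.toFinset ∪ univ.image h := by
    intro h; ext x; simp only [List.toFinset_append, mem_union, List.mem_toFinset, List.mem_ofFn,
      mem_image, mem_univ, true_and]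
  simp only [h2]
  refine le_trans ?_ h
  gcongr
  · norm_num
  · omega

/-- Double counting for tuples indexed by a sum type. -/
theorem card_sum_tuples_ge {ι₁ ι₂ : Type*} [Fintype ι₁] [DecidableEq ι₁] [Fintype ι₂]
    [DecidableEq ι₂] (G : Finset (ι₁ ⊕ ι₂ → V)) (S : Finset (ι₁ → V)) {a b : ℝ}
    (hb : 0 ≤ b)
    (hS : a * (Fintype.card V : ℝ) ^ Fintype.card ι₁ ≤ #S)
    (hG : ∀ u ∈ S, b * (Fintype.card V : ℝ) ^ Fintype.card ι₂ ≤
      #{w : ι₂ → V | Sum.elim u w ∈ G}) :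
    a * b * (Fintype.card V : ℝ) ^ Fintype.card (ι₁ ⊕ ι₂) ≤ #G := by
  have hinj : ∑ u ∈ S, #{w : ι₂ → V | Sum.elim u w ∈ G} ≤ #G := by
    rw [← card_sigma]
    refine card_le_card_of_injOn (fun x => Sum.elim x.1 x.2) ?_ ?_
    · rintro ⟨u, w⟩ hx
      simp only [coe_sigma, Set.mem_sigma_iff, mem_coe, mem_filter, mem_univ, true_and] at hx
      exact hx.2
    · rintro ⟨u, w⟩ - ⟨u', w'⟩ - h
      have h1 : u = u' := by
        funext i; simpa using congrFun h (Sum.inl i)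
      have h2 : w = w' := by
        funext i; simpa using congrFun h (Sum.inr i)
      rw [h1, h2]
  have h2 : (∑ u ∈ S, (#{w : ι₂ → V | Sum.elim u w ∈ G} : ℝ)) ≤ #G := by exact_mod_cast hinj
  refine le_trans ?_ h2
  refine le_trans ?_ (card_nsmul_le_sum _ _ _ hG)
  rw [nsmul_eq_mul, Fintype.card_sum, pow_add]
  calc _ = (a * (Fintype.card V : ℝ) ^ Fintype.card ι₁) *
        (b * (Fintype.card V : ℝ) ^ Fintype.card ι₂) := by ring
    _ ≤ _ := by gcongr

end Degree

/-! ### Connecting two overlaps -/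

section Connect

variable {V : Type*} [Fintype V] [DecidableEq V] {k l : ℕ}

/-- The entries of the list form an edge. -/
def EdgeList (E : Finset (Finset V)) (w : List V) : Prop := w.toFinset ∈ E

theorem EdgeList.perm {E : Finset (Finset V)} {w w' : List V} (h : EdgeList E w)
    (hp : w.Perm w') : EdgeList E w' := by
  rw [EdgeList] at *; rwa [← List.toFinset_eq_of_perm _ _ hp]

theorem isPath_cons_block {α : Type*} {Q : List α → Prop} (hlk : l < k) {o mid o' r : List α}
    (hom : o.length + mid.length = k - l) (ho' : o'.length = l) (hQ : Q (o ++ mid ++ o'))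
    (hr : IsPath k l Q (o' ++ r)) : IsPath k l Q (o ++ (mid ++ (o' ++ r))) := by
  have h1 : IsPath k l Q ((o ++ mid) ++ o') := (isSeg_edge hlk (by simp; omega) hQ).2
  have := h1.append hlk ho' (by simp [hom]) hr
  simpa using this

/-- The window condition for lists of fixed vertices and classes. -/
def ClassEdge {ι : Type*} (E : Finset (Finset V)) (G : Finset (ι → V)) (w : List (V ⊕ ι)) : Prop :=
  w.Nodup ∧ ∀ z ∈ G, EdgeList E (w.map (Sum.elim id z))

theorem IsBlowup.isPath {ι κ : Type*} {E : Finset (Finset V)} {G : Finset (ι → V)} {c : κ → ι}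
    {C : κ → V} (hC : IsBlowup G c C) (L : List (V ⊕ κ))
    (hL : IsPath k l (ClassEdge E G) (L.map (Sum.map id c))) :
    IsPath k l (EdgeList E) (L.map (Sum.elim id C)) := by
  rw [isPath_map] at hL ⊢
  refine hL.mono fun w _ hw => ?_
  have h1 : ((w.filterMap Sum.getRight?).map c).Nodup := by
    have h2 := hw.1.filterMap (f := Sum.getRight?) (by
      intro a a' b hb hb'
      cases a <;> cases a' <;> simp_all)
    rw [List.filterMap_map] at h2
    rw [List.map_filterMap]
    convert h2 using 2
    rename_i x _
    cases x <;> rfl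
  obtain ⟨z, hz, hz'⟩ := hC.list _ h1
  have h3 := hw.2 z hz
  rw [List.map_map] at h3
  convert h3 using 1
  refine List.map_congr_left fun x hx => ?_
  cases x with
  | inl v => rfl
  | inr p =>
    simp only [Sum.elim_inr, Function.comp_apply, Sum.map_inr]
    exact hz' p (by simpa [List.mem_filterMap] using hx)

end Connect

section ConnectorClasses

variable {V : Type*} [Fintype V] [DecidableEq V]

theorem EdgeList.congr {E : Finset (Finset V)} {w w' : List V} (h : EdgeList E w)
    (hp : ∀ x, x ∈ w ↔ x ∈ w') : EdgeList E w' := by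
  have : w.toFinset = w'.toFinset := by ext x; simp [hp]
  rw [EdgeList] at *; rwa [← this]

theorem EdgeList.nodup {E : Finset (Finset V)} {k : ℕ} (hE : ∀ e ∈ E, #e = k) {w : List V}
    (h : EdgeList E w) (hw : w.length = k) : w.Nodup := by
  have h1 := hE _ h
  rw [List.card_toFinset, ← hw] at h1
  have h2 : w.dedup = w := (List.dedup_sublist w).eq_of_length h1
  rw [← h2]; exact List.nodup_dedup w

/-- Index type of the vertices a connector is made of. -/
abbrev ConnIdx (j : ℕ) := Fin (j + 2) ⊕ Fin (j + 2) ⊕ Fin 2 ⊕ Fin (j + 1)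

/-- The order in which a connector visits its classes. -/
def connClasses (j : ℕ) : List (ConnIdx j) :=
  let u : Fin (j + 2) → ConnIdx j := Sum.inl
  let v : Fin (j + 2) → ConnIdx j := fun i => Sum.inr (Sum.inl i)
  let q : Fin 2 → ConnIdx j := fun i => Sum.inr (Sum.inr (Sum.inl i))
  let h : Fin (j + 1) → ConnIdx j := fun i => Sum.inr (Sum.inr (Sum.inr i))
  let us := List.ofFn fun i : Fin j => u i.succ.succ
  let vs := List.ofFn fun i : Fin j => v i.succ.succ
  [u 0] ++ ((u 1 :: us) ++ ([q 1] ++ ((q 0 :: vs) ++ ([u 1] ++ ((q 1 :: us) ++ ([q 0] ++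
    ((u 1 :: vs) ++ ([v 1] ++ (List.ofFn h ++ ([u 1] ++ ((v 1 :: vs) ++ [v 0])))))))))))

/-- The base systems from which connectors are cloned. -/
def ConnBase {j : ℕ} (E : Finset (Finset V)) (A B : List V) (z : ConnIdx j → V) : Prop :=
  let u : Fin (j + 2) → V := fun i => z (Sum.inl i)
  let v : Fin (j + 2) → V := fun i => z (Sum.inr (Sum.inl i))
  let q : Fin 2 → V := fun i => z (Sum.inr (Sum.inr (Sum.inl i)))
  let h : Fin (j + 1) → V := fun i => z (Sum.inr (Sum.inr (Sum.inr i)))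
  EdgeList E (A ++ List.ofFn u) ∧ EdgeList E (B ++ List.ofFn v) ∧
  EdgeList E ((List.ofFn (fun i : Fin (j + 1) => u i.succ) ++
    List.ofFn fun i : Fin j => v i.succ.succ) ++ List.ofFn q) ∧
  EdgeList E ((u 1 :: List.ofFn (fun i : Fin (j + 1) => v i.succ)) ++ List.ofFn h)

set_option maxHeartbeats 2000000 in
theorem isPath_connClasses {j : ℕ} {E : Finset (Finset V)} {A B : List V}
    (hA : A.length = j + 1) (hB : B.length = j + 1) (hAn : A.Nodup) (hBn : B.Nodup)
    (G : Finset (ConnIdx j → V)) (hG : ∀ z ∈ G, ConnBase E A B z) :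
    IsPath (2 * j + 3) (j + 1) (ClassEdge E G)
      (A.map Sum.inl ++ ((connClasses j).map Sum.inr ++ B.map Sum.inl)) := by
  have hAi := hAn.map (Sum.inl_injective (α := V) (β := ConnIdx j))
  have hBi := hBn.map (Sum.inl_injective (α := V) (β := ConnIdx j))
  simp only [connClasses, List.map_append, List.map_cons, List.map_nil, List.append_assoc,
    List.map_ofFn]
  refine isPath_cons_block (by omega) (by simp [hA]; omega) (by simp) ⟨?_, fun z hz => ?_⟩ ?_
  rotate_left 2
  refine isPath_cons_block (by omega) (by simp; omega) (by simp) ⟨?_, fun z hz => ?_⟩ ?_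
  rotate_left 2
  refine isPath_cons_block (by omega) (by simp; omega) (by simp) ⟨?_, fun z hz => ?_⟩ ?_
  rotate_left 2
  refine isPath_cons_block (by omega) (by simp; omega) (by simp) ⟨?_, fun z hz => ?_⟩ ?_
  rotate_left 2
  refine isPath_cons_block (by omega) (by simp; omega) (by simp) ⟨?_, fun z hz => ?_⟩ ?_
  rotate_left 2
  refine isPath_cons_block (by omega) (by simp; omega) (by simp) ⟨?_, fun z hz => ?_⟩ ?_
  rotate_left 2
  rw [← List.append_nil (B.map Sum.inl)]
  refine isPath_cons_block (by omega) (by simp; omega) (by simp [hB]) ⟨?_, fun z hz => ?_⟩ ?_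
  rotate_left 2
  · exact isPath_of_length_lt (by simp [hB]; omega)
  all_goals first
    | (have hGz := hG z hz
       dsimp only [ConnBase] at hGz
       obtain ⟨h1, h2, h3, h4⟩ := hGz
       first
        | (refine h1.congr fun x => ?_
           simp [List.mem_ofFn, eq_comm]; done)
        | (refine h1.congr fun x => ?_
           simp [List.mem_ofFn, eq_comm]; tauto)
        | (refine h2.congr fun x => ?_
           simp [List.mem_ofFn, eq_comm]; tauto)
        | (refine h3.congr fun x => ?_
           simp [List.mem_ofFn, eq_comm]; tauto)
        | (refine h4.congr fun x => ?_
           simp [List.mem_ofFn, eq_comm]; tauto))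
    | simp [List.nodup_append, List.nodup_ofFn, Function.Injective, hAi, hBi, Fin.ext_iff]

end ConnectorClasses

section Connectors

variable {V : Type*} [Fintype V] [DecidableEq V]

open Classical in
theorem card_connBase_ge {j : ℕ} (hj : 1 ≤ j) [Nonempty V] {E : Finset (Finset V)}
    (hE : ∀ e ∈ E, #e = 2 * j + 3) {c₀ : ℝ} (hc₀ : 0 < c₀)
    (hdeg : ∀ S : Finset V, #S = 2 * j + 3 - 2 →
      c₀ * (Fintype.card V : ℝ) ^ 2 ≤ #{e ∈ E | S ⊆ e})
    (hn : 2 * (2 * j + 3) ≤ Fintype.card V)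
    (hn2 : ((j : ℝ) + 2) * (j + 2 + (j + 2)) ≤ c₀ / 2 ^ (2 * j + 3) / 2 * Fintype.card V)
    {A B : List V} (hA : A.length = j + 1) (hB : B.length = j + 1) (hAn : A.Nodup)
    (hBn : B.Nodup) :
    (c₀ / 2 ^ (2 * j + 3)) * ((c₀ / 2 ^ (2 * j + 3) / 2) *
      ((c₀ / 2 ^ (2 * j + 3)) * (c₀ / 2 ^ (2 * j + 3)))) *
        (Fintype.card V : ℝ) ^ Fintype.card (ConnIdx j) ≤
      #{z : ConnIdx j → V | ConnBase E A B z} := by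
  have hext := card_extend_list_ge hE hc₀.le hdeg hn
  set c₁ := c₀ / 2 ^ (2 * j + 3) with hc₁
  have hc1 : 0 < c₁ := by positivity
  refine card_sum_tuples_ge _ {u | EdgeList E (A ++ List.ofFn u)} (by positivity) ?_ ?_
  · simpa [EdgeList] using hext (j + 2) (by omega) A hAn (by omega)
  intro u hu
  simp only [mem_filter, mem_univ, true_and] at hu
  have hun : (List.ofFn u).Nodup :=
    ((hu.nodup hE (by simp [hA]; omega)).of_append_right)
  refine card_sum_tuples_ge _ {v ∈ ({v | EdgeList E (B ++ List.ofFn v)} : Finset _) |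
    Function.Injective v ∧ ∀ p, v p ∉ (List.ofFn u).toFinset} (by positivity) ?_ ?_
  · have h1 := card_good_tuples_ge (List.ofFn u).toFinset
      ({v | EdgeList E (B ++ List.ofFn v)} : Finset (Fin (j + 2) → V)) (α := c₁) (α' := c₁ / 2)
      (by simpa [EdgeList] using hext (j + 2) (by omega) B hBn (by omega)) (by
        refine le_trans ?_ hn2
        have : (#(List.ofFn u).toFinset : ℝ) ≤ j + 2 := by
          have := List.toFinset_card_le (List.ofFn u)
          rw [List.length_ofFn] at this
          exact_mod_cast this
        simp only [Fintype.card_fin, Nat.cast_add, Nat.cast_ofNat]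
        gcongr)
    rw [sub_half] at h1
    convert h1
  intro v hv
  simp only [mem_filter, mem_univ, true_and] at hv
  obtain ⟨hv, hvi, hvu⟩ := hv
  have hvu : ∀ p q, u q ≠ v p := by
    intro p q h
    exact hvu p (by simp only [List.mem_toFinset, List.mem_ofFn]; exact ⟨q, h⟩)
  have hui : Function.Injective u := List.nodup_ofFn.1 hun
  refine card_sum_tuples_ge _ {q | EdgeList E ((List.ofFn (fun i : Fin (j + 1) => u i.succ) ++
    List.ofFn fun i : Fin j => v i.succ.succ) ++ List.ofFn q)} (by positivity) ?_ ?_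
  · have h1 := hext 2 le_rfl (List.ofFn (fun i : Fin (j + 1) => u i.succ) ++
      List.ofFn fun i : Fin j => v i.succ.succ) ?_ ?_
    · rw [Fintype.card_fin]
      convert h1
      rfl
    · rw [List.nodup_append']
      refine ⟨List.nodup_ofFn.2 (hui.comp (Fin.succ_injective _)),
        List.nodup_ofFn.2 (hvi.comp ((Fin.succ_injective _).comp (Fin.succ_injective _))), ?_⟩
      intro x hx hx'
      simp only [List.mem_ofFn] at hx hx'
      obtain ⟨a, rfl⟩ := hx
      obtain ⟨b, hb⟩ := hx'
      exact hvu _ _ hb.symm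
    · simp; omega
  intro q hq
  simp only [mem_filter, mem_univ, true_and] at hq
  have h1 := hext (j + 1) (by omega) (u 1 :: List.ofFn (fun i : Fin (j + 1) => v i.succ)) ?_ ?_
  · rw [Fintype.card_fin]
    refine h1.trans (Nat.cast_le.2 (card_le_card fun h hh => ?_))
    simp only [mem_filter, mem_univ, true_and] at hh ⊢
    exact ⟨hu, hv, hq, hh⟩
  · rw [List.nodup_cons]
    refine ⟨?_, List.nodup_ofFn.2 (hvi.comp (Fin.succ_injective _))⟩
    simp only [List.mem_ofFn, not_exists]
    exact fun i h => hvu _ _ h.symm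
  · simp; omega

/-- Any two disjoint overlaps are joined by many connectors of the same length. -/
theorem exists_connectors {k l : ℕ} (hk : 4 ≤ k) (hl1 : 1 ≤ l) (hl2 : 2 * l < k) {c₀ : ℝ}
    (hc₀ : 0 < c₀) :
    ∃ s q : ℕ, s + l = q * (k - l) ∧ ∃ α : ℝ, 0 < α ∧ ∃ n₀ : ℕ,
      ∀ (V : Type) [Fintype V] [DecidableEq V] (E : Finset (Finset V)),
        n₀ ≤ Fintype.card V → (∀ e ∈ E, #e = k) →
        (∀ S : Finset V, #S = k - 2 → c₀ * (Fintype.card V : ℝ) ^ 2 ≤ #{e ∈ E | S ⊆ e}) →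
        ∀ A B : List V, A.length = l → B.length = l → A.Nodup → B.Nodup → A.Disjoint B →
          ∃ G : Finset (Fin s → V), α * (Fintype.card V : ℝ) ^ Fintype.card (Fin s) ≤ #G ∧
            ∀ C ∈ G, IsSeg k l (EdgeList E) (A ++ List.ofFn C ++ B) := by
  rcases le_or_gt (2 * l) (k - 2) with h | h
  · refine ⟨k - 2 * l, 1, by omega, c₀ / 2 ^ k, by positivity, 2 * k, ?_⟩
    intro V _ _ E hn hE hdeg A B hA hB hAn hBn hAB
    have h1 := card_extend_list_ge hE hc₀.le hdeg hn (k - 2 * l) (by omega) (A ++ B)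
      (hAn.append hBn hAB) (by simp; omega)
    refine ⟨_, by rw [Fintype.card_fin]; exact h1, fun C hC => ?_⟩
    simp only [mem_filter, mem_univ, true_and] at hC
    refine isSeg_edge (by omega) (by simp; omega) (EdgeList.perm hC ?_)
    rw [List.append_assoc, List.append_assoc]
    exact List.Perm.append_left _ List.perm_append_comm
  · obtain ⟨j, rfl⟩ := Nat.exists_eq_add_of_le' hl1
    obtain rfl : k = 2 * j + 3 := by omega
    set c₁ := c₀ / 2 ^ (2 * j + 3) with hc₁
    set d := c₁ * ((c₁ / 2) * (c₁ * c₁)) with hd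
    have hlen : (connClasses j).length = 6 * j + 13 := by
      simp [connClasses]; ring
    refine ⟨(connClasses j).length, 7, by rw [hlen]; omega,
      d ^ 2 ^ Fintype.card (Fin (connClasses j).length), by positivity,
      max (2 * (2 * j + 3)) ⌈((j : ℝ) + 2) * (j + 2 + (j + 2)) / (c₁ / 2)⌉₊, ?_⟩
    intro V _ _ E hn hE hdeg A B hA hB hAn hBn hAB
    have hn1 := (le_max_left _ _).trans hn
    have hn2 := (le_max_right _ _).trans hn
    have : Nonempty V := Fintype.card_pos_iff.1 (by omega)
    have hn2 := Nat.ceil_le.1 hn2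
    rw [div_le_iff₀ (by positivity), mul_comm (Fintype.card V : ℝ)] at hn2
    classical
    have hG := card_connBase_ge (by omega) hE hc₀ hdeg hn1 hn2 hA hB hAn hBn
    set G : Finset (ConnIdx j → V) := {z : ConnIdx j → V | ConnBase E A B z} with hGdef
    refine ⟨_, card_isBlowup_ge G (by positivity) hG (connClasses j).get, fun C hC => ?_⟩
    simp only [mem_filter, mem_univ, true_and] at hC
    have h1 := isPath_connClasses hA hB hAn hBn G (fun z hz => (mem_filter.1 hz).2)
    have h2 := hC.isPath (k := 2 * j + 3) (l := j + 1) (E := E)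
      (A.map Sum.inl ++ ((List.finRange _).map Sum.inr ++ B.map Sum.inl)) (by
        have h3 : (connClasses j).map (Sum.inr : _ → V ⊕ ConnIdx j) =
            ((List.finRange _).map (connClasses j).get).map Sum.inr := by
          rw [← List.ofFn_eq_map, List.ofFn_get]
        rw [h3, List.map_map] at h1
        rw [List.map_append, List.map_append, List.map_map, List.map_map, List.map_map]
        exact h1)
    refine ⟨⟨7, by simp [hA, hB, hlen]; omega⟩, ?_⟩
    simpa [List.map_append, List.ofFn_eq_map] using h2

end Connectors

/-! ### Good vertices and switchers -/

section AbsorbCounting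

variable {V : Type*} [Fintype V] [DecidableEq V]

open Classical in
theorem card_extend_tuple_ge {E : Finset (Finset V)} {k : ℕ} (hE : ∀ e ∈ E, #e = k) {c₀ : ℝ}
    (hc₀ : 0 ≤ c₀)
    (hdeg : ∀ S : Finset V, #S = k - 2 → c₀ * (Fintype.card V : ℝ) ^ 2 ≤ #{e ∈ E | S ⊆ e})
    (hn : 2 * k ≤ Fintype.card V) {τ : Type*} [Fintype τ] [DecidableEq τ]
    (ht : 2 ≤ Fintype.card τ) (X : List V)
    (hX : X.Nodup) (hXt : X.length + Fintype.card τ = k) :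
    c₀ / 2 ^ k * (Fintype.card V : ℝ) ^ Fintype.card τ ≤
      #{h : τ → V | EdgeList E (X ++ tupList h)} := by
  refine (card_extend_list_ge hE hc₀ hdeg hn _ ht X hX hXt).trans (Nat.cast_le.2 ?_)
  let e := Fintype.equivFin τ
  refine card_le_card_of_injOn (fun h => h ∘ e) ?_ ?_
  · intro h hh
    simp only [coe_filter, mem_univ, true_and, Set.mem_ofPred_eq] at hh ⊢
    refine EdgeList.congr (w := X ++ List.ofFn h) hh fun x => ?_
    simp only [List.mem_append, List.mem_ofFn, mem_tupList, Function.comp_apply]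
    rw [e.surjective.exists]
  · intro h _ h' _ heq
    funext i
    have := congrFun heq (e.symm i)
    simpa using this

variable {τ : Type*} [Fintype τ] [DecidableEq τ]

open Classical in
/-- Number of vertices completing `y` and `g` to an edge. -/
noncomputable def codeg (E : Finset (Finset V)) (y : V) (g : τ → V) : ℕ :=
  #{b | EdgeList E (b :: y :: tupList g)}

open Classical in
/-- Pairs forming an edge with `t` although they are in few edges. -/
noncomputable def thinPairs (τ : Type*) [Fintype τ] [DecidableEq τ] (E : Finset (Finset V)) (δ : ℝ)
    (t : V) : Finset ((τ → V) × V) :=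
  {p | EdgeList E (t :: p.2 :: tupList p.1) ∧ (codeg E p.2 p.1 : ℝ) < δ * Fintype.card V}

theorem sum_card_thinPairs_le (E : Finset (Finset V)) {δ : ℝ} (hδ : 0 ≤ δ) :
    ∑ t, (#(thinPairs τ E δ t) : ℝ) ≤
      δ * Fintype.card V * (Fintype.card V : ℝ) ^ (Fintype.card τ + 1) := by
  classical
  have h1 : ∀ t, (#(thinPairs τ E δ t) : ℝ) = ∑ p : (τ → V) × V,
      if EdgeList E (t :: p.2 :: tupList p.1) ∧ (codeg E p.2 p.1 : ℝ) < δ * Fintype.card V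
      then (1 : ℝ) else 0 := fun t => by
    rw [sum_boole, thinPairs]
  simp only [h1]
  rw [sum_comm]
  have h2 : ∀ p : (τ → V) × V, (∑ t, if EdgeList E (t :: p.2 :: tupList p.1) ∧
      (codeg E p.2 p.1 : ℝ) < δ * Fintype.card V then (1 : ℝ) else 0) ≤ δ * Fintype.card V := by
    intro p
    by_cases h : (codeg E p.2 p.1 : ℝ) < δ * Fintype.card V
    · simp only [h, and_true]
      rw [sum_boole]
      exact h.le
    · simp only [h, and_false, if_false, sum_const_zero]; positivity
  refine (sum_le_sum fun p _ => h2 p).trans (le_of_eq ?_)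
  simp [pow_succ]; ring

open Classical in
/-- Vertices in too many thin pairs. -/
noncomputable def thinVertices (τ : Type*) [Fintype τ] [DecidableEq τ] (E : Finset (Finset V))
    (δ : ℝ) : Finset V :=
  {t | δ * (Fintype.card V : ℝ) ^ (Fintype.card τ + 1) < #(thinPairs τ E (δ ^ 2) t)}

theorem card_thinVertices_le [Nonempty V] (E : Finset (Finset V)) {δ : ℝ} (hδ : 0 < δ) :
    (#(thinVertices τ E δ) : ℝ) ≤ δ * Fintype.card V := by
  classical
  have hn : (0 : ℝ) < Fintype.card V := by simp [Fintype.card_pos]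
  have h1 := sum_card_thinPairs_le (τ := τ) E (sq_nonneg δ)
  have h2 : #(thinVertices τ E δ) * (δ * (Fintype.card V : ℝ) ^ (Fintype.card τ + 1)) ≤
      ∑ t, (#(thinPairs τ E (δ ^ 2) t) : ℝ) := by
    rw [← nsmul_eq_mul]
    refine (card_nsmul_le_sum (thinVertices τ E δ)
      (fun t => (#(thinPairs τ E (δ ^ 2) t) : ℝ)) _ fun t ht => ?_).trans
      (sum_le_univ_sum_of_nonneg fun _ => by positivity)
    rw [thinVertices, mem_filter] at ht
    exact ht.2.le
  have h3 := h2.trans h1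
  have h4 : (0 : ℝ) < δ * (Fintype.card V : ℝ) ^ (Fintype.card τ + 1) := by positivity
  refine le_of_mul_le_mul_right (h3.trans (le_of_eq ?_)) h4
  ring

open Classical in
/-- Tuples through which `t` and `y` may be exchanged. -/
noncomputable def switchers (E : Finset (Finset V)) (t y : V) : Finset (τ ⊕ Unit → V) :=
  {h | EdgeList E (t :: y :: tupList (fun i => h (Sum.inl i))) ∧
    EdgeList E (h (Sum.inr ()) :: y :: tupList fun i => h (Sum.inl i))}

open Classical in
/-- Vertices that can hardly be exchanged with `t`. -/
noncomputable def rigidFor (τ : Type*) [Fintype τ] [DecidableEq τ] (E : Finset (Finset V)) (ρ : ℝ)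
    (t : V) : Finset V :=
  {y | (#(switchers (τ := τ) E t y) : ℝ) <
    ρ * (Fintype.card V : ℝ) ^ Fintype.card (τ ⊕ Unit)}

theorem card_rigidFor_le [Nonempty V] {E : Finset (Finset V)} {c₁ δ : ℝ} (hc₁ : 0 < c₁)
    (hδ : 0 < δ) {t : V} (ht : t ∉ thinVertices τ E δ)
    (hext : ∀ y, y ≠ t → c₁ * (Fintype.card V : ℝ) ^ Fintype.card τ ≤
      #(by classical exact {h : τ → V | EdgeList E ([t, y] ++ tupList h)})) :
    (#(rigidFor τ E (c₁ * δ ^ 2 / 2) t) : ℝ) ≤ 2 * δ / c₁ * Fintype.card V + 1 := by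
  classical
  set n : ℝ := (Fintype.card V : ℝ) with hnn
  have hn : (0 : ℝ) < n := by simp [n, Fintype.card_pos]
  set R := rigidFor τ E (c₁ * δ ^ 2 / 2) t with hR
  have h1 : ∀ y ∈ R.erase t, c₁ / 2 * n ^ Fintype.card τ ≤
      #{g : τ → V | EdgeList E (t :: y :: tupList g) ∧ (codeg E y g : ℝ) < δ ^ 2 * n} := by
    intro y hy
    rw [mem_erase, hR, rigidFor, mem_filter] at hy
    obtain ⟨hyt, -, hy⟩ := hy
    by_contra! hlt
    have h2 := hext y hyt
    have h3 : (#{h : τ → V | EdgeList E ([t, y] ++ tupList h)} : ℝ) =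
        #{g : τ → V | EdgeList E (t :: y :: tupList g) ∧ (codeg E y g : ℝ) < δ ^ 2 * n} +
        #{g : τ → V | EdgeList E (t :: y :: tupList g) ∧ ¬ (codeg E y g : ℝ) < δ ^ 2 * n} := by
      rw [← Nat.cast_add, ← filter_filter, ← filter_filter, card_filter_add_card_filter_not]
      rfl
    have h4 : c₁ / 2 * n ^ Fintype.card τ ≤
        #{g : τ → V | EdgeList E (t :: y :: tupList g) ∧ ¬ (codeg E y g : ℝ) < δ ^ 2 * n} := by
      have : c₁ * n ^ Fintype.card τ ≤ (#{h : τ → V | EdgeList E ([t, y] ++ tupList h)} : ℝ) := by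
        convert h2
      linarith
    have h5 := card_sum_tuples_ge (switchers (τ := τ) E t y) _ (a := c₁ / 2) (b := δ ^ 2)
      (by positivity) h4 (by
        intro g hg
        simp only [mem_filter, mem_univ, true_and, not_lt] at hg
        refine le_trans (by simpa using hg.2) (Nat.cast_le.2 ?_)
        refine card_le_card_of_injOn (fun b _ => b) ?_ ?_
        · intro b hb
          simp only [coe_filter, mem_univ, true_and, Set.mem_ofPred_eq] at hb
          simp only [switchers, coe_filter, mem_filter, mem_univ, true_and, Set.mem_ofPred_eq]
          exact ⟨hg.1, hb⟩
        · intro b _ b' _ h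
          exact congrFun h ())
    rw [show c₁ * δ ^ 2 / 2 = c₁ / 2 * δ ^ 2 by ring] at hy
    exact absurd h5 (not_le.2 hy)
  have h2 : #(R.erase t) * (c₁ / 2 * n ^ Fintype.card τ) ≤ #(thinPairs τ E (δ ^ 2) t) := by
    rw [← nsmul_eq_mul]
    refine (card_nsmul_le_sum _ _ _ h1).trans ?_
    rw [← Nat.cast_sum, ← card_sigma]
    refine Nat.cast_le.2 (card_le_card_of_injOn (fun p => (p.2, p.1)) ?_ ?_)
    · rintro ⟨y, g⟩ hp
      simp only [coe_sigma, Set.mem_sigma_iff, mem_coe, mem_filter, mem_univ, true_and] at hp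
      simp only [thinPairs, mem_coe, mem_filter, mem_univ, true_and]
      exact hp.2
    · rintro ⟨y, g⟩ - ⟨y', g'⟩ - h
      simp only [Prod.mk.injEq] at h
      rw [h.1, h.2]
  have h3 : (#(thinPairs τ E (δ ^ 2) t) : ℝ) ≤ δ * n ^ (Fintype.card τ + 1) := by
    simpa [thinVertices] using ht
  have h4 : (#(R.erase t) : ℝ) ≤ 2 * δ / c₁ * n := by
    have h5 : (0 : ℝ) < c₁ / 2 * n ^ Fintype.card τ := by positivity
    refine le_of_mul_le_mul_right ((h2.trans h3).trans (le_of_eq ?_)) h5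
    field_simp
    ring
  have h5 : #R ≤ #(R.erase t) + 1 := by
    have := pred_card_le_card_erase (s := R) (a := t)
    omega
  have h6 : (#R : ℝ) ≤ #(R.erase t) + 1 := by exact_mod_cast h5
  linarith

open Classical in
/-- An edge together with switchers exchanging its entries with prescribed vertices. -/
noncomputable def absorbBase (τ : Type*) [Fintype τ] [DecidableEq τ] (E : Finset (Finset V))
    {k M : ℕ} (jj : Fin M → Fin k) (T : Fin M → V) :
    Finset (Fin k ⊕ (Fin M × (τ ⊕ Unit)) → V) :=
  {z | EdgeList E (tupList fun j => z (Sum.inl j)) ∧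
    ∀ i, (fun x => z (Sum.inr (i, x))) ∈ switchers E (T i) (z (Sum.inl (jj i)))}

theorem card_absorbBase_ge [Nonempty V] {E : Finset (Finset V)} {k M : ℕ} {c₁ ρ η : ℝ}
    (hρ : 0 < ρ) (jj : Fin M → Fin k) (T : Fin M → V)
    (hEk : c₁ * (Fintype.card V : ℝ) ^ k ≤
      #(by classical exact {h : Fin k → V | EdgeList E (tupList h)}))
    (hT : ∀ i, (#(rigidFor τ E ρ (T i)) : ℝ) ≤ η * Fintype.card V)
    (hη : (k : ℝ) * (M * η * Fintype.card V + k) ≤ c₁ / 2 * Fintype.card V) :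
    c₁ / 2 * ρ ^ M * (Fintype.card V : ℝ) ^ Fintype.card (Fin k ⊕ (Fin M × (τ ⊕ Unit))) ≤
      #(absorbBase τ E jj T) := by
  classical
  set F : Finset V := univ.biUnion fun i => rigidFor τ E ρ (T i) with hF
  have hFc : (#F : ℝ) ≤ M * η * Fintype.card V := by
    have : #F ≤ ∑ i, #(rigidFor τ E ρ (T i)) := card_biUnion_le
    have h2 : (#F : ℝ) ≤ ∑ i, (#(rigidFor τ E ρ (T i)) : ℝ) := by exact_mod_cast this
    refine h2.trans ((sum_le_sum fun i _ => hT i).trans ?_)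
    simp [mul_assoc]
  have h1 := card_good_tuples_ge F ({h : Fin k → V | EdgeList E (tupList h)} : Finset _)
    (α := c₁) (α' := c₁ / 2) (by rw [Fintype.card_fin]; convert hEk) (by
      refine le_trans ?_ hη
      rw [Fintype.card_fin]
      gcongr)
  rw [sub_half] at h1
  refine card_sum_tuples_ge _ _ (by positivity) h1 fun z hz => ?_
  simp only [mem_filter, mem_univ, true_and] at hz
  obtain ⟨hzE, -, hzF⟩ := hz
  have h2 : ∀ i, ρ * (Fintype.card V : ℝ) ^ Fintype.card (τ ⊕ Unit) ≤
      #(switchers (τ := τ) E (T i) (z (jj i))) := by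
    intro i
    have h3 : z (jj i) ∉ rigidFor τ E ρ (T i) := fun h =>
      hzF (jj i) (mem_biUnion.2 ⟨i, mem_univ _, h⟩)
    simpa [rigidFor] using h3
  have h3 : (ρ * (Fintype.card V : ℝ) ^ Fintype.card (τ ⊕ Unit)) ^ M ≤
      #(Fintype.piFinset fun i => switchers (τ := τ) E (T i) (z (jj i))) := by
    rw [Fintype.card_piFinset, Nat.cast_prod]
    calc _ = ∏ i : Fin M, (ρ * (Fintype.card V : ℝ) ^ Fintype.card (τ ⊕ Unit)) := by simp
      _ ≤ _ := prod_le_prod (fun _ _ => by positivity) fun i _ => h2 i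
  refine le_trans (le_of_eq ?_) (h3.trans (Nat.cast_le.2 (card_le_card_of_injOn
    (fun w p => w p.1 p.2) ?_ ?_)))
  · rw [mul_pow, ← pow_mul, Fintype.card_prod, Fintype.card_fin, mul_comm M]
  · intro w hw
    rw [mem_coe, Fintype.mem_piFinset] at hw
    simp only [absorbBase, mem_coe, mem_filter, mem_univ, true_and, Sum.elim_inl, Sum.elim_inr]
    exact ⟨hzE, hw⟩
  · intro w _ w' _ h
    funext i x
    exact congrFun h (i, x)

end AbsorbCounting

/-! ### Absorbing families of segments -/

section AbsorbPaths

theorem perm_univ_of_length {κ : Type*} [Fintype κ] {L : List κ} (h : ∀ x, x ∈ L)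
    (hlen : L.length = Fintype.card κ) : L.Perm (univ : Finset κ).toList := by
  classical
  have h1 : L.toFinset = univ := by ext x; simp [h]
  have h2 : L.dedup.length = L.length := by
    rw [← List.card_toFinset, h1, card_univ, hlen]
  have h3 : L.Nodup := by
    rw [← (List.dedup_sublist L).eq_of_length h2]; exact List.nodup_dedup L
  rw [List.perm_ext_iff_of_nodup h3 (nodup_toList _)]
  simp [h]

/-- Index type of the part of an edge on which a swap takes place. -/
abbrev SwapIdx (j p : ℕ) := Fin (j + 1) ⊕ Fin p ⊕ Fin j

/-- Positions of a swap segment. -/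
abbrev SwapPos (j p : ℕ) := Fin (j + 1) ⊕ Fin p ⊕ Fin j ⊕ Fin p ⊕ Fin (j + 1) ⊕ Fin 3

/-- Positions of an absorber. -/
abbrev AbsPos (j p k M : ℕ) := Fin k ⊕ (Fin M × SwapPos j p)

/-- The classes of the positions of an absorber. -/
def absClass {j p k M : ℕ} (jj : Fin M → Fin k) :
    AbsPos j p k M → Fin k ⊕ (Fin M × (SwapIdx j p ⊕ Unit))
  | Sum.inl a => Sum.inl a
  | Sum.inr (i, Sum.inl x) => Sum.inr (i, Sum.inl (Sum.inl x))
  | Sum.inr (i, Sum.inr (Sum.inl x)) => Sum.inr (i, Sum.inl (Sum.inr (Sum.inl x)))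
  | Sum.inr (i, Sum.inr (Sum.inr (Sum.inl x))) => Sum.inr (i, Sum.inl (Sum.inr (Sum.inr x)))
  | Sum.inr (i, Sum.inr (Sum.inr (Sum.inr (Sum.inl x)))) =>
      Sum.inr (i, Sum.inl (Sum.inr (Sum.inl x)))
  | Sum.inr (i, Sum.inr (Sum.inr (Sum.inr (Sum.inr (Sum.inl x))))) =>
      Sum.inr (i, Sum.inl (Sum.inl x))
  | Sum.inr (i, Sum.inr (Sum.inr (Sum.inr (Sum.inr (Sum.inr s))))) =>
      if s = 1 then Sum.inr (i, Sum.inr ()) else Sum.inl (jj i)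

/-- A swap segment, with the three pivotal entries as parameters. -/
def swapList {β : Type*} {j p : ℕ} (f : SwapPos j p → β) (x y z : β) : List β :=
  List.ofFn (fun i : Fin (j + 1) => f (Sum.inl i)) ++
  ((x :: List.ofFn fun i : Fin p => f (Sum.inr (Sum.inl i))) ++
  ((y :: List.ofFn fun i : Fin j => f (Sum.inr (Sum.inr (Sum.inl i)))) ++
  ((z :: List.ofFn fun i : Fin p => f (Sum.inr (Sum.inr (Sum.inr (Sum.inl i))))) ++
  List.ofFn fun i : Fin (j + 1) => f (Sum.inr (Sum.inr (Sum.inr (Sum.inr (Sum.inl i))))))))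

theorem length_swapList {β : Type*} {j p : ℕ} (f : SwapPos j p → β) (x y z : β) :
    (swapList f x y z).length = 3 * j + 2 * p + 5 := by
  simp [swapList]; ring

theorem map_swapList {β γ : Type*} {j p : ℕ} (g : β → γ) (f : SwapPos j p → β) (x y z : β) :
    (swapList f x y z).map g = swapList (fun q => g (f q)) (g x) (g y) (g z) := by
  simp [swapList, List.map_ofFn, Function.comp_def]

theorem sameEnds_swapList {β : Type*} {j p : ℕ} (f : SwapPos j p → β) (x y z x' y' z' : β) :
    SameEnds (j + 1) (swapList f x y z) (swapList f x' y' z') := by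
  constructor
  · rw [swapList, swapList, List.take_append_of_le_length (by simp),
      List.take_append_of_le_length (by simp)]
  · rw [swapList, swapList]
    simp only [← List.append_assoc]
    rw [lastPart_append (by simp), lastPart_append (by simp)]

theorem mem_swapList_of_pos {β : Type*} {j p : ℕ} (f : SwapPos j p → β) (x y z : β)
    (q : SwapPos j p) (hq : ∀ s, q ≠ Sum.inr (Sum.inr (Sum.inr (Sum.inr (Sum.inr s))))) :
    f q ∈ swapList f x y z := by
  rcases q with i | i | i | i | i | s
  rotate_right
  · exact absurd rfl (hq s)
  all_goals simp [swapList, -List.ofFn_succ]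

/-- The position of a pivotal entry of the `i`-th swap. -/
def pivot {j p k M : ℕ} (i : Fin M) (s : Fin 3) : AbsPos j p k M :=
  Sum.inr (i, Sum.inr (Sum.inr (Sum.inr (Sum.inr (Sum.inr s)))))

/-- The residue of `x` as an index. -/
def resIdx {k : ℕ} (hk : 0 < k) (x : ℕ) : Fin k := ⟨x % k, Nat.mod_lt _ hk⟩

theorem isPath_residues {V : Type*} [Fintype V] [DecidableEq V] {ι : Type*} {k l : ℕ} (hk : 0 < k)
    {E : Finset (Finset V)} {G : Finset (Fin k ⊕ ι → V)}
    (hG : ∀ z ∈ G, EdgeList E (tupList fun j => z (Sum.inl j))) (N : ℕ) :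
    IsPath k l (ClassEdge E G)
      ((List.range N).map fun x => (Sum.inr (Sum.inl (resIdx hk x)) : V ⊕ (Fin k ⊕ ι))) := by
  intro i hi
  set w := ((List.range N).drop (i * (k - l))).take k with hw
  rw [← List.map_drop, ← List.map_take, ← hw]
  have hlen : i * (k - l) + k ≤ N := by simpa using hi
  have hwr : w = List.range' (i * (k - l)) k := by
    apply List.ext_getElem
    · simp [hw]; omega
    · intro a h1 h2
      simp [hw]
  have hall : ∀ a : Fin k, ∃ x ∈ w, resIdx hk x = a := by
    intro a
    have h1 := Nat.image_Ico_mod (i * (k - l)) k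
    have h2 : (a : ℕ) ∈ (Ico (i * (k - l)) (i * (k - l) + k)).image (· % k) := by
      rw [h1]; simp
    obtain ⟨x, hx, hxa⟩ := mem_image.1 h2
    refine ⟨x, ?_, Fin.ext hxa⟩
    rw [hwr, List.mem_range'_1]
    exact mem_Ico.1 hx
  have hp : (w.map (resIdx hk)).Perm (univ : Finset (Fin k)).toList :=
    perm_univ_of_length (by simpa using hall) (by simp [hwr])
  have hm : (w.map fun x => (Sum.inr (Sum.inl (resIdx hk x)) : V ⊕ (Fin k ⊕ ι))) =
      (w.map (resIdx hk)).map fun x => Sum.inr (Sum.inl x) := by simp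
  refine ⟨?_, fun z hz => (hG z hz).congr fun v => ?_⟩
  · rw [hm]
    refine List.Nodup.map ?_ (hp.nodup_iff.2 (nodup_toList _))
    exact Sum.inr_injective.comp Sum.inl_injective
  · rw [mem_tupList]
    simp only [List.map_map, List.mem_map, Function.comp_apply, Sum.elim_inr]
    constructor
    · rintro ⟨a, rfl⟩
      obtain ⟨x, hx, rfl⟩ := hall a
      exact ⟨x, hx, rfl⟩
    · rintro ⟨x, -, rfl⟩
      exact ⟨_, rfl⟩

section Segments

variable {j p k M : ℕ}

/-- The segments of an absorber before absorption. -/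
def absSegs (j p k M : ℕ) : List (List (AbsPos j p k M)) :=
  List.ofFn (fun a : Fin k => Sum.inl a) ::
    List.ofFn fun i => swapList (fun q => Sum.inr (i, q)) (pivot i 0) (pivot i 1) (pivot i 2)

/-- The segments of an absorber after absorption. -/
def absSegs' (hk : 0 < k) (j p M : ℕ) : List (List (Fin M ⊕ AbsPos j p k M)) :=
  (((List.range (j + p + 2)).map fun x => Sum.inr (Sum.inl (resIdx hk x))) ++
    (List.ofFn fun i => Sum.inr (pivot i 2)) ++
    ((List.range (j + 1)).map fun x => Sum.inr (Sum.inl (resIdx hk (j + p + 2 + x))))) ::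
    List.ofFn fun i => swapList (fun q => Sum.inr (Sum.inr (i, q))) (Sum.inl i)
      (Sum.inr (pivot i 0)) (Sum.inr (pivot i 1))

theorem absSegs_perm : (absSegs j p k M).flatten.Perm (univ : Finset (AbsPos j p k M)).toList := by
  refine perm_univ_of_length ?_ ?_
  · rintro (a | ⟨i, q⟩)
    · simp [absSegs]
    · simp only [absSegs, List.flatten_cons, List.mem_append, List.mem_flatten, List.mem_ofFn]
      right
      refine ⟨_, ⟨i, rfl⟩, ?_⟩
      rcases q with x | x | x | x | x | s
      rotate_right
      · fin_cases s <;> simp [swapList, pivot]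
      all_goals
        refine mem_swapList_of_pos _ _ _ _ _ ?_
        simp
  · simp [absSegs, List.length_flatten, List.map_ofFn, Function.comp_def, length_swapList,
      -List.ofFn_succ]
    left; ring

theorem absSegs'_perm (hk : 0 < k) (hkj : k = 2 * j + p + 3) :
    (absSegs' hk j p M).flatten.Perm (univ : Finset (Fin M ⊕ AbsPos j p k M)).toList := by
  refine perm_univ_of_length ?_ ?_
  · rintro (i | (a | ⟨i, q⟩))
    · simp only [absSegs', List.flatten_cons, List.mem_append, List.mem_flatten, List.mem_ofFn]
      right
      exact ⟨_, ⟨i, rfl⟩, by simp [swapList]⟩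
    · simp only [absSegs', List.flatten_cons, List.mem_append]
      left
      rcases lt_or_ge (a : ℕ) (j + p + 2) with h | h
      · left; left
        refine List.mem_map.2 ⟨a, by simpa using h, ?_⟩
        simp [resIdx, Nat.mod_eq_of_lt a.2]
      · right
        have := a.2
        refine List.mem_map.2 ⟨a - (j + p + 2), by simp; omega, ?_⟩
        simp [resIdx, Nat.add_sub_cancel' h, Nat.mod_eq_of_lt a.2]
    · simp only [absSegs', List.flatten_cons, List.mem_append, List.mem_flatten, List.mem_ofFn]
      by_cases h2 : (Sum.inr (i, q) : AbsPos j p k M) = pivot i 2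
      · left; left; right
        exact ⟨i, by rw [h2]⟩
      right
      refine ⟨_, ⟨i, rfl⟩, ?_⟩
      rcases q with x | x | x | x | x | s
      rotate_right
      · fin_cases s
        · simp [swapList, pivot]
        · simp [swapList, pivot]
        · exact absurd rfl h2
      all_goals
        refine mem_swapList_of_pos (fun q => Sum.inr (Sum.inr (i, q))) _ _ _ _ ?_
        simp
  · simp [absSegs', List.length_flatten, List.map_ofFn, Function.comp_def, length_swapList,
      -List.ofFn_succ]
    subst hkj
    ring

end Segments

end AbsorbPaths

theorem isPath_two_blocks {α : Type*} {k l : ℕ} {Q : List α → Prop} (hlk : l < k)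
    {o a o' b o'' : List α} (h₁ : o.length + a.length = k - l) (ho' : o'.length = l)
    (h₂ : o'.length + b.length = k - l) (ho'' : o''.length = l) (hQ : Q (o ++ a ++ o'))
    (hQ' : Q (o' ++ b ++ o'')) : IsPath k l Q (o ++ (a ++ (o' ++ (b ++ o'')))) := by
  refine isPath_cons_block hlk h₁ ho' hQ ?_
  rw [← List.append_nil o'']
  exact isPath_cons_block hlk h₂ ho'' hQ' (isPath_of_length_lt (by simp; omega))

section AbsorbSegments

theorem mem_switchers {V τ : Type*} [Fintype V] [DecidableEq V] [Fintype τ] [DecidableEq τ]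
    {E : Finset (Finset V)} {t y : V} {h : τ ⊕ Unit → V} :
    h ∈ switchers E t y ↔ EdgeList E (t :: y :: tupList (fun i => h (Sum.inl i))) ∧
      EdgeList E (h (Sum.inr ()) :: y :: tupList fun i => h (Sum.inl i)) := by
  classical
  simp [switchers]

theorem mem_absorbBase {V τ : Type*} [Fintype V] [DecidableEq V] [Fintype τ] [DecidableEq τ]
    {E : Finset (Finset V)} {k M : ℕ} {jj : Fin M → Fin k} {T : Fin M → V}
    {z : Fin k ⊕ (Fin M × (τ ⊕ Unit)) → V} :
    z ∈ absorbBase τ E jj T ↔ EdgeList E (tupList fun j => z (Sum.inl j)) ∧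
      ∀ i, (fun x => z (Sum.inr (i, x))) ∈ switchers E (T i) (z (Sum.inl (jj i))) := by
  classical
  simp [absorbBase]

variable {V : Type*} [Fintype V] [DecidableEq V] {j p k M : ℕ}

set_option maxHeartbeats 1000000 in
theorem isPath_swap (hkj : k = 2 * j + p + 3) {E : Finset (Finset V)} {jj : Fin M → Fin k}
    {T : Fin M → V} (i : Fin M) :
    IsPath k (j + 1) (ClassEdge E (absorbBase (SwapIdx j p) E jj T))
      ((swapList (fun q => Sum.inr (Sum.inr (i, q))) (Sum.inr (pivot i 0)) (Sum.inr (pivot i 1))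
        (Sum.inr (pivot i 2)) : List (V ⊕ AbsPos j p k M)).map (Sum.map id (absClass jj))) := by
  subst hkj
  rw [map_swapList, swapList]
  refine isPath_two_blocks (by omega) (by simp; omega) (by simp) (by simp; omega) (by simp)
    ⟨?_, fun z hz => ?_⟩ ⟨?_, fun z hz => ?_⟩
  · simp [absClass, pivot, List.nodup_append, List.nodup_ofFn, Function.Injective, -List.ofFn_succ]
  · refine ((mem_switchers.1 ((mem_absorbBase.1 hz).2 i)).2).congr fun x => ?_
    simp [absClass, pivot, -List.ofFn_succ, mem_tupList, eq_comm]
    refine iff_of_eq ?_; ac_rfl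
  · simp [absClass, pivot, List.nodup_append, List.nodup_ofFn, Function.Injective, -List.ofFn_succ]
  · refine ((mem_switchers.1 ((mem_absorbBase.1 hz).2 i)).2).congr fun x => ?_
    simp [absClass, pivot, -List.ofFn_succ, mem_tupList, eq_comm]
    refine iff_of_eq ?_; ac_rfl

set_option maxHeartbeats 1000000 in
theorem isPath_swap' (hkj : k = 2 * j + p + 3) {E : Finset (Finset V)} {jj : Fin M → Fin k}
    {T : Fin M → V} (i : Fin M) :
    IsPath k (j + 1) (ClassEdge E (absorbBase (SwapIdx j p) E jj T))
      ((swapList (fun q => Sum.inr (Sum.inr (i, q))) (Sum.inl (T i)) (Sum.inr (pivot i 0))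
        (Sum.inr (pivot i 1)) : List (V ⊕ AbsPos j p k M)).map (Sum.map id (absClass jj))) := by
  subst hkj
  rw [map_swapList, swapList]
  refine isPath_two_blocks (by omega) (by simp; omega) (by simp) (by simp; omega) (by simp)
    ⟨?_, fun z hz => ?_⟩ ⟨?_, fun z hz => ?_⟩
  · simp [absClass, pivot, List.nodup_append, List.nodup_ofFn, Function.Injective, -List.ofFn_succ]
  · refine ((mem_switchers.1 ((mem_absorbBase.1 hz).2 i)).1).congr fun x => ?_
    simp [absClass, pivot, -List.ofFn_succ, mem_tupList, eq_comm]
    refine iff_of_eq ?_; ac_rfl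
  · simp [absClass, pivot, List.nodup_append, List.nodup_ofFn, Function.Injective, -List.ofFn_succ]
  · refine ((mem_switchers.1 ((mem_absorbBase.1 hz).2 i)).2).congr fun x => ?_
    simp [absClass, pivot, -List.ofFn_succ, mem_tupList, eq_comm]
    refine iff_of_eq ?_; ac_rfl

theorem isPath_center (hk : 0 < k) (hM : M = k * (j + p + 2)) {E : Finset (Finset V)}
    {T : Fin M → V} :
    IsPath k (j + 1)
      (ClassEdge E (absorbBase (SwapIdx j p) E (fun i => resIdx hk (j + p + 2 + i)) T))
      ((((List.range (j + p + 2)).map fun x => Sum.inr (Sum.inl (resIdx hk x))) ++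
        (List.ofFn fun i => Sum.inr (pivot i 2)) ++
        ((List.range (j + 1)).map fun x => Sum.inr (Sum.inl (resIdx hk (j + p + 2 + x)))) :
        List (V ⊕ AbsPos j p k M)).map (Sum.map id (absClass fun i => resIdx hk (j + p + 2 + i)))) := by
  have h1 := isPath_residues (V := V) (l := j + 1) (G := absorbBase (SwapIdx j p) E
    (fun i => resIdx hk (j + p + 2 + i)) T) hk (fun z hz => (mem_absorbBase.1 hz).1)
    (j + p + 2 + M + (j + 1))
  convert h1 using 1
  rw [List.range_add (n := j + p + 2 + M), List.range_add (n := j + p + 2) (m := M)]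
  simp only [List.map_append, List.map_map, List.map_ofFn]
  congr 1
  · congr 1
    refine List.ext_getElem (by simp) fun i h1 h2 => ?_
    simp [absClass, pivot]
  · refine List.map_congr_left fun x _ => ?_
    simp only [Function.comp_apply, Sum.map_inr, absClass, resIdx, hM]
    congr 3
    rw [show j + p + 2 + k * (j + p + 2) + x = j + p + 2 + x + k * (j + p + 2) by ring,
      Nat.add_mul_mod_self_left]

end AbsorbSegments

section AbsorberFamilies

/-- `X` is an absorber for the tuple `T`. -/
def IsAbsorber {V κ : Type*} [Fintype κ] [DecidableEq V] (k l : ℕ) (E : Finset (Finset V))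
    (P : List (List κ)) {M : ℕ} (T : Fin M → V) (X : κ → V) : Prop :=
  (∀ s ∈ P, IsSeg k l (EdgeList E) (s.map X)) ∧
  ∃ ss : List (List V), List.Forall₂ (SameEnds l) (P.map (List.map X)) ss ∧
    (∀ s ∈ ss, IsSeg k l (EdgeList E) s) ∧ ss.flatten.Perm (tupList X ++ List.ofFn T)

theorem isAbsorber_of_isBlowup {V : Type*} [Fintype V] [DecidableEq V] {j p k M : ℕ} (hk : 0 < k)
    (hkj : k = 2 * j + p + 3) (hM : M = k * (j + p + 2)) {E : Finset (Finset V)} {T : Fin M → V}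
    {X : AbsPos j p k M → V}
    (hX : IsBlowup (absorbBase (SwapIdx j p) E (fun i => resIdx hk (j + p + 2 + i)) T)
      (absClass fun i => resIdx hk (j + p + 2 + i)) X) :
    IsAbsorber k (j + 1) E (absSegs j p k M) T X := by
  have hkl : k - (j + 1) = j + p + 2 := by omega
  refine ⟨?_, (absSegs' hk j p M).map (List.map (Sum.elim T X)), ?_, ?_, ?_⟩
  · intro s hs
    rw [absSegs, List.mem_cons, List.mem_ofFn] at hs
    rcases hs with rfl | ⟨i, rfl⟩
    · refine isSeg_edge (by omega) (by simp) ?_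
      obtain ⟨z, hz, hzX⟩ := hX.list (List.ofFn fun a : Fin k => Sum.inl a) (by
        rw [List.map_ofFn, List.nodup_ofFn]
        exact Sum.inl_injective)
      refine (mem_absorbBase.1 hz).1.congr fun v => ?_
      simp only [mem_tupList, List.map_ofFn, List.mem_ofFn, Function.comp_apply]
      refine exists_congr fun a => ?_
      rw [hzX (Sum.inl a) (by simp)]
      rfl
    · refine ⟨⟨2, ?_⟩, ?_⟩
      · rw [List.length_map, length_swapList, hkl]; ring
      · have := hX.isPath _ (isPath_swap hkj (E := E) (T := T)
          (jj := fun i => resIdx hk (j + p + 2 + i)) i)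
        rw [map_swapList] at this ⊢
        exact this
  · rw [absSegs, absSegs', List.map_cons, List.map_cons, List.map_ofFn, List.map_ofFn]
    refine .cons ?_ ?_
    · have h1 : (List.ofFn fun a : Fin k => X (Sum.inl a)) =
          ((List.range (j + p + 2)).map fun x => X (Sum.inl (resIdx hk x))) ++
          (List.range (j + 1)).map fun x => X (Sum.inl (resIdx hk (j + p + 2 + x))) := by
        have h2 := List.range_add (n := j + p + 2) (m := j + 1)
        rw [show j + p + 2 + (j + 1) = k by omega] at h2
        have h3 : (List.ofFn fun a : Fin k => X (Sum.inl a)) =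
            (List.range k).map fun x => X (Sum.inl (resIdx hk x)) := by
          refine List.ext_getElem (by simp) fun i hi _ => ?_
          have : i < k := by simpa using hi
          simp [resIdx, Nat.mod_eq_of_lt this]
        rw [h3, h2, List.map_append, List.map_map]
        rfl
      change SameEnds (j + 1) (List.ofFn fun a : Fin k => X (Sum.inl a)) _
      rw [h1]
      simp only [List.map_append, List.map_map]
      constructor
      · rw [List.append_assoc, List.take_append_of_le_length (by simp; omega),
          List.take_append_of_le_length (by simp; omega)]
        rfl
      · rw [lastPart_append (by simp), lastPart_append (by simp)]
        rfl
    · refine List.forall₂_iff_get.2 ⟨by simp, fun i h₁ h₂ => ?_⟩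
      simp only [List.get_eq_getElem, List.getElem_map, List.getElem_ofFn, Function.comp_apply]
      rw [map_swapList, map_swapList]
      exact sameEnds_swapList _ _ _ _ _ _ _
  · intro s hs
    obtain ⟨t, ht, rfl⟩ := List.mem_map.1 hs
    rw [absSegs', List.mem_cons, List.mem_ofFn] at ht
    rcases ht with rfl | ⟨i, rfl⟩
    · refine ⟨⟨k + 1, ?_⟩, ?_⟩
      · simp [hkl, hM]; ring
      · have := hX.isPath _ (isPath_center hk hM (E := E) (T := T))
        simp only [List.map_append, List.map_map, List.map_ofFn] at this ⊢
        exact this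
    · refine ⟨⟨2, ?_⟩, ?_⟩
      · rw [List.length_map, length_swapList, hkl]; ring
      · have := hX.isPath _ (isPath_swap' hkj (E := E) (T := T)
          (jj := fun i => resIdx hk (j + p + 2 + i)) i)
        rw [map_swapList] at this ⊢
        exact this
  · rw [← List.map_flatten]
    refine ((absSegs'_perm hk hkj).map _).trans ?_
    have h1 : ((univ : Finset (AbsPos j p k M)).toList.map Sum.inr ++ List.ofFn Sum.inl).Perm
        (univ : Finset (Fin M ⊕ AbsPos j p k M)).toList := by
      refine perm_univ_of_length (by simp) ?_
      simp only [List.length_append, List.length_map, length_toList, card_univ, List.length_ofFn,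
        Fintype.card_sum, Fintype.card_fin]
      ring
    have h2 := (h1.map (Sum.elim T X)).symm
    rw [List.map_append, List.map_map, List.map_ofFn] at h2
    exact h2

/-- Few vertices excepted, every tuple of vertices has many absorbers. -/
theorem exists_absorbers {k l : ℕ} (hk4 : 4 ≤ k) (hl1 : 1 ≤ l) (hl2 : 2 * l < k) {c₀ μ : ℝ}
    (hc₀ : 0 < c₀) (hμ : 0 < μ) :
    ∃ (κ : Type) (_ : Fintype κ) (_ : DecidableEq κ) (P : List (List κ)) (M : ℕ),
      M = k * (k - l) ∧ P ≠ [] ∧ P.flatten.Perm (univ : Finset κ).toList ∧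
      ∃ α : ℝ, 0 < α ∧ ∃ n₀ : ℕ,
      ∀ (V : Type) [Fintype V] [DecidableEq V] (E : Finset (Finset V)),
        n₀ ≤ Fintype.card V → (∀ e ∈ E, #e = k) →
        (∀ S : Finset V, #S = k - 2 → c₀ * (Fintype.card V : ℝ) ^ 2 ≤ #{e ∈ E | S ⊆ e}) →
        ∃ bad : Finset V, (#bad : ℝ) ≤ μ * Fintype.card V ∧
          ∀ T : Fin M → V, (∀ i, T i ∉ bad) →
            ∃ G : Finset (κ → V), α * (Fintype.card V : ℝ) ^ Fintype.card κ ≤ #G ∧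
              ∀ X ∈ G, IsAbsorber k l E P T X := by
  obtain ⟨j, rfl⟩ := Nat.exists_eq_add_of_le' hl1
  obtain ⟨p, hp⟩ := Nat.exists_eq_add_of_lt hl2
  have hkj : k = 2 * j + p + 3 := by omega
  have hk : 0 < k := by omega
  set M := k * (j + p + 2) with hM
  set c₁ := c₀ / 2 ^ k with hc₁
  have hc₁0 : 0 < c₁ := by positivity
  have hM0 : 0 < M := by positivity
  set δ := min μ (c₁ ^ 2 / (16 * k * M)) with hδ
  have hδ0 : 0 < δ := lt_min hμ (by positivity)
  have hδ1 : 16 * k * M * δ ≤ c₁ ^ 2 := by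
    have : δ ≤ c₁ ^ 2 / (16 * k * M) := min_le_right _ _
    rwa [le_div_iff₀ (by positivity), mul_comm] at this
  set ρ := c₁ * δ ^ 2 / 2 with hρ
  have hρ0 : 0 < ρ := by positivity
  refine ⟨AbsPos j p k M, inferInstance, inferInstance, absSegs j p k M, M,
    by rw [hM, show k - (j + 1) = j + p + 2 by omega], by simp [absSegs], absSegs_perm,
    (c₁ / 2 * ρ ^ M) ^ 2 ^ Fintype.card (AbsPos j p k M), by positivity,
    max (2 * k) ⌈((k : ℝ) * (M + k)) / (c₁ / 4)⌉₊, ?_⟩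
  intro V _ _ E hn hE hdeg
  have hn1 := (le_max_left _ _).trans hn
  have hn2 := Nat.ceil_le.1 ((le_max_right _ _).trans hn)
  rw [div_le_iff₀ (by positivity)] at hn2
  have : Nonempty V := Fintype.card_pos_iff.1 (by omega)
  set n : ℝ := (Fintype.card V : ℝ) with hnn
  have hn0 : 0 < n := by simp [n, Fintype.card_pos]
  refine ⟨thinVertices (SwapIdx j p) E δ, (card_thinVertices_le E hδ0).trans
    (mul_le_mul_of_nonneg_right (min_le_left _ _) hn0.le), fun T hT => ?_⟩
  classical
  have h1 : ∀ i, (#(rigidFor (SwapIdx j p) E ρ (T i)) : ℝ) ≤ (2 * δ / c₁ + 1 / n) * n := by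
    intro i
    refine (card_rigidFor_le hc₁0 hδ0 (hT i) fun y hy => ?_).trans (le_of_eq ?_)
    · have := card_extend_tuple_ge hE hc₀.le hdeg hn1 (τ := SwapIdx j p) (by simp; omega)
        [T i, y] (by simpa using hy.symm) (by simp; omega)
      convert this
    · rw [add_mul, one_div, inv_mul_cancel₀ hn0.ne']
  have h2 := card_absorbBase_ge hρ0 (fun i : Fin M => resIdx hk (j + p + 2 + i)) T (by
      have := card_extend_tuple_ge hE hc₀.le hdeg hn1 (τ := Fin k) (by simp; omega)
        [] (by simp) (by simp)
      rw [Fintype.card_fin] at this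
      convert this
      rfl) h1 (by
      have e : (M : ℝ) * (2 * δ / c₁ + 1 / n) * n = M * (2 * δ / c₁) * n + M := by
        field_simp
      rw [e]
      have h3 : (k : ℝ) * (M * (2 * δ / c₁) * n) ≤ c₁ / 8 * n := by
        have : (k : ℝ) * (M * (2 * δ / c₁) * n) = (16 * k * M * δ) / c₁ / 8 * n := by ring
        rw [this]
        refine mul_le_mul_of_nonneg_right ?_ hn0.le
        rw [div_le_div_iff_of_pos_right (by norm_num), div_le_iff₀ hc₁0]
        nlinarith
      nlinarith)
  have h3 := card_isBlowup_ge _ (by positivity) h2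
    (absClass (p := p) (j := j) fun i : Fin M => resIdx hk (j + p + 2 + i))
  refine ⟨_, h3, fun X hX => ?_⟩
  exact isAbsorber_of_isBlowup hk hkj hM (mem_filter.1 hX).2

end AbsorberFamilies

/-! ### A weak regularity lemma -/

section FibreAverages

variable {Z A : Type*} [Fintype Z]

open Classical in
/-- The average of `g` over the fibre of `π` through `z`. -/
noncomputable def fibreAvg (π : Z → A) (g : Z → ℝ) (z : Z) : ℝ :=
  (∑ w with π w = π z, g w) / #{w | π w = π z}

theorem fibreAvg_congr {π : Z → A} {g : Z → ℝ} {z z' : Z} (h : π z = π z') :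
    fibreAvg π g z = fibreAvg π g z' := by
  rw [fibreAvg, fibreAvg, h]

theorem sum_mul_fibreAvg (π : Z → A) (g u : Z → ℝ) (hu : ∀ z z', π z = π z' → u z = u z') :
    ∑ z, u z * fibreAvg π g z = ∑ z, u z * g z := by
  classical
  have h1 : ∀ z, u z * fibreAvg π g z =
      ∑ w, if π w = π z then u w * g w / #{w' | π w' = π w} else 0 := by
    intro z
    rw [← sum_filter, fibreAvg, mul_div_assoc', mul_sum, sum_div]
    refine sum_congr rfl fun w hw => ?_
    have hw := (mem_filter.1 hw).2
    rw [hu w z hw, hw]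
  simp only [h1]
  rw [sum_comm]
  refine sum_congr rfl fun w _ => ?_
  rw [← sum_filter, sum_const, nsmul_eq_mul]
  have h2 : (#{z | π w = π z} : ℝ) = #{w' | π w' = π w} := by simp only [eq_comm]
  have h3 : (#{w' | π w' = π w} : ℝ) ≠ 0 := by
    have : 0 < #{w' | π w' = π w} := card_pos.2 ⟨w, by simp⟩
    positivity
  rw [h2, mul_div_cancel₀ _ h3]

theorem sum_sq_sub_fibreAvg {A' : Type*} (π : Z → A) (π' : Z → A') (g : Z → ℝ)
    (h : ∀ z z', π' z = π' z' → π z = π z') :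
    ∑ z, (fibreAvg π' g z - fibreAvg π g z) ^ 2 =
      ∑ z, fibreAvg π' g z ^ 2 - ∑ z, fibreAvg π g z ^ 2 := by
  have h1 := sum_mul_fibreAvg π g (fibreAvg π g) fun z z' => fibreAvg_congr
  have h2 := sum_mul_fibreAvg π' g (fibreAvg π g) fun z z' hz => fibreAvg_congr (h z z' hz)
  have h3 : ∀ z, (fibreAvg π' g z - fibreAvg π g z) ^ 2 =
      fibreAvg π' g z ^ 2 - 2 * (fibreAvg π g z * fibreAvg π' g z) +
        fibreAvg π g z * fibreAvg π g z := fun z => by ring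
  simp only [h3, sum_add_distrib, sum_sub_distrib, ← mul_sum, h1, h2]
  have h4 : ∑ z, fibreAvg π g z ^ 2 = ∑ z, fibreAvg π g z * g z := by
    rw [← h1]; simp only [sq]
  rw [h4]; ring

theorem fibreAvg_sq_le (π : Z → A) {g : Z → ℝ} (h0 : ∀ z, 0 ≤ g z) (h1 : ∀ z, g z ≤ 1) (z : Z) :
    fibreAvg π g z ^ 2 ≤ 1 := by
  classical
  have h2 : 0 ≤ fibreAvg π g z := div_nonneg (sum_nonneg fun w _ => h0 w) (by positivity)
  have h3 : fibreAvg π g z ≤ 1 := by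
    refine div_le_one_of_le₀ ((sum_le_sum fun w _ => h1 w).trans ?_) (by positivity)
    simp
  exact pow_le_one₀ h2 h3

end FibreAverages

section Regularity

variable {V K : Type*} [Fintype V] [DecidableEq V] [Fintype K] [DecidableEq K]

/-- A colour class. -/
def colClass {ι : Type*} [DecidableEq ι] (χ : V → ι) (i : ι) : Finset V := {v | χ v = i}

/-- The members of `Ω` in a box. -/
def boxPart (Ω : Finset (K → V)) (X : K → Finset V) : Finset (K → V) := {z ∈ Ω | ∀ i, z i ∈ X i}

/-- The colour vector `a` is dense but contains a large sparse box. -/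
def Irregular {ι : Type*} [DecidableEq ι] (Ω : Finset (K → V)) (ε d : ℝ) (χ : V → ι) (a : K → ι) :
    Prop :=
  d * ∏ i, (#(colClass χ (a i)) : ℝ) ≤ #(boxPart Ω fun i => colClass χ (a i)) ∧
    ∃ X : K → Finset V, (∀ i, X i ⊆ colClass χ (a i)) ∧
      (∀ i, ε * #(colClass χ (a i)) ≤ #(X i)) ∧
      (#(boxPart Ω X) : ℝ) < d / 2 * ∏ i, (#(X i) : ℝ)

open Classical in
/-- The energy of a colouring. -/
noncomputable def energy {ι : Type*} (Ω : Finset (K → V)) (χ : V → ι) : ℝ :=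
  ∑ z, fibreAvg (fun (z : K → V) i => χ (z i)) (fun z => if z ∈ Ω then 1 else 0) z ^ 2

theorem energy_le {ι : Type*} (Ω : Finset (K → V)) (χ : V → ι) :
    energy Ω χ ≤ (Fintype.card V : ℝ) ^ Fintype.card K := by
  classical
  refine (sum_le_sum fun z _ => fibreAvg_sq_le _ ?_ ?_ z).trans ?_
  · intro z; split_ifs <;> norm_num
  · intro z; split_ifs <;> norm_num
  · simp

theorem colVec_eq_iff {ι : Type*} [DecidableEq ι] {χ : V → ι} {a : K → ι} {z : K → V} :
    (fun i => χ (z i)) = a ↔ ∀ i, z i ∈ colClass χ (a i) := by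
  simp [funext_iff, colClass]

open Classical in
/-- Refining along witnesses of irregularity increases the energy. -/
theorem exists_refinement {ι : Type} [Fintype ι] [DecidableEq ι] (Ω : Finset (K → V)) {ε d : ℝ}
    (hε : 0 < ε) (hd : 0 < d) (χ : V → ι)
    (hirr : ε * (Fintype.card V : ℝ) ^ Fintype.card K ≤
      #{z : K → V | Irregular Ω ε d χ fun i => χ (z i)}) :
    ∃ χ' : V → ι × ((K → ι) × K → Bool),
      energy Ω χ + d ^ 2 / 4 * ε ^ (Fintype.card K + 1) *
        (Fintype.card V : ℝ) ^ Fintype.card K ≤ energy Ω χ' := by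
  choose! X hX using fun a (h : Irregular Ω ε d χ a) => h.2
  let χ' : V → ι × ((K → ι) × K → Bool) := fun v => (χ v, fun p => decide (v ∈ X p.1 p.2))
  refine ⟨χ', ?_⟩
  set g : (K → V) → ℝ := fun z => if z ∈ Ω then 1 else 0 with hg
  set π : (K → V) → K → ι := fun z i => χ (z i) with hπ
  set π' : (K → V) → K → ι × ((K → ι) × K → Bool) := fun z i => χ' (z i) with hπ'
  have hfin : ∀ z z', π' z = π' z' → π z = π z' := fun z z' h => by
    funext i; exact congrArg Prod.fst (congrFun h i)
  have h1 := sum_sq_sub_fibreAvg π π' g hfin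
  have h2 : energy Ω χ' = ∑ z, fibreAvg π' g z ^ 2 := rfl
  have h3 : energy Ω χ = ∑ z, fibreAvg π g z ^ 2 := rfl
  rw [h2, h3]
  suffices h : d ^ 2 / 4 * ε ^ (Fintype.card K + 1) * (Fintype.card V : ℝ) ^ Fintype.card K ≤
      ∑ z, (fibreAvg π' g z - fibreAvg π g z) ^ 2 by linarith
  have key : ∀ a, Irregular Ω ε d χ a → d ^ 2 / 4 * ε ^ Fintype.card K * #{z | π z = a} ≤
      ∑ z with π z = a, (fibreAvg π' g z - fibreAvg π g z) ^ 2 := by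
    intro a ha
    obtain ⟨hXs, hXc, hXe⟩ := hX a ha
    have hbox : ∀ z, π z = a ↔ ∀ i, z i ∈ colClass χ (a i) := fun z => colVec_eq_iff
    have hcard : (#{z | π z = a} : ℝ) = ∏ i, (#(colClass χ (a i)) : ℝ) := by
      have : ({z | π z = a} : Finset (K → V)) = Fintype.piFinset fun i => colClass χ (a i) := by
        ext z; simp [hbox, Fintype.mem_piFinset]
      rw [this, Fintype.card_piFinset, Nat.cast_prod]
    set B := Fintype.piFinset (X a) with hB
    have hBc : (#B : ℝ) = ∏ i, (#(X a i) : ℝ) := by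
      rw [hB, Fintype.card_piFinset, Nat.cast_prod]
    have hBge : ε ^ Fintype.card K * #{z | π z = a} ≤ (#B : ℝ) := by
      rw [hBc, hcard, ← card_univ, ← prod_const, ← prod_mul_distrib]
      exact prod_le_prod (fun _ _ => by positivity) fun i _ => hXc i
    have hBsub : B ⊆ ({z | π z = a} : Finset (K → V)) := by
      intro z hz
      rw [hB, Fintype.mem_piFinset] at hz
      rw [mem_filter, hbox]
      exact ⟨mem_univ _, fun i => hXs i (hz i)⟩
    have hBmeas : ∀ z z', π' z = π' z' → (z ∈ B ↔ z' ∈ B) := by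
      intro z z' h
      simp only [hB, Fintype.mem_piFinset]
      refine forall_congr' fun i => ?_
      have h4 := congrFun (congrArg Prod.snd (congrFun h i)) (a, i)
      simpa [hπ', χ'] using h4
    have hsum : ∑ z ∈ B, fibreAvg π' g z = #(boxPart Ω (X a)) := by
      have h4 := sum_mul_fibreAvg π' g (fun z => if z ∈ B then 1 else 0) fun z z' h => by
        simp only [hBmeas z z' h]
      simp only [ite_mul, one_mul, zero_mul, ← sum_filter] at h4
      rw [filter_mem_eq_inter, univ_inter] at h4
      rw [h4, hg, sum_boole]
      congr 2
      ext z
      simp [hB, boxPart, Fintype.mem_piFinset, and_comm]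
    have hge : ∀ z ∈ B, d ≤ fibreAvg π g z := by
      intro z hz
      have hza : π z = a := (mem_filter.1 (hBsub hz)).2
      rw [fibreAvg]
      refine (le_div_iff₀ (Nat.cast_pos.2 (card_pos.2 ⟨z, by simp⟩))).2 ?_
      have hcard' := hcard
      rw [← hza] at hcard'
      refine le_trans (le_of_eq (b := d * ∏ i, (#(colClass χ (a i)) : ℝ)) ?_)
        (ha.1.trans (le_of_eq ?_))
      · rw [← hza, ← hcard']
        congr!
      rw [hza, hg, sum_boole, filter_filter]
      congr 2
      ext z
      simp [boxPart, hbox, and_comm]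
    have h5 : ∀ z ∈ B, d ^ 2 * (3 / 4) - d * fibreAvg π' g z ≤
        (fibreAvg π' g z - fibreAvg π g z) ^ 2 := by
      intro z hz
      have := hge z hz
      nlinarith [sq_nonneg (fibreAvg π' g z - fibreAvg π g z + d / 2)]
    calc d ^ 2 / 4 * ε ^ Fintype.card K * #{z | π z = a} ≤ d ^ 2 / 4 * #B := by
          rw [mul_assoc]; gcongr
      _ ≤ ∑ z ∈ B, (d ^ 2 * (3 / 4) - d * fibreAvg π' g z) := by
          rw [sum_sub_distrib, sum_const, nsmul_eq_mul, ← mul_sum, hsum]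
          rw [← hBc] at hXe
          nlinarith
      _ ≤ ∑ z ∈ B, (fibreAvg π' g z - fibreAvg π g z) ^ 2 := sum_le_sum h5
      _ ≤ _ := sum_le_sum_of_subset_of_nonneg hBsub fun _ _ _ => sq_nonneg _
  calc d ^ 2 / 4 * ε ^ (Fintype.card K + 1) * (Fintype.card V : ℝ) ^ Fintype.card K
      = d ^ 2 / 4 * ε ^ Fintype.card K * (ε * (Fintype.card V : ℝ) ^ Fintype.card K) := by ring
    _ ≤ d ^ 2 / 4 * ε ^ Fintype.card K * #{z : K → V | Irregular Ω ε d χ (π z)} := by gcongr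
    _ = ∑ a with Irregular Ω ε d χ a, d ^ 2 / 4 * ε ^ Fintype.card K * #{z | π z = a} := by
        rw [← mul_sum]
        congr 1
        rw [card_eq_sum_card_fiberwise (f := π) (t := {a | Irregular Ω ε d χ a})
          (by intro z hz; simpa using hz), Nat.cast_sum]
        refine sum_congr rfl fun a ha => ?_
        rw [filter_filter]
        congr 2
        ext z
        have := (mem_filter.1 ha).2
        simp only [mem_filter, mem_univ, true_and]
        exact ⟨fun h => h.2, fun h => ⟨h ▸ this, h⟩⟩
    _ ≤ ∑ a with Irregular Ω ε d χ a,
        ∑ z with π z = a, (fibreAvg π' g z - fibreAvg π g z) ^ 2 :=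
        sum_le_sum fun a ha => key a (mem_filter.1 ha).2
    _ ≤ ∑ a, ∑ z with π z = a, (fibreAvg π' g z - fibreAvg π g z) ^ 2 :=
        sum_le_univ_sum_of_nonneg fun a => sum_nonneg fun _ _ => sq_nonneg _
    _ = _ := sum_fiberwise _ _ _

open Classical in
/-- There is a bounded colouring with few tuples in irregular colour vectors. -/
theorem exists_regular_colouring (K : Type) [Fintype K] [DecidableEq K] {ε d : ℝ} (hε : 0 < ε)
    (hd : 0 < d) : ∃ R : ℕ, ∀ (V : Type) [Fintype V] [DecidableEq V] [Nonempty V]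
      (Ω : Finset (K → V)), ∃ (ι : Type) (_ : Fintype ι) (_ : DecidableEq ι) (χ : V → ι),
      Fintype.card ι ≤ R ∧ (#{z : K → V | Irregular Ω ε d χ fun i => χ (z i)} : ℝ) ≤
        ε * (Fintype.card V : ℝ) ^ Fintype.card K := by
  set c := d ^ 2 / 4 * ε ^ (Fintype.card K + 1) with hc
  have hc0 : 0 < c := by positivity
  have main : ∀ j : ℕ, ∃ R : ℕ, ∀ (V : Type) [Fintype V] [DecidableEq V] [Nonempty V]
      (Ω : Finset (K → V)), ∃ (ι : Type) (_ : Fintype ι) (_ : DecidableEq ι) (χ : V → ι),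
      Fintype.card ι ≤ R ∧ ((#{z : K → V | Irregular Ω ε d χ fun i => χ (z i)} : ℝ) ≤
        ε * (Fintype.card V : ℝ) ^ Fintype.card K ∨
        j * c * (Fintype.card V : ℝ) ^ Fintype.card K ≤ energy Ω χ) := by
    intro j
    induction j with
    | zero =>
      refine ⟨1, fun V _ _ _ Ω => ⟨Unit, inferInstance, inferInstance, fun _ => (), by simp,
        Or.inr ?_⟩⟩
      simp only [Nat.cast_zero, zero_mul]
      exact sum_nonneg fun _ _ => sq_nonneg _
    | succ j ih =>
      obtain ⟨R, hR⟩ := ih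
      refine ⟨R * 2 ^ (R ^ Fintype.card K * Fintype.card K) + R, fun V _ _ _ Ω => ?_⟩
      obtain ⟨ι, _, _, χ, hι, h⟩ := hR V Ω
      by_cases hirr : (#{z : K → V | Irregular Ω ε d χ fun i => χ (z i)} : ℝ) ≤
        ε * (Fintype.card V : ℝ) ^ Fintype.card K
      · exact ⟨ι, _, _, χ, by omega, Or.inl hirr⟩
      · obtain ⟨χ', hχ'⟩ := exists_refinement Ω hε hd χ (not_le.1 hirr).le
        refine ⟨_, inferInstance, inferInstance, χ', ?_, Or.inr ?_⟩
        · refine le_trans ?_ (Nat.le_add_right _ R)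
          simp only [Fintype.card_prod, Fintype.card_fun, Fintype.card_bool]
          gcongr
          norm_num
        · have := h.resolve_left hirr
          rw [← hc] at hχ'
          push_cast
          rw [add_mul, add_mul, one_mul]
          linarith
  obtain ⟨j, hj⟩ := exists_nat_gt (1 / c)
  rw [div_lt_iff₀ hc0] at hj
  obtain ⟨R, hR⟩ := main j
  refine ⟨R, fun V _ _ _ Ω => ?_⟩
  obtain ⟨ι, h1, h2, χ, hι, h⟩ := hR V Ω
  refine ⟨ι, h1, h2, χ, hι, h.resolve_right fun h => ?_⟩
  have h3 := h.trans (energy_le Ω χ)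
  have hn : (0 : ℝ) < (Fintype.card V : ℝ) ^ Fintype.card K := by
    have : 0 < Fintype.card V := Fintype.card_pos
    positivity
  nlinarith

end Regularity

section Stability

variable {V : Type*} [Fintype V] [DecidableEq V]

/-- The proportion of vertices of weight exceeding `s`. -/
noncomputable def upperFrac (w : V → ℝ) (s : ℝ) : ℝ :=
  (#{v | s < w v} : ℝ) / Fintype.card V

theorem upperFrac_nonneg (w : V → ℝ) (s : ℝ) : 0 ≤ upperFrac w s := by
  unfold upperFrac; positivity

theorem upperFrac_anti (w : V → ℝ) {s t : ℝ} (h : s ≤ t) : upperFrac w t ≤ upperFrac w s := by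
  unfold upperFrac
  gcongr with v _

theorem sum_upperFrac_le (w : V → ℝ) (hw : ∀ v, 0 ≤ w v) {x : ℝ} (hx : 0 ≤ x)
    (hsum : ∑ v, w v ≤ x * Fintype.card V) {J : ℕ} (hJ : 0 < J) :
    ∑ j ∈ Icc 1 (J - 1), upperFrac w ((j : ℝ) / J) ≤ J * x := by
  have hJ0 : (0 : ℝ) < J := by exact_mod_cast hJ
  unfold upperFrac
  rw [← sum_div]
  refine div_le_of_le_mul₀ (by positivity) (by positivity) ?_
  have h1 : ∀ j : ℕ, (#{v | (j : ℝ) / J < w v} : ℝ) = ∑ v, if (j : ℝ) / J < w v then 1 else 0 := by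
    intro j; rw [sum_boole]
  simp only [h1]
  rw [sum_comm]
  have h2 : ∀ v, (∑ j ∈ Icc 1 (J - 1), if (j : ℝ) / J < w v then (1 : ℝ) else 0) ≤ J * w v := by
    intro v
    rw [sum_boole]
    have h0 : 0 ≤ J * w v := mul_nonneg hJ0.le (hw v)
    refine le_trans ?_ (Nat.floor_le h0)
    norm_cast
    calc _ ≤ #(Icc 1 ⌊J * w v⌋₊) := by
          refine card_le_card fun j hj => ?_
          rw [mem_filter, mem_Icc] at hj
          rw [mem_Icc]
          refine ⟨hj.1.1, Nat.le_floor ?_⟩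
          rw [div_lt_iff₀ hJ0] at hj
          linarith [hj.2]
      _ = _ := by simp
  calc _ ≤ ∑ v, J * w v := sum_le_sum fun v _ => h2 v
    _ = J * ∑ v, w v := by rw [mul_sum]
    _ ≤ J * (x * Fintype.card V) := by gcongr
    _ = _ := by ring

theorem card_heavy_pairs_le [Nonempty V] (w : V → ℝ) (θ : ℝ) :
    (#{p : V × V | 1 < w p.1 + w p.2} : ℝ) ≤
      (upperFrac w θ ^ 2 + 2 * (1 - upperFrac w θ) * upperFrac w (1 - θ)) *
        (Fintype.card V : ℝ) ^ 2 := by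
  have hN : (0 : ℝ) < Fintype.card V := by exact_mod_cast Fintype.card_pos
  set A : Finset V := {v | θ < w v} with hA
  set B : Finset V := {v | 1 - θ < w v} with hB
  have hsub : ({p : V × V | 1 < w p.1 + w p.2} : Finset (V × V)) ⊆
      (A ×ˢ A ∪ Aᶜ ×ˢ B) ∪ B ×ˢ Aᶜ := by
    intro p hp
    simp only [mem_filter, mem_univ, true_and] at hp
    simp only [mem_union, mem_product, mem_compl, hA, hB, mem_filter, mem_univ, true_and, not_lt]
    by_cases h1 : θ < w p.1
    · by_cases h2 : θ < w p.2
      · exact Or.inl (Or.inl ⟨h1, h2⟩)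
      · exact Or.inr ⟨by linarith, not_lt.1 h2⟩
    · exact Or.inl (Or.inr ⟨not_lt.1 h1, by linarith [not_lt.1 h1]⟩)
  have hcard : (#{p : V × V | 1 < w p.1 + w p.2} : ℝ) ≤
      (#A : ℝ) * #A + #Aᶜ * #B + #B * #Aᶜ := by
    have := (card_le_card hsub).trans ((card_union_le _ _).trans
      (Nat.add_le_add_right (card_union_le _ _) _))
    simp only [card_product] at this
    exact_mod_cast this
  have hAc : (#Aᶜ : ℝ) = Fintype.card V - #A := by
    rw [card_compl, Nat.cast_sub (card_le_univ _)]
  refine hcard.trans (le_of_eq ?_)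
  rw [hAc]
  unfold upperFrac
  rw [← hA, ← hB]
  field_simp
  ring

/-- Stability for the number of pairs of total weight more than one. -/
theorem exists_stability {x δ : ℝ} (hx : 0 < x) (hx6 : x ≤ 1 / 6) (hδ : 0 < δ) :
    ∃ γ : ℝ, 0 < γ ∧ ∀ (V : Type) [Fintype V] [DecidableEq V] [Nonempty V] (w : V → ℝ),
      (∀ v, 0 ≤ w v) → ∑ v, w v ≤ x * Fintype.card V →
      (2 * x - x ^ 2 - γ) * (Fintype.card V : ℝ) ^ 2 ≤ #{p : V × V | 1 < w p.1 + w p.2} →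
      (#{v | x < w v} : ℝ) ≤ (x + δ) * Fintype.card V := by
  set δ' := min (δ / 4) (1 / 30) with hδ'
  have hδ'0 : 0 < δ' := by positivity
  have hδ1 : δ' ≤ δ / 4 := min_le_left _ _
  have hδ2 : δ' ≤ 1 / 30 := min_le_right _ _
  obtain ⟨j₀, hj₀⟩ := exists_nat_gt (2 / δ')
  have hj0' : 0 < j₀ := by
    have : (0 : ℝ) < j₀ := lt_trans (by positivity) hj₀
    exact_mod_cast this
  rw [div_lt_iff₀ hδ'0] at hj₀
  obtain ⟨J, hJ⟩ := exists_nat_gt (max (2 * (j₀ : ℝ) + 2) (j₀ / x))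
  have hJ1 := (le_max_left _ _).trans_lt hJ
  have hJ2 := (le_max_right _ _).trans_lt hJ
  have hJN : 2 * j₀ + 2 < J := by exact_mod_cast hJ1
  have hJ0 : (0 : ℝ) < J := by
    have : 0 < J := by omega
    exact_mod_cast this
  rw [div_lt_iff₀ hx] at hJ2
  refine ⟨min δ' (1 / J), by positivity, ?_⟩
  intro V _ _ _ w hw hsum hP
  set γ := min δ' (1 / (J : ℝ)) with hγ
  have hγ1 : γ ≤ δ' := min_le_left _ _
  have hγ2 : γ ≤ 1 / J := min_le_right _ _
  have hγJ : J * γ ≤ 1 := by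
    rw [le_div_iff₀ hJ0] at hγ2; linarith
  have hN : (0 : ℝ) < Fintype.card V := by exact_mod_cast Fintype.card_pos
  have hP' : ∀ θ : ℝ, 2 * x - x ^ 2 - γ ≤
      upperFrac w θ ^ 2 + 2 * (1 - upperFrac w θ) * upperFrac w (1 - θ) := by
    intro θ
    exact le_of_mul_le_mul_right (hP.trans (card_heavy_pairs_le w θ)) (by positivity)
  have hfin : ∀ F₁ F₂ : ℝ, 0 ≤ F₁ → F₁ ≤ F₂ → (F₁ + F₂) / 2 ≤ x + δ' →
      2 * x - x ^ 2 - γ ≤ F₂ ^ 2 + 2 * (1 - F₂) * F₁ →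
      (F₂ - F₁) / 2 ≤ (2 * ((F₁ + F₂) / 2) - ((F₁ + F₂) / 2) ^ 2) - (2 * x - x ^ 2) + γ := by
    intro F₁ F₂ h1 h2 h3 h4
    nlinarith [mul_nonneg (sub_nonneg.2 h2) (show (0 : ℝ) ≤ 1 - 5 / 2 * (F₁ + F₂) + 3 / 2 * F₁
      + 3 / 2 * F₁ by nlinarith)]
  have hlow : ∀ θ : ℝ, θ ≤ 1 / 2 →
      2 * (x - γ) ≤ upperFrac w θ + upperFrac w (1 - θ) := by
    intro θ hθ
    by_contra! hcon
    have h1 := upperFrac_nonneg w (1 - θ)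
    have h2 := upperFrac_anti w (show θ ≤ 1 - θ by linarith)
    have h3 := hfin _ _ h1 h2 (by linarith [lt_min hδ'0 (one_div_pos.2 hJ0)]) (hP' θ)
    set g := (upperFrac w (1 - θ) + upperFrac w θ) / 2 with hg
    have h5 : g < x - γ := by rw [hg]; linarith
    have hγ0 : 0 < γ := lt_min hδ'0 (one_div_pos.2 hJ0)
    nlinarith
  obtain ⟨j, hj1, hj2, hjg⟩ : ∃ j : ℕ, 1 ≤ j ∧ j ≤ j₀ ∧
      upperFrac w (j / J) + upperFrac w (1 - j / J) ≤ 2 * (x + δ') := by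
    by_contra! hcon
    have hs := sum_upperFrac_le w hw hx.le hsum (J := J) (by omega)
    have hs' : ∑ j ∈ Icc 1 (J - 1), upperFrac w (1 - (j : ℝ) / J) =
        ∑ j ∈ Icc 1 (J - 1), upperFrac w ((j : ℝ) / J) := by
      refine sum_bij' (fun j _ => J - j) (fun j _ => J - j) ?_ ?_ ?_ ?_ ?_
      · intro j hj; rw [mem_Icc] at *; omega
      · intro j hj; rw [mem_Icc] at *; omega
      · intro j hj; rw [mem_Icc] at *; omega
      · intro j hj; rw [mem_Icc] at *; omega
      · intro j hj
        rw [mem_Icc] at hj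
        rw [Nat.cast_sub (by omega), sub_div, div_self hJ0.ne']
    have hterm : ∀ j ∈ Icc 1 (J - 1), 2 * (x - γ) + (if j ≤ j₀ then 2 * δ' else 0) ≤
        upperFrac w ((j : ℝ) / J) + upperFrac w (1 - (j : ℝ) / J) := by
      intro j hj
      rw [mem_Icc] at hj
      have hγ0 : 0 < γ := lt_min hδ'0 (one_div_pos.2 hJ0)
      split_ifs with h
      · linarith [hcon j hj.1 h]
      · rw [add_zero]
        rcases le_total ((j : ℝ) / J) (1 / 2) with h2 | h2
        · exact hlow _ h2
        · have := hlow (1 - (j : ℝ) / J) (by linarith)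
          rw [sub_sub_cancel] at this
          linarith
    have h1 := sum_le_sum hterm
    rw [sum_add_distrib, sum_add_distrib, hs', sum_const, ← sum_filter, sum_const] at h1
    have h2 : (Icc 1 (J - 1)).filter (· ≤ j₀) = Icc 1 j₀ := by
      ext i; rw [mem_filter, mem_Icc, mem_Icc]; omega
    rw [h2, Nat.card_Icc, Nat.card_Icc, nsmul_eq_mul, nsmul_eq_mul] at h1
    have h3 : ((J - 1 + 1 - 1 : ℕ) : ℝ) = J - 1 := by
      rw [Nat.sub_add_cancel (by omega), Nat.cast_sub (by omega)]; simp
    have h4 : ((j₀ + 1 - 1 : ℕ) : ℝ) = j₀ := by simp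
    rw [h3, h4] at h1
    have hγ0 : 0 < γ := lt_min hδ'0 (one_div_pos.2 hJ0)
    nlinarith
  have hjJ : (j : ℝ) / J ≤ 1 / 2 := by
    rw [div_le_div_iff₀ hJ0 (by norm_num)]
    have : j * 2 ≤ 1 * J := by omega
    exact_mod_cast this
  have h1 := upperFrac_nonneg w (1 - j / J)
  have h2 := upperFrac_anti w (show (j : ℝ) / J ≤ 1 - j / J by linarith)
  have h3 := hfin _ _ h1 h2 (by linarith) (hP' _)
  have h4 : upperFrac w (j / J) ≤ x + δ := by
    have h5 := hlow _ hjJ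
    nlinarith
  have h5 : upperFrac w x ≤ upperFrac w (j / J) := by
    refine upperFrac_anti w ?_
    rw [div_le_iff₀ hJ0]
    have : (j : ℝ) ≤ j₀ := by exact_mod_cast hj2
    linarith
  have h6 := h5.trans h4
  unfold upperFrac at h6
  rwa [div_le_iff₀ hN] at h6

end Stability

section Fractional

variable {V : Type*} [Fintype V] [DecidableEq V]

theorem exists_threshold [Nonempty V] (y : V → ℝ) {b : ℝ} (hb : 0 < b)
    (hb1 : b ≤ Fintype.card V) :
    ∃ a ∈ Set.range y, b ≤ #{v | y v ≤ a} ∧ (#{v | y v < a} : ℝ) < b := by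
  have hne : ({v | b ≤ #{u | y u ≤ y v}} : Finset V).Nonempty := by
    obtain ⟨v, -, hv⟩ := exists_max_image univ y univ_nonempty
    refine ⟨v, ?_⟩
    rw [mem_filter]
    refine ⟨mem_univ _, ?_⟩
    rw [filter_true_of_mem fun u _ => hv u (mem_univ u)]
    exact hb1
  obtain ⟨v, hv, hmin⟩ := exists_min_image _ y hne
  rw [mem_filter] at hv
  refine ⟨y v, ⟨v, rfl⟩, hv.2, ?_⟩
  by_contra! hcon
  have hne2 : ({u | y u < y v} : Finset V).Nonempty := by
    rw [← card_pos]
    exact_mod_cast hb.trans_le hcon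
  obtain ⟨u, hu, hmax⟩ := exists_max_image _ y hne2
  rw [mem_filter] at hu
  have h1 : u ∈ ({v | b ≤ #{u | y u ≤ y v}} : Finset V) := by
    rw [mem_filter]
    refine ⟨mem_univ _, hcon.trans ?_⟩
    norm_cast
    refine card_le_card fun t ht => ?_
    have := hmax t ht
    rw [mem_filter]
    exact ⟨mem_univ _, this⟩
  exact absurd (hmin u h1) (not_le.2 hu.2)

/-- Replacing the two coordinates `i₀, i₁` of `z`. -/
def setTwo {K : Type*} [DecidableEq K] (i₀ i₁ : K) (z : K → V) (p : V × V) : K → V :=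
  Function.update (Function.update z i₀ p.1) i₁ p.2

open Classical in
/-- If the pair degrees of `Ω` are nearly those of the extremal configuration, but `Ω` is far from
extremal, then every weighting has many light tuples. -/
theorem exists_light_tuples (K : Type) [Fintype K] [DecidableEq K] {i₀ i₁ : K} (hi : i₀ ≠ i₁)
    (wt : K → ℝ) (hwt : ∀ i, 0 ≤ wt i) (h₀ : wt i₀ = 1 / 2) (h₁ : wt i₁ = 1 / 2) {m : ℝ}
    (hm3 : 3 ≤ m) (hm : ∑ i, wt i = m) {δ ρ' : ℝ} (hδ : 0 < δ) (hρ' : 0 < ρ') :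
    ∃ γ : ℝ, 0 < γ ∧ ∀ ε : ℝ, 0 < ε → ε ≤ 1 → ∃ ρ : ℝ, 0 < ρ ∧ ∃ n₀ : ℕ,
      ∀ (V : Type) [Fintype V] [DecidableEq V] [Nonempty V] (Ω : Finset (K → V)),
      n₀ ≤ Fintype.card V →
      (∀ z : K → V, Function.Injective z →
        (1 - (1 - 1 / (2 * m)) ^ 2 - γ) * (Fintype.card V : ℝ) ^ 2 ≤
          #{p : V × V | setTwo i₀ i₁ z p ∈ Ω}) →
      (∀ B : Finset V, (1 - 1 / (2 * m) - δ) * Fintype.card V ≤ #B →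
        ρ' * (Fintype.card V : ℝ) ^ Fintype.card K ≤ #{z ∈ Ω | ∀ i, z i ∈ B}) →
      ∀ y : V → ℝ, (∀ v, 0 ≤ y v) → ∑ v, y v ≤ Fintype.card V →
        ρ * (Fintype.card V : ℝ) ^ Fintype.card K ≤
          #{z ∈ Ω | ∑ i, wt i * y (z i) ≤ m * (1 + ε)} := by
  have hm0 : 0 < m := by linarith
  set x := 1 / (2 * m) with hx
  have hx0 : 0 < x := by positivity
  have hx6 : x ≤ 1 / 6 := by
    rw [hx]; exact one_div_le_one_div_of_le (by norm_num) (by linarith)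
  have hxm : 2 * m * x = 1 := by rw [hx]; field_simp
  obtain ⟨γ, hγ, hstab⟩ := exists_stability hx0 hx6 hδ
  refine ⟨γ / 2, by positivity, fun ε hε hε1 => ?_⟩
  set η := ε / 4 with hη
  have hη0 : 0 < η := by positivity
  set ρ := min ρ' (η ^ Fintype.card K / 2 * (γ / 2)) with hρ
  obtain ⟨n₀, hn₀⟩ := exists_nat_gt
    ((Fintype.card K : ℝ) * Fintype.card K / (η ^ Fintype.card K / 2))
  refine ⟨ρ, by positivity, n₀, ?_⟩
  intro V _ _ _ Ω hn hdeg hnon y hy hsum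
  have hN : (0 : ℝ) < Fintype.card V := by exact_mod_cast Fintype.card_pos
  obtain ⟨a, ⟨v₀, hv₀⟩, ha1, ha2⟩ := exists_threshold y (b := η * Fintype.card V) (by positivity)
    (by nlinarith)
  have ha0 : 0 ≤ a := hv₀ ▸ hy v₀
  set Λ : Finset V := {v | y v ≤ a} with hΛ
  have hge : ((1 - η) * Fintype.card V : ℝ) ≤ #{v | a ≤ y v} := by
    have h1 := card_filter_add_card_filter_not (s := (univ : Finset V)) (fun v => y v < a)
    simp only [not_lt, card_univ] at h1
    have h2 : (#{v | y v < a} : ℝ) + #{v | a ≤ y v} = Fintype.card V := by exact_mod_cast h1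
    linarith
  have hsum2 : ∑ v, (max (y v) a - a) ≤ Fintype.card V - a * ((1 - η) * Fintype.card V) := by
    calc ∑ v, (max (y v) a - a) ≤ ∑ v, (y v - a * if a ≤ y v then 1 else 0) := by
          refine sum_le_sum fun v _ => ?_
          split_ifs with h
          · rw [max_eq_left h]; linarith
          · rw [max_eq_right (not_le.1 h).le]; linarith [hy v]
      _ = ∑ v, y v - a * #{v | a ≤ y v} := by
          rw [sum_sub_distrib, ← mul_sum, sum_boole]
      _ ≤ _ := by gcongr
  have ha3 : a * (1 - η) ≤ 1 := by
    have : (0 : ℝ) ≤ Fintype.card V - a * ((1 - η) * Fintype.card V) :=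
      (sum_nonneg fun v _ => sub_nonneg.2 (le_max_right _ _)).trans hsum2
    by_contra! hcon
    nlinarith
  have ha4 : a ≤ 2 := by nlinarith
  set h := 1 + ε - a with hh
  have hh0 : 0 < h := by nlinarith
  set w : V → ℝ := fun v => (max (y v) a - a) / (2 * m * h) with hw
  have hw0 : ∀ v, 0 ≤ w v := fun v => div_nonneg (sub_nonneg.2 (le_max_right _ _)) (by positivity)
  have hyw : ∀ v, y v ≤ a + 2 * m * h * w v := by
    intro v
    rw [hw]
    dsimp only
    rw [mul_div_cancel₀ _ (by positivity)]
    linarith [le_max_left (y v) a]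
  have hwsum : ∑ v, w v ≤ x * Fintype.card V := by
    rw [hw]
    dsimp only
    rw [← sum_div, div_le_iff₀ (by positivity)]
    have : x * Fintype.card V * (2 * m * h) = h * Fintype.card V := by
      calc _ = (2 * m * x) * (h * Fintype.card V) := by ring
        _ = _ := by rw [hxm, one_mul]
    rw [this]
    refine hsum2.trans ?_
    rw [hh]
    nlinarith
  have hNk : (0 : ℝ) < (Fintype.card V : ℝ) ^ Fintype.card K := by positivity
  by_cases hP : (2 * x - x ^ 2 - γ) * (Fintype.card V : ℝ) ^ 2 ≤ #{p : V × V | 1 < w p.1 + w p.2}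
  · have hB := hstab V w hw0 hwsum hP
    have h1 := hnon {v | w v ≤ x} (by
      have h1 := card_filter_add_card_filter_not (s := (univ : Finset V)) (fun v => x < w v)
      simp only [not_lt, card_univ] at h1
      have h2 : (#{v | x < w v} : ℝ) + #{v | w v ≤ x} = Fintype.card V := by exact_mod_cast h1
      linarith)
    refine (mul_le_mul_of_nonneg_right (min_le_left _ _) hNk.le).trans (h1.trans ?_)
    norm_cast
    refine card_le_card fun z hz => ?_
    rw [mem_filter] at hz ⊢
    refine ⟨hz.1, ?_⟩
    have hle : ∀ i, y (z i) ≤ 1 + ε := by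
      intro i
      have h3 := (mem_filter.1 (hz.2 i)).2
      have h4 : 2 * m * h * w (z i) ≤ h := by
        calc 2 * m * h * w (z i) ≤ 2 * m * h * x := by gcongr
          _ = (2 * m * x) * h := by ring
          _ = h := by rw [hxm, one_mul]
      have := hyw (z i)
      rw [hh] at h4 this
      linarith
    calc ∑ i, wt i * y (z i) ≤ ∑ i, wt i * (1 + ε) :=
          sum_le_sum fun i _ => mul_le_mul_of_nonneg_left (hle i) (hwt i)
      _ = m * (1 + ε) := by rw [← sum_mul, hm]
  · push Not at hP
    set A := Fintype.piFinset fun _ : K => Λ with hA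
    have hAc : η ^ Fintype.card K * (Fintype.card V : ℝ) ^ Fintype.card K ≤ #A := by
      rw [hA, Fintype.card_piFinset, prod_const, card_univ, Nat.cast_pow, ← mul_pow]
      gcongr
    have hinj := card_good_tuples_ge (α' := η ^ Fintype.card K / 2) (∅ : Finset V) A hAc (by
      rw [div_lt_iff₀ (by positivity)] at hn₀
      have : (n₀ : ℝ) ≤ Fintype.card V := by exact_mod_cast hn
      rw [card_empty, Nat.cast_zero, zero_add]
      refine hn₀.le.trans ?_
      rw [mul_comm]
      gcongr)
    set I : Finset (K → V) := {C ∈ A | Function.Injective C ∧ ∀ p, C p ∉ (∅ : Finset V)} with hI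
    set Gd : Finset (K → V) := {z ∈ Ω | ∑ i, wt i * y (z i) ≤ m * (1 + ε)} with hGd
    have hpairs : ∀ z ∈ I, γ / 2 * (Fintype.card V : ℝ) ^ 2 ≤
        #{p : V × V | setTwo i₀ i₁ z p ∈ Gd} := by
      intro z hz
      rw [hI, mem_filter] at hz
      have h1 := hdeg z hz.2.1
      have h2 : #{p : V × V | setTwo i₀ i₁ z p ∈ Ω} ≤
          #{p : V × V | 1 < w p.1 + w p.2} + #{p : V × V | setTwo i₀ i₁ z p ∈ Gd} := by
        refine (card_le_card fun p hp => ?_).trans (card_union_le _ _)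
        rw [mem_filter] at hp
        rw [mem_union, mem_filter, mem_filter]
        by_cases hp2 : 1 < w p.1 + w p.2
        · exact Or.inl ⟨mem_univ _, hp2⟩
        · refine Or.inr ⟨mem_univ _, ?_⟩
          rw [hGd, mem_filter]
          refine ⟨hp.2, ?_⟩
          rw [not_lt] at hp2
          have hΛz : ∀ i, y (z i) ≤ a := fun i =>
            (mem_filter.1 (Fintype.mem_piFinset.1 hz.1 i)).2
          have e : ∀ i, wt i * y (setTwo i₀ i₁ z p i) ≤ wt i * a +
              ((if i = i₀ then m * h * w p.1 else 0) + if i = i₁ then m * h * w p.2 else 0) := by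
            intro i
            unfold setTwo
            by_cases e1 : i = i₁
            · subst e1
              rw [Function.update_self, if_neg hi.symm, if_pos rfl, h₁]
              linarith [hyw p.2]
            · rw [Function.update_of_ne e1, if_neg e1]
              by_cases e0 : i = i₀
              · subst e0
                rw [Function.update_self, if_pos rfl, h₀]
                linarith [hyw p.1]
              · rw [Function.update_of_ne e0, if_neg e0]
                linarith [mul_le_mul_of_nonneg_left (hΛz i) (hwt i)]
          refine (sum_le_sum fun i _ => e i).trans ?_
          rw [sum_add_distrib, sum_add_distrib, sum_ite_eq', sum_ite_eq', if_pos (mem_univ _),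
            if_pos (mem_univ _), ← sum_mul, hm, ← mul_add]
          have : m * h * (w p.1 + w p.2) ≤ m * h * 1 := by gcongr
          rw [hh] at this ⊢
          linarith
      have h3 : (#{p : V × V | setTwo i₀ i₁ z p ∈ Ω} : ℝ) ≤
          #{p : V × V | 1 < w p.1 + w p.2} + #{p : V × V | setTwo i₀ i₁ z p ∈ Gd} := by
        exact_mod_cast h2
      have h4 : 1 - (1 - x) ^ 2 - γ / 2 = (2 * x - x ^ 2 - γ) + γ / 2 := by ring
      rw [h4, add_mul] at h1
      linarith
    have hcount : #(I.sigma fun z => ({p : V × V | setTwo i₀ i₁ z p ∈ Gd} : Finset (V × V))) ≤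
        #(Gd ×ˢ (univ : Finset (V × V))) := by
      refine card_le_card_of_injOn (fun s => (setTwo i₀ i₁ s.1 s.2, (s.1 i₀, s.1 i₁))) ?_ ?_
      · intro s hs
        have hs' := mem_sigma.1 (mem_coe.1 hs)
        exact mem_coe.2 (mem_product.2 ⟨(mem_filter.1 hs'.2).2, mem_univ _⟩)
      · rintro ⟨z, p⟩ - ⟨z', p'⟩ - hzz
        simp only [Prod.mk.injEq] at hzz
        obtain ⟨e1, e2, e3⟩ := hzz
        have hp2 : p.2 = p'.2 := by
          have := congrFun e1 i₁
          simpa [setTwo] using this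
        have hp1 : p.1 = p'.1 := by
          have := congrFun e1 i₀
          simpa [setTwo, Function.update_of_ne hi] using this
        have hz : z = z' := by
          funext i
          by_cases c1 : i = i₁
          · rw [c1, e3]
          by_cases c0 : i = i₀
          · rw [c0, e2]
          have := congrFun e1 i
          simpa [setTwo, Function.update_of_ne c1, Function.update_of_ne c0] using this
        rw [hz, Prod.ext hp1 hp2]
    rw [card_sigma, card_product, card_univ, Fintype.card_prod] at hcount
    have hc2 : (∑ z ∈ I, (#{p : V × V | setTwo i₀ i₁ z p ∈ Gd} : ℝ)) ≤
        #Gd * (Fintype.card V * Fintype.card V) := by exact_mod_cast hcount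
    have hc3 := (card_nsmul_le_sum I _ _ hpairs).trans hc2
    rw [nsmul_eq_mul] at hc3
    have hc4 : (#I : ℝ) * (γ / 2) ≤ #Gd := by
      refine le_of_mul_le_mul_right (a := (Fintype.card V : ℝ) ^ 2) ?_ (by positivity)
      calc _ = (#I : ℝ) * (γ / 2 * (Fintype.card V : ℝ) ^ 2) := by ring
        _ ≤ _ := hc3
        _ = _ := by ring
    refine le_trans ?_ hc4
    calc ρ * (Fintype.card V : ℝ) ^ Fintype.card K
        ≤ η ^ Fintype.card K / 2 * (γ / 2) * (Fintype.card V : ℝ) ^ Fintype.card K := by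
          gcongr; exact min_le_right _ _
      _ = (η ^ Fintype.card K - η ^ Fintype.card K / 2) *
          (Fintype.card V : ℝ) ^ Fintype.card K * (γ / 2) := by ring
      _ ≤ #I * (γ / 2) := by gcongr

end Fractional

section Minimax

variable {V K : Type*} [Fintype V] [DecidableEq V] [Fintype K] [DecidableEq K]

/-- The weighted load of the vertex `v` under the tuple weighting `x`. -/
def vertexLoad (wt : K → ℝ) (x : (K → V) → ℝ) (v : V) : ℝ :=
  ∑ z, x z * ∑ i, if z i = v then wt i else 0

theorem sum_mul_vertexLoad (wt : K → ℝ) (x : (K → V) → ℝ) (y : V → ℝ) :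
    ∑ v, y v * vertexLoad wt x v = ∑ z, x z * ∑ i, wt i * y (z i) := by
  simp only [vertexLoad, mul_sum]
  rw [sum_comm]
  refine sum_congr rfl fun z _ => ?_
  rw [sum_comm]
  refine sum_congr rfl fun i _ => ?_
  simp only [mul_ite, mul_zero, sum_ite_eq, mem_univ, if_true]
  ring

open Classical in
/-- If every weighting has many light tuples, there is a spread fractional tiling. -/
theorem exists_fractional_tiling [Nonempty V] (wt : K → ℝ) (Ω : Finset (K → V)) {ρ c : ℝ}
    (hρ : 0 < ρ)
    (h : ∀ y : V → ℝ, (∀ v, 0 ≤ y v) → ∑ v, y v ≤ Fintype.card V →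
      ρ * (Fintype.card V : ℝ) ^ Fintype.card K ≤ #{z ∈ Ω | ∑ i, wt i * y (z i) ≤ c}) :
    ∃ x : (K → V) → ℝ, (∀ z, 0 ≤ x z) ∧ (∀ z, z ∉ Ω → x z = 0) ∧
      (∀ z, x z ≤ 1 / (ρ * (Fintype.card V : ℝ) ^ Fintype.card K)) ∧ ∑ z, x z = 1 ∧
      ∀ v, vertexLoad wt x v ≤ c / Fintype.card V := by
  have hN : (0 : ℝ) < Fintype.card V := by exact_mod_cast Fintype.card_pos
  set b := 1 / (ρ * (Fintype.card V : ℝ) ^ Fintype.card K) with hb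
  set S : Set ((K → V) → ℝ) := Set.Icc 0 (fun z => if z ∈ Ω then b else 0) ∩
    {x | ∑ z, x z = 1} with hS
  have hb0 : 0 ≤ b := by positivity
  have hconv : Convex ℝ S := by
    refine (convex_Icc _ _).inter ?_
    intro x hx y hy s t hs ht hst
    rw [Set.mem_ofPred_eq] at *
    simp only [Pi.add_apply, Pi.smul_apply, smul_eq_mul, sum_add_distrib, ← mul_sum, hx, hy]
    linarith
  have hcomp : IsCompact S := by
    refine isCompact_Icc.inter_right ?_
    exact isClosed_eq (by fun_prop) continuous_const
  let L : ((K → V) → ℝ) →ₗ[ℝ] (V → ℝ) :=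
    { toFun := vertexLoad wt
      map_add' := by
        intro x y; funext v
        simp only [vertexLoad, Pi.add_apply, add_mul, sum_add_distrib]
      map_smul' := by
        intro r x; funext v
        simp only [vertexLoad, Pi.smul_apply, smul_eq_mul, mul_sum, RingHom.id_apply, mul_assoc] }
  have hLcont : Continuous L := L.continuous_of_finiteDimensional
  set U : Set (V → ℝ) := Set.Iic (fun _ => c / Fintype.card V) with hU
  by_cases hdis : Disjoint (L '' S) U
  · exfalso
    obtain ⟨f, s, t, hf1, hst, hf2⟩ := geometric_hahn_banach_compact_closed
      (hconv.linear_image L) (hcomp.image hLcont) (convex_Iic _) isClosed_Iic hdis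
    set y : V → ℝ := fun v => - f (Pi.single v 1) with hy
    have hf : ∀ u : V → ℝ, f u = - ∑ v, y v * u v := by
      intro u
      conv_lhs => rw [← Finset.univ_sum_single u]
      rw [map_sum, ← sum_neg_distrib]
      refine sum_congr rfl fun v _ => ?_
      have : (Pi.single v (u v) : V → ℝ) = u v • Pi.single v 1 := by
        rw [← Pi.single_smul, smul_eq_mul, mul_one]
      rw [this, map_smul, smul_eq_mul, hy]
      ring
    have hcU : (fun _ => c / Fintype.card V : V → ℝ) ∈ U := Set.mem_Iic.2 le_rfl
    have hy0 : ∀ v, 0 ≤ y v := by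
      intro v
      by_contra! hneg
      obtain ⟨r, hr⟩ : ∃ r : ℝ, 0 ≤ r ∧
          f (fun _ => c / Fintype.card V) - t + r * y v ≤ 0 := by
        refine ⟨(f (fun _ => c / Fintype.card V) - t) / (- y v), ?_, ?_⟩
        · exact div_nonneg (by linarith [hf2 _ hcU]) (by linarith)
        · rw [div_neg, neg_mul, div_mul_cancel₀ _ hneg.ne]
          linarith
      have h1 := hf2 ((fun _ => c / Fintype.card V) - r • Pi.single v 1) (by
        rw [Set.mem_Iic]
        refine sub_le_self _ (smul_nonneg hr.1 ?_)
        exact Pi.single_nonneg.2 zero_le_one)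
      rw [map_sub, map_smul, smul_eq_mul] at h1
      have h2 : f (Pi.single v 1) = - y v := by rw [hy]; ring
      rw [h2] at h1
      linarith [hr.2]
    set σ := ∑ v, y v with hσ
    have hσ0 : 0 ≤ σ := sum_nonneg fun v _ => hy0 v
    have hkey : ∀ x ∈ S, c / Fintype.card V * σ < ∑ z, x z * ∑ i, wt i * y (z i) := by
      intro x hx
      have h1 := hf1 _ (Set.mem_image_of_mem L hx)
      have h2 := hf2 _ hcU
      rw [hf] at h1 h2
      have h3 : L x = vertexLoad wt x := rfl
      rw [h3, sum_mul_vertexLoad] at h1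
      rw [← sum_mul, ← hσ] at h2
      linarith
    set G : Finset (K → V) := {z ∈ Ω | ∑ i, wt i * y (z i) ≤ c / Fintype.card V * σ} with hG
    have hGc : ρ * (Fintype.card V : ℝ) ^ Fintype.card K ≤ #G := by
      rcases hσ0.eq_or_lt with h0 | h0
      · have hyz : ∀ v, y v = 0 := fun v =>
          (sum_eq_zero_iff_of_nonneg fun v _ => hy0 v).1 h0.symm v (mem_univ v)
        have hc : G = Ω := by
          rw [hG, ← h0]
          refine filter_true_of_mem fun z _ => ?_
          simp [hyz]
        rw [hc]
        refine (h y hy0 (by rw [← hσ, ← h0]; exact hN.le)).trans ?_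
        norm_cast
        exact card_le_card (filter_subset _ _)
      · have h1 := h (fun v => Fintype.card V / σ * y v)
          (fun v => mul_nonneg (by positivity) (hy0 v))
          (by rw [← mul_sum, ← hσ, div_mul_cancel₀ _ h0.ne'])
        refine h1.trans ?_
        norm_cast
        refine card_le_card fun z hz => ?_
        rw [mem_filter] at hz
        rw [hG, mem_filter]
        refine ⟨hz.1, ?_⟩
        have h2 : ∑ i, wt i * (Fintype.card V / σ * y (z i)) =
            Fintype.card V / σ * ∑ i, wt i * y (z i) := by
          rw [mul_sum]
          exact sum_congr rfl fun i _ => by ring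
        have h3 := hz.2
        rw [h2, div_mul_eq_mul_div, div_le_iff₀ h0] at h3
        rw [div_mul_eq_mul_div, le_div_iff₀ hN]
        linarith
    have hG0 : (0 : ℝ) < #G := lt_of_lt_of_le (by positivity) hGc
    have h1 := hkey (fun z => if z ∈ G then 1 / (#G : ℝ) else 0) (by
      refine ⟨Set.mem_Icc.2 ⟨fun z => ?_, fun z => ?_⟩, ?_⟩
      · dsimp only [Pi.zero_apply]
        split_ifs
        · exact one_div_nonneg.2 hG0.le
        · exact le_rfl
      · dsimp only
        by_cases hz : z ∈ G
        · rw [if_pos hz, if_pos (mem_filter.1 hz).1, hb]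
          exact one_div_le_one_div_of_le (by positivity) hGc
        · rw [if_neg hz]
          split_ifs
          · exact hb0
          · exact le_rfl
      · rw [Set.mem_ofPred_eq, ← sum_filter, filter_mem_eq_inter, univ_inter, sum_const,
          nsmul_eq_mul]
        exact mul_one_div_cancel hG0.ne')
    simp only [ite_mul, zero_mul] at h1
    rw [← sum_filter, filter_mem_eq_inter, univ_inter] at h1
    have h2 : ∑ z ∈ G, 1 / (#G : ℝ) * ∑ i, wt i * y (z i) ≤
        ∑ z ∈ G, 1 / (#G : ℝ) * (c / Fintype.card V * σ) :=
      sum_le_sum fun z hz => mul_le_mul_of_nonneg_left (mem_filter.1 hz).2 (one_div_nonneg.2 hG0.le)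
    rw [sum_const, nsmul_eq_mul, ← mul_assoc, mul_one_div_cancel hG0.ne', one_mul] at h2
    linarith
  · obtain ⟨u, ⟨x, hx, rfl⟩, hu⟩ := Set.not_disjoint_iff.1 hdis
    obtain ⟨hx1, hx2⟩ := hx
    rw [Set.mem_Icc] at hx1
    refine ⟨x, fun z => hx1.1 z, fun z hz => ?_, fun z => ?_, hx2, fun v => hu v⟩
    · have h1 := hx1.2 z
      dsimp only at h1
      rw [if_neg hz] at h1
      exact le_antisymm h1 (hx1.1 z)
    · refine (hx1.2 z).trans ?_
      dsimp only
      split_ifs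
      · exact le_rfl
      · exact hb0

end Minimax

section Alternating

/-- The weight of a position within an edge: half for positions in overlaps. -/
noncomputable def posWt (k l : ℕ) (i : Fin k) : ℝ := if l ≤ i.1 ∧ i.1 < k - l then 1 else 1 / 2

theorem posWt_nonneg (k l : ℕ) (i : Fin k) : 0 ≤ posWt k l i := by
  unfold posWt; split_ifs <;> norm_num

theorem sum_posWt {k l : ℕ} (hl2 : 2 * l < k) : ∑ i, posWt k l i = k - l := by
  have h1 : ∀ i : Fin k, posWt k l i = 1 / 2 + 1 / 2 * if l ≤ i.1 ∧ i.1 < k - l then 1 else 0 := by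
    intro i; unfold posWt; split_ifs <;> norm_num
  simp only [h1]
  rw [sum_add_distrib, ← mul_sum, sum_boole, sum_const, card_univ, Fintype.card_fin, nsmul_eq_mul]
  have h2 : #{i : Fin k | l ≤ i.1 ∧ i.1 < k - l} = k - 2 * l := by
    have h3 : ({i : Fin k | l ≤ i.1 ∧ i.1 < k - l} : Finset (Fin k)).map Fin.valEmbedding =
        Ico l (k - l) := by
      ext j
      simp only [mem_map, mem_filter, mem_univ, true_and, Fin.valEmbedding_apply, mem_Ico]
      constructor
      · rintro ⟨i, hi, rfl⟩; exact hi
      · intro hj; exact ⟨⟨j, by omega⟩, hj, rfl⟩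
    rw [← card_map Fin.valEmbedding, h3, Nat.card_Ico]
    omega
  rw [h2, Nat.cast_sub hl2.le]
  push_cast
  ring

variable {k l : ℕ}

/-- The classes of one of the two overlaps of an edge. -/
def endBlock (k l : ℕ) (b : Bool) : List (Fin k) :=
  (List.finRange k).filter fun i => if b then i.1 < l else k - l ≤ i.1

/-- The classes of the middle of an edge. -/
def midBlock (k l : ℕ) : List (Fin k) :=
  (List.finRange k).filter fun i => l ≤ i.1 ∧ i.1 < k - l

/-- The classes of a path traversing its edges alternatingly forwards and backwards. -/
def altList (k l : ℕ) : Bool → ℕ → List (Fin k)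
  | b, 0 => endBlock k l b
  | b, n + 1 => endBlock k l b ++ (midBlock k l ++ altList k l (!b) n)

theorem length_filter_finRange (p : Fin k → Prop) [DecidablePred p] :
    ((List.finRange k).filter fun i => p i).length = #{i : Fin k | p i} := by
  rw [← List.toFinset_card_of_nodup ((List.nodup_finRange k).filter _)]
  congr 1
  ext i
  simp

theorem length_endBlock (hl2 : 2 * l < k) (b : Bool) : (endBlock k l b).length = l := by
  unfold endBlock
  cases b
  · simp only [Bool.false_eq_true, if_false]
    rw [length_filter_finRange (fun i => k - l ≤ i.1)]
    have h3 : ({i : Fin k | k - l ≤ i.1} : Finset (Fin k)).map Fin.valEmbedding =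
        Ico (k - l) k := by
      ext j
      simp only [mem_map, mem_filter, mem_univ, true_and, Fin.valEmbedding_apply, mem_Ico]
      constructor
      · rintro ⟨i, hi, rfl⟩; exact ⟨hi, i.2⟩
      · intro hj; exact ⟨⟨j, by omega⟩, hj.1, rfl⟩
    rw [← card_map Fin.valEmbedding, h3, Nat.card_Ico]
    omega
  · simp only [if_true]
    rw [length_filter_finRange (fun i => i.1 < l)]
    have h3 : ({i : Fin k | i.1 < l} : Finset (Fin k)).map Fin.valEmbedding = range l := by
      ext j
      simp only [mem_map, mem_filter, mem_univ, true_and, Fin.valEmbedding_apply, mem_range]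
      constructor
      · rintro ⟨i, hi, rfl⟩; exact hi
      · intro hj; exact ⟨⟨j, by omega⟩, hj, rfl⟩
    rw [← card_map Fin.valEmbedding, h3, card_range]

theorem length_midBlock (hl2 : 2 * l < k) : (midBlock k l).length = k - 2 * l := by
  unfold midBlock
  rw [length_filter_finRange (fun i => l ≤ i.1 ∧ i.1 < k - l)]
  have h3 : ({i : Fin k | l ≤ i.1 ∧ i.1 < k - l} : Finset (Fin k)).map Fin.valEmbedding =
      Ico l (k - l) := by
    ext j
    simp only [mem_map, mem_filter, mem_univ, true_and, Fin.valEmbedding_apply, mem_Ico]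
    constructor
    · rintro ⟨i, hi, rfl⟩; exact hi
    · intro hj; exact ⟨⟨j, by omega⟩, hj, rfl⟩
  rw [← card_map Fin.valEmbedding, h3, Nat.card_Ico]
  omega

theorem length_altList (hl2 : 2 * l < k) (b : Bool) (n : ℕ) :
    (altList k l b n).length = l + n * (k - l) := by
  induction n generalizing b with
  | zero => simp [altList, length_endBlock hl2]
  | succ n ih =>
    rw [altList, List.length_append, List.length_append, length_endBlock hl2,
      length_midBlock hl2, ih, add_mul]
    omega

theorem exists_altList_eq (b : Bool) (n : ℕ) : ∃ r, altList k l b n = endBlock k l b ++ r := by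
  cases n with
  | zero => exact ⟨[], by simp [altList]⟩
  | succ n => exact ⟨_, rfl⟩

theorem isPath_altList (hl2 : 2 * l < k) (b : Bool) (n : ℕ) :
    IsPath k l (fun w => w.Nodup ∧ ∀ i, i ∈ w) (altList k l b n) := by
  induction n generalizing b with
  | zero =>
    refine isPath_of_length_lt ?_
    rw [length_altList hl2]
    omega
  | succ n ih =>
    obtain ⟨r, hr⟩ := exists_altList_eq (k := k) (l := l) (!b) n
    have h := ih (!b)
    rw [altList, hr]
    rw [hr] at h
    refine isPath_cons_block (by omega) ?_ (length_endBlock hl2 _) ?_ h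
    · rw [length_endBlock hl2, length_midBlock hl2]; omega
    · have hmem : ∀ i : Fin k, i ∈ endBlock k l b ++ midBlock k l ++ endBlock k l (!b) := by
        intro i
        cases b <;> simp [endBlock, midBlock] <;> omega
      refine ⟨?_, hmem⟩
      have h1 := perm_univ_of_length hmem (by
        rw [List.length_append, List.length_append, length_endBlock hl2, length_midBlock hl2,
          length_endBlock hl2, Fintype.card_fin]
        omega)
      exact h1.nodup_iff.2 (nodup_toList _)

theorem count_endBlock (b : Bool) (i : Fin k) :
    (endBlock k l b).count i = if (if b then i.1 < l else k - l ≤ i.1) then 1 else 0 := by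
  unfold endBlock
  rw [((List.nodup_finRange k).filter _).count]
  cases b <;> simp

theorem count_midBlock (i : Fin k) :
    (midBlock k l).count i = if l ≤ i.1 ∧ i.1 < k - l then 1 else 0 := by
  unfold midBlock
  rw [((List.nodup_finRange k).filter _).count]
  simp

theorem count_altList_aux (hl2 : 2 * l < k) (b : Bool) (n : ℕ) (i : Fin k) :
    (i.1 < l → 2 * (altList k l b n).count i ≤ n + if b then 2 else 1) ∧
    (k - l ≤ i.1 → 2 * (altList k l b n).count i ≤ n + if b then 1 else 2) ∧
    (l ≤ i.1 ∧ i.1 < k - l → (altList k l b n).count i ≤ n) := by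
  induction n generalizing b with
  | zero =>
    rw [altList, count_endBlock]
    cases b <;> simp <;> refine ⟨fun h => ?_, fun h => ?_, fun h => ?_⟩ <;>
      first | omega | (split_ifs <;> omega)
  | succ n ih =>
    obtain ⟨h1, h2, h3⟩ := ih (!b)
    rw [altList, List.count_append, List.count_append, count_endBlock, count_midBlock]
    cases b <;> simp at h1 h2 h3 ⊢ <;> refine ⟨fun h => ?_, fun h => ?_, fun h => ?_⟩ <;>
      split_ifs <;> omega

theorem count_altList_le (hl2 : 2 * l < k) (b : Bool) (n : ℕ) (i : Fin k) :
    ((altList k l b n).count i : ℝ) ≤ (n + 2) * posWt k l i := by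
  obtain ⟨h1, h2, h3⟩ := count_altList_aux hl2 b n i
  unfold posWt
  split_ifs with h
  · have := h3 h
    have h4 : (altList k l b n).count i ≤ n + 2 := by omega
    rw [mul_one]
    exact_mod_cast h4
  · have h4 : 2 * (altList k l b n).count i ≤ n + 2 := by
      rcases lt_or_ge i.1 l with h5 | h5
      · have := h1 h5
        split_ifs at this <;> omega
      · have := h2 (by omega)
        split_ifs at this <;> omega
    have h5 : (2 : ℝ) * (altList k l b n).count i ≤ n + 2 := by exact_mod_cast h4
    linarith

end Alternating

section BoxPaths

variable {k l : ℕ}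

theorem mem_boxPart {V K : Type*} [DecidableEq V] [Fintype K] {Ω : Finset (K → V)}
    {X : K → Finset V} {z : K → V} : z ∈ boxPart Ω X ↔ z ∈ Ω ∧ ∀ i, z i ∈ X i := by
  unfold boxPart; exact mem_filter

/-- The edges underlying a set of tuples. -/
def tupleEdges {V : Type*} [DecidableEq V] (Ω : Finset (Fin k → V)) : Finset (Finset V) :=
  Ω.image fun z => univ.image z

/-- The number of vertices of colour `j` a path with colour vector `a` may use. -/
noncomputable def colourUse {ι : Type*} [DecidableEq ι] (k l L : ℕ) (a : Fin k → ι) (j : ι) : ℝ :=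
  ∑ i, if a i = j then (L + 2) * posWt k l i else 0

theorem colourUse_nonneg {ι : Type*} [DecidableEq ι] (L : ℕ) (a : Fin k → ι) (j : ι) :
    0 ≤ colourUse k l L a j := by
  refine sum_nonneg fun i _ => ?_
  split_ifs
  · exact mul_nonneg (by positivity) (posWt_nonneg k l i)
  · exact le_rfl

theorem isPath_ofFn_of_isBlowup {V : Type*} [Fintype V] [DecidableEq V] {Ω G : Finset (Fin k → V)}
    (hG : G ⊆ Ω) (cl : List (Fin k)) (hcl : IsPath k l (fun w => w.Nodup ∧ ∀ i, i ∈ w) cl)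
    {C : Fin cl.length → V} (hC : IsBlowup G cl.get C) :
    IsPath k l (EdgeList (tupleEdges Ω)) (List.ofFn C) := by
  have h1 : cl = (List.finRange cl.length).map cl.get := by
    rw [← List.ofFn_eq_map, List.ofFn_get]
  rw [h1, isPath_map] at hcl
  rw [List.ofFn_eq_map, isPath_map]
  refine hcl.mono fun w _ hw => ?_
  obtain ⟨z, hz, hz'⟩ := hC.list w hw.1
  refine mem_image.2 ⟨z, hG hz, ?_⟩
  ext v
  simp only [mem_image, mem_univ, true_and, List.mem_toFinset, List.mem_map]
  constructor
  · rintro ⟨i, rfl⟩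
    obtain ⟨p, hp, rfl⟩ := List.mem_map.1 (hw.2 i)
    exact ⟨p, hp, hz' p hp⟩
  · rintro ⟨p, hp, rfl⟩
    exact ⟨_, (hz' p hp).symm⟩

theorem exists_path_in_box (hl2 : 2 * l < k) (L : ℕ) {d : ℝ} (hd : 0 < d) :
    ∃ n₀ : ℕ, ∀ (V : Type) [Fintype V] [DecidableEq V] [Nonempty V] (Ω : Finset (Fin k → V)),
      n₀ ≤ Fintype.card V → ∀ X : Fin k → Finset V,
      d * (Fintype.card V : ℝ) ^ k ≤ #(boxPart Ω X) →
      ∃ P : List V, P.Nodup ∧ P.length = l + L * (k - l) ∧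
        IsPath k l (EdgeList (tupleEdges Ω)) P ∧ (∀ v ∈ P, ∃ i, v ∈ X i) ∧
        ∀ (ι : Type) [DecidableEq ι] (χ : V → ι) (a : Fin k → ι),
          (∀ i, ∀ v ∈ X i, χ v = a i) → ∀ j,
          (#{v ∈ P.toFinset | χ v = j} : ℝ) ≤ colourUse k l L a j := by
  classical
  set cl := altList k l true L with hcl
  set s := cl.length with hs
  obtain ⟨n₀, hn₀⟩ := exists_nat_gt ((s : ℝ) * s / d ^ 2 ^ s)
  refine ⟨n₀, fun V _ _ _ Ω hn X hX => ?_⟩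
  have h1 := card_isBlowup_ge (boxPart Ω X) hd.le (by rwa [Fintype.card_fin]) cl.get
  rw [Fintype.card_fin] at h1
  rw [div_lt_iff₀ (by positivity)] at hn₀
  obtain ⟨C, hC, hinj, -⟩ := exists_good_tuple (κ := Fin s) ∅ {C | IsBlowup (boxPart Ω X) cl.get C}
    (α := d ^ 2 ^ s) (by rw [Fintype.card_fin]; convert h1) (by
      rw [card_empty, Nat.cast_zero, zero_add, Fintype.card_fin]
      refine hn₀.trans_le ?_
      rw [mul_comm]
      gcongr)
  have hC' : IsBlowup (boxPart Ω X) cl.get C := by simpa using hC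
  have hmem : ∀ p, C p ∈ X (cl.get p) := by
    intro p
    obtain ⟨z, hz, hz'⟩ := hC'.list [p] (by simp)
    rw [hz' p (by simp)]
    exact (mem_boxPart.1 hz).2 _
  refine ⟨List.ofFn C, List.nodup_ofFn.2 hinj, ?_, ?_, ?_, ?_⟩
  · rw [List.length_ofFn, hs, hcl, length_altList hl2]
  · exact isPath_ofFn_of_isBlowup (fun z hz => (mem_boxPart.1 hz).1) cl (isPath_altList hl2 true L) hC'
  · intro v hv
    obtain ⟨p, rfl⟩ := (List.mem_ofFn' C v).1 hv
    exact ⟨_, hmem p⟩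
  · intro ι _ χ a ha j
    have h2 : #{v ∈ (List.ofFn C).toFinset | χ v = j} ≤ #{p : Fin s | a (cl.get p) = j} := by
      refine (card_le_card fun v hv => ?_).trans
        (card_image_le (s := {p : Fin s | a (cl.get p) = j}) (f := C))
      rw [mem_filter, List.mem_toFinset, List.mem_ofFn'] at hv
      obtain ⟨⟨p, rfl⟩, hp⟩ := hv
      rw [mem_image]
      refine ⟨p, ?_, rfl⟩
      rw [mem_filter]
      exact ⟨mem_univ _, by rw [← hp]; exact (ha _ _ (hmem p)).symm⟩
    have h3 : (#{p : Fin s | a (cl.get p) = j} : ℝ) =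
        ∑ i : Fin k, if a i = j then (cl.count i : ℝ) else 0 := by
      rw [← sum_filter, ← Nat.cast_sum, Nat.cast_inj,
        card_eq_sum_card_fiberwise (f := cl.get) (t := {i : Fin k | a i = j})
          (by intro p hp; simpa using hp)]
      refine sum_congr rfl fun i hi => ?_
      rw [filter_filter]
      have h4 : ({p : Fin s | a (cl.get p) = j ∧ cl.get p = i} : Finset (Fin s)) =
          ({p : Fin s | cl.get p = i} : Finset (Fin s)) := by
        ext p
        simp only [mem_filter, mem_univ, true_and]
        exact ⟨fun h => h.2, fun h => ⟨h ▸ (mem_filter.1 hi).2, h⟩⟩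
      rw [h4]
      have h5 : cl = (List.finRange s).map cl.get := by
        rw [← List.ofFn_eq_map, List.ofFn_get]
      conv_rhs => rw [h5, List.count_eq_countP, List.countP_map]
      rw [List.countP_eq_length_filter,
        ← List.toFinset_card_of_nodup ((List.nodup_finRange s).filter _)]
      congr 1
      ext p
      simp
    calc (#{v ∈ (List.ofFn C).toFinset | χ v = j} : ℝ) ≤ #{p : Fin s | a (cl.get p) = j} := by
          exact_mod_cast h2
      _ = _ := h3
      _ ≤ _ := by
          refine sum_le_sum fun i _ => ?_
          split_ifs
          · exact count_altList_le hl2 true L i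
          · exact le_rfl

open Classical in
theorem exists_paths_in_boxes (hl2 : 2 * l < k) (L : ℕ) {d ε μ : ℝ} (hd : 0 < d)
    (hε : 0 < ε) (hμ : 0 < μ) :
    ∃ n₀ : ℕ, ∀ (V : Type) [Fintype V] [DecidableEq V] [Nonempty V] (Ω : Finset (Fin k → V)),
      n₀ ≤ Fintype.card V → ∀ (ι : Type) [Fintype ι] [DecidableEq ι] (χ : V → ι)
        (as : List (Fin k → ι)),
      (∀ a ∈ as, ¬ Irregular Ω ε d χ a ∧
        d * ∏ i, (#(colClass χ (a i)) : ℝ) ≤ #(boxPart Ω fun i => colClass χ (a i)) ∧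
        μ * (Fintype.card V : ℝ) ^ k ≤ ∏ i, (#(colClass χ (a i)) : ℝ)) →
      (∀ j, (as.map fun a => colourUse k l L a j).sum ≤ (1 - ε) * #(colClass χ j)) →
      ∃ Ps : List (List V), Ps.length = as.length ∧
        (∀ P ∈ Ps, P.length = l + L * (k - l) ∧ IsPath k l (EdgeList (tupleEdges Ω)) P) ∧
        Ps.flatten.Nodup ∧ ∀ j, (#{v ∈ Ps.flatten.toFinset | χ v = j} : ℝ) ≤
          (as.map fun a => colourUse k l L a j).sum := by
  obtain ⟨n₀, hn₀⟩ := exists_path_in_box hl2 L (d := d / 2 * ε ^ k * μ) (by positivity)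
  refine ⟨n₀, fun V _ _ _ Ω hn ι _ _ χ as => ?_⟩
  induction as with
  | nil => intro _ _; exact ⟨[], by simp⟩
  | cons a as ih =>
    intro has hcap
    obtain ⟨Ps, hlen, hPs, hnd, huse⟩ := ih (fun b hb => has b (List.mem_cons_of_mem _ hb))
      (fun j => by
        refine le_trans ?_ (hcap j)
        rw [List.map_cons, List.sum_cons]
        linarith [colourUse_nonneg (l := l) L a j])
    obtain ⟨h1, h2, h3⟩ := has a List.mem_cons_self
    set X : Fin k → Finset V := fun i => colClass χ (a i) \ Ps.flatten.toFinset with hX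
    have hXc : ∀ i, ε * #(colClass χ (a i)) ≤ #(X i) := by
      intro i
      have h4 : #(colClass χ (a i)) ≤
          #(X i) + #{v ∈ Ps.flatten.toFinset | χ v = a i} := by
        refine (card_le_card fun v hv => ?_).trans (card_union_le _ _)
        rw [mem_union, hX, mem_sdiff, mem_filter]
        by_cases h5 : v ∈ Ps.flatten.toFinset
        · exact Or.inr ⟨h5, (mem_filter.1 hv).2⟩
        · exact Or.inl ⟨hv, h5⟩
      have h5 : (#(colClass χ (a i)) : ℝ) ≤
          #(X i) + #{v ∈ Ps.flatten.toFinset | χ v = a i} := by exact_mod_cast h4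
      have h6 := huse (a i)
      have h7 := hcap (a i)
      rw [List.map_cons, List.sum_cons] at h7
      linarith [colourUse_nonneg (l := l) L a (a i)]
    have hbox : d / 2 * ∏ i, (#(X i) : ℝ) ≤ #(boxPart Ω X) := by
      by_contra! hcon
      exact h1 ⟨h2, X, fun i => sdiff_subset, hXc, hcon⟩
    have hprod : ε ^ k * ∏ i, (#(colClass χ (a i)) : ℝ) ≤ ∏ i, (#(X i) : ℝ) := by
      calc ε ^ k * ∏ i, (#(colClass χ (a i)) : ℝ) = ∏ i, ε * (#(colClass χ (a i)) : ℝ) := by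
            rw [prod_mul_distrib, prod_const, card_univ, Fintype.card_fin]
        _ ≤ _ := prod_le_prod (fun _ _ => by positivity) fun i _ => hXc i
    obtain ⟨P, hPnd, hPlen, hPp, hPX, hPu⟩ := hn₀ V Ω hn X (by
      refine le_trans ?_ hbox
      calc d / 2 * ε ^ k * μ * (Fintype.card V : ℝ) ^ k =
            d / 2 * (ε ^ k * (μ * (Fintype.card V : ℝ) ^ k)) := by ring
        _ ≤ d / 2 * (ε ^ k * ∏ i, (#(colClass χ (a i)) : ℝ)) := by gcongr
        _ ≤ _ := by gcongr)
    refine ⟨P :: Ps, by simp [hlen], ?_, ?_, ?_⟩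
    · intro P' hP'
      rcases List.mem_cons.1 hP' with rfl | hP'
      · exact ⟨hPlen, hPp⟩
      · exact hPs P' hP'
    · rw [List.flatten_cons, List.nodup_append']
      refine ⟨hPnd, hnd, fun v hv hv' => ?_⟩
      obtain ⟨i, hi⟩ := hPX v hv
      exact (mem_sdiff.1 hi).2 (List.mem_toFinset.2 hv')
    · intro j
      have h8 : #{v ∈ (P :: Ps).flatten.toFinset | χ v = j} ≤
          #{v ∈ P.toFinset | χ v = j} + #{v ∈ Ps.flatten.toFinset | χ v = j} := by
        rw [List.flatten_cons, List.toFinset_append, filter_union]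
        exact card_union_le _ _
      have h9 : (#{v ∈ (P :: Ps).flatten.toFinset | χ v = j} : ℝ) ≤
          #{v ∈ P.toFinset | χ v = j} + #{v ∈ Ps.flatten.toFinset | χ v = j} := by
        exact_mod_cast h8
      rw [List.map_cons, List.sum_cons]
      have h10 := hPu ι χ a (fun i v hv => (mem_filter.1 (mem_sdiff.1 hv).1).2) j
      refine h9.trans (add_le_add ?_ (huse j))
      exact h10

end BoxPaths

section PathTiling

variable {k l : ℕ}

theorem sum_map_flatMap_replicate {α : Type*} (S : Finset α) (n : α → ℕ) (f : α → ℝ) :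
    ((S.toList.flatMap fun a => List.replicate (n a) a).map f).sum = ∑ a ∈ S, n a * f a := by
  rw [← Finset.sum_map_toList]
  induction S.toList with
  | nil => simp
  | cons a t ih =>
    rw [List.flatMap_cons, List.map_append, List.sum_append, ih, List.map_replicate,
      List.sum_replicate, nsmul_eq_mul, List.map_cons, List.sum_cons]

open Classical in
/-- Few colour vectors are irregular, sparse or small, as measured by a spread weighting. -/
theorem sum_bad_colour_vectors_le {V K ι : Type*} [Fintype V] [DecidableEq V] [Nonempty V]
    [Fintype K] [DecidableEq K] [Fintype ι] [DecidableEq ι] (Ω : Finset (K → V)) (χ : V → ι)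
    {ε d μ b : ℝ} (hd : 0 ≤ d) (hb : 0 ≤ b) (hμ : 0 ≤ μ) (x : (K → V) → ℝ) (hx0 : ∀ z, 0 ≤ x z)
    (hxΩ : ∀ z, z ∉ Ω → x z = 0) (hxb : ∀ z, x z ≤ b)
    (hirr : (#{z : K → V | Irregular Ω ε d χ fun i => χ (z i)} : ℝ) ≤
      ε * (Fintype.card V : ℝ) ^ Fintype.card K) :
    ∑ a with ¬ (¬ Irregular Ω ε d χ a ∧
        d * ∏ i, (#(colClass χ (a i)) : ℝ) ≤ #(boxPart Ω fun i => colClass χ (a i)) ∧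
        μ * (Fintype.card V : ℝ) ^ Fintype.card K ≤ ∏ i, (#(colClass χ (a i)) : ℝ)),
      ∑ z with (fun i => χ (z i)) = a, x z ≤
      (ε + d + (Fintype.card ι : ℝ) ^ Fintype.card K * μ) *
        (b * (Fintype.card V : ℝ) ^ Fintype.card K) := by
  set M := (Fintype.card V : ℝ) ^ Fintype.card K with hM
  set X : (K → ι) → ℝ := fun a => ∑ z with (fun i => χ (z i)) = a, x z with hX
  have hX0 : ∀ a, 0 ≤ X a := fun a => sum_nonneg fun z _ => hx0 z
  have hfib : ∀ a : K → ι, (#{z : K → V | (fun i => χ (z i)) = a} : ℝ) =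
      ∏ i, (#(colClass χ (a i)) : ℝ) := by
    intro a
    have : ({z : K → V | (fun i => χ (z i)) = a} : Finset (K → V)) =
        Fintype.piFinset fun i => colClass χ (a i) := by
      ext z; simp [colVec_eq_iff, Fintype.mem_piFinset]
    rw [this, Fintype.card_piFinset, Nat.cast_prod]
  have htot : ∑ a : K → ι, ∏ i, (#(colClass χ (a i)) : ℝ) = M := by
    simp only [← hfib]
    rw [← Nat.cast_sum, ← card_eq_sum_card_fiberwise (f := fun (z : K → V) i => χ (z i))
      (fun z _ => by simp)]
    simp [hM]
  have h1 : ∑ a with Irregular Ω ε d χ a, X a ≤ ε * (b * M) := by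
    have e1 : ∑ a with Irregular Ω ε d χ a, X a =
        ∑ z with Irregular Ω ε d χ fun i => χ (z i), x z := by
      rw [← sum_fiberwise_of_maps_to (g := fun (z : K → V) i => χ (z i))
        (t := {a | Irregular Ω ε d χ a}) (by intro z hz; simpa using hz)]
      refine sum_congr rfl fun a ha => ?_
      rw [hX, filter_filter]
      refine sum_congr ?_ fun _ _ => rfl
      ext z
      have := (mem_filter.1 ha).2
      simp only [mem_filter, mem_univ, true_and]
      exact ⟨fun h => ⟨h ▸ this, h⟩, fun h => h.2⟩
    rw [e1]
    refine (sum_le_card_nsmul _ _ b fun z _ => hxb z).trans ?_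
    rw [nsmul_eq_mul]
    calc _ ≤ ε * M * b := by gcongr
      _ = _ := by ring
  have h2 : ∀ S : Finset (K → ι), (∀ a ∈ S, (#(boxPart Ω fun i => colClass χ (a i)) : ℝ) ≤
      d * ∏ i, (#(colClass χ (a i)) : ℝ)) → ∑ a ∈ S, X a ≤ d * (b * M) := by
    intro S hS
    have e1 : ∀ a ∈ S, X a ≤ b * (d * ∏ i, (#(colClass χ (a i)) : ℝ)) := by
      intro a ha
      have e2 : X a ≤ #(boxPart Ω fun i => colClass χ (a i)) * b := by
        rw [hX]
        dsimp only
        rw [← nsmul_eq_mul]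
        refine le_trans (le_of_eq ?_) (sum_le_card_nsmul _ x b fun z _ => hxb z)
        symm
        refine sum_subset (fun z hz => ?_) fun z hz hz' => ?_
        · rw [mem_filter]
          exact ⟨mem_univ _, colVec_eq_iff.2 (mem_boxPart.1 hz).2⟩
        · refine hxΩ z fun hzΩ => hz' (mem_boxPart.2 ⟨hzΩ, ?_⟩)
          exact colVec_eq_iff.1 (mem_filter.1 hz).2
      refine e2.trans ?_
      rw [mul_comm]
      exact mul_le_mul_of_nonneg_left (hS a ha) hb
    refine (sum_le_sum e1).trans ?_
    rw [← mul_sum, ← mul_sum]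
    have e3 : ∑ a ∈ S, ∏ i, (#(colClass χ (a i)) : ℝ) ≤ M := by
      rw [← htot]
      exact sum_le_sum_of_subset_of_nonneg (subset_univ S) fun a _ _ =>
        prod_nonneg fun _ _ => Nat.cast_nonneg _
    calc _ ≤ b * (d * M) := by gcongr
      _ = _ := by ring
  have h3 : ∀ S : Finset (K → ι), (∀ a ∈ S, ∏ i, (#(colClass χ (a i)) : ℝ) ≤ μ * M) →
      ∑ a ∈ S, X a ≤ (Fintype.card ι : ℝ) ^ Fintype.card K * μ * (b * M) := by
    intro S hS
    have hM0 : 0 ≤ M := by rw [hM]; positivity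
    have e1 : ∀ a ∈ S, X a ≤ μ * M * b := by
      intro a ha
      refine (sum_le_card_nsmul _ _ b fun z _ => hxb z).trans ?_
      rw [nsmul_eq_mul, hfib]
      exact mul_le_mul_of_nonneg_right (hS a ha) hb
    refine (sum_le_card_nsmul _ _ _ e1).trans ?_
    rw [nsmul_eq_mul]
    have e2 : (#S : ℝ) ≤ (Fintype.card ι : ℝ) ^ Fintype.card K := by
      have := card_le_univ S
      rw [Fintype.card_fun] at this
      exact_mod_cast this
    calc _ ≤ (Fintype.card ι : ℝ) ^ Fintype.card K * (μ * M * b) :=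
          mul_le_mul_of_nonneg_right e2 (mul_nonneg (mul_nonneg hμ hM0) hb)
      _ = _ := by ring
  have e : ∀ s t : Finset (K → ι), ∑ a ∈ s ∪ t, X a ≤ ∑ a ∈ s, X a + ∑ a ∈ t, X a := by
    intro s t
    rw [← sum_union_inter]
    linarith [sum_nonneg fun a (_ : a ∈ s ∩ t) => hX0 a]
  set S₁ : Finset (K → ι) := {a | Irregular Ω ε d χ a} with hS₁
  set S₂ : Finset (K → ι) := {a | (#(boxPart Ω fun i => colClass χ (a i)) : ℝ) <
          d * ∏ i, (#(colClass χ (a i)) : ℝ)} with hS₂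
  set S₃ : Finset (K → ι) := {a | ∏ i, (#(colClass χ (a i)) : ℝ) < μ * M} with hS₃
  have h4 := h2 S₂ fun a ha => (mem_filter.1 ha).2.le
  have h5 := h3 S₃ fun a ha => (mem_filter.1 ha).2.le
  refine (sum_le_sum_of_subset_of_nonneg (t := S₁ ∪ S₂ ∪ S₃) (fun a ha => ?_)
    fun a _ _ => hX0 a).trans ?_
  · rw [mem_filter] at ha
    rw [mem_union, mem_union, hS₁, hS₂, hS₃, mem_filter, mem_filter, mem_filter]
    have h6 := ha.2
    by_contra hcon
    push Not at hcon
    exact h6 ⟨hcon.1.1 (mem_univ _), hcon.1.2 (mem_univ _), hcon.2 (mem_univ _)⟩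
  · have e1 := e (S₁ ∪ S₂) S₃
    have e2 := e S₁ S₂
    rw [add_mul, add_mul]
    linarith

end PathTiling

section PathTiling

variable {k l : ℕ}

theorem one_sub_six_mul_le {x : ℝ} (h1 : 8 * x ≤ 1) :
    1 - 6 * x ≤ (1 - x) ^ 3 * (1 - 3 * x) := by
  have h2 : 1 - 3 * x ≤ (1 - x) ^ 3 := by
    nlinarith [mul_nonneg (sq_nonneg x) (by linarith : 0 ≤ 3 - x)]
  nlinarith [mul_le_mul_of_nonneg_right h2 (by linarith : 0 ≤ 1 - 3 * x), sq_nonneg x]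

set_option maxHeartbeats 1600000 in
open Classical in
/-- A hypergraph with large pair degrees which is not extremal has an almost perfect tiling by
long paths. -/
theorem exists_path_tiling (hk : 4 ≤ k) (hl1 : 1 ≤ l) (hl2 : 2 * l < k) {i₀ i₁ : Fin k}
    (hi₀ : i₀.1 = 0) (hi₁ : i₁.1 = k - 1) {δ ρ' : ℝ} (hδ : 0 < δ) (hρ' : 0 < ρ') :
    ∃ γ : ℝ, 0 < γ ∧ ∀ ε : ℝ, 0 < ε → ∃ L₀ : ℕ, ∀ L : ℕ, L₀ ≤ L → ∃ n₀ : ℕ,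
      ∀ (V : Type) [Fintype V] [DecidableEq V] [Nonempty V] (Ω : Finset (Fin k → V)),
      n₀ ≤ Fintype.card V →
      (∀ z : Fin k → V, Function.Injective z →
        (1 - (1 - 1 / (2 * ((k : ℝ) - l))) ^ 2 - γ) * (Fintype.card V : ℝ) ^ 2 ≤
          #{p : V × V | setTwo i₀ i₁ z p ∈ Ω}) →
      (∀ B : Finset V, (1 - 1 / (2 * ((k : ℝ) - l)) - δ) * Fintype.card V ≤ #B →
        ρ' * (Fintype.card V : ℝ) ^ k ≤ #{z ∈ Ω | ∀ i, z i ∈ B}) →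
      ∃ Ps : List (List V),
        (∀ P ∈ Ps, P.length = l + L * (k - l) ∧ IsPath k l (EdgeList (tupleEdges Ω)) P) ∧
        Ps.flatten.Nodup ∧ (1 - ε) * Fintype.card V ≤ (Ps.flatten.length : ℝ) := by
  set m : ℝ := (k : ℝ) - l with hm
  have hm3 : 3 ≤ m := by
    have h1 : l + 3 ≤ k := by omega
    have h2 : (l : ℝ) + 3 ≤ k := by exact_mod_cast h1
    linarith
  obtain ⟨γ, hγ, hlight⟩ := exists_light_tuples (Fin k) (i₀ := i₀) (i₁ := i₁)
    (by intro h; have := congrArg Fin.val h; omega) (posWt k l) (posWt_nonneg k l)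
    (by unfold posWt; rw [if_neg (by omega)]) (by unfold posWt; rw [if_neg (by omega)])
    hm3 (sum_posWt hl2) hδ hρ'
  refine ⟨γ, hγ, fun ε hε => ?_⟩
  set ε₁ := min ε 1 / 8 with hε₁
  have hε₁0 : 0 < ε₁ := by positivity
  have hε₁ε : 8 * ε₁ ≤ ε := by rw [hε₁]; linarith [min_le_left ε 1]
  have hε₁1 : 8 * ε₁ ≤ 1 := by rw [hε₁]; linarith [min_le_right ε 1]
  obtain ⟨ρ, hρ, n₁, hlight⟩ := hlight ε₁ hε₁0 (by linarith)
  obtain ⟨L₀, hL₀⟩ := exists_nat_gt (2 / ε₁)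
  rw [div_lt_iff₀ hε₁0] at hL₀
  refine ⟨L₀, fun L hL => ?_⟩
  have hLε : 2 ≤ ε₁ * (L + 2) := by
    have : (L₀ : ℝ) ≤ L := by exact_mod_cast hL
    nlinarith
  set ε₂ := min ε₁ (ε₁ * ρ) with hε₂
  have hε₂0 : 0 < ε₂ := by positivity
  have hε₂1 : ε₂ ≤ ε₁ := min_le_left _ _
  have hε₂2 : ε₂ ≤ ε₁ * ρ := min_le_right _ _
  have hd : 0 < ε₁ * ρ := by positivity
  obtain ⟨R, hR⟩ := exists_regular_colouring (Fin k) hε₂0 hd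
  set μ := ε₁ * ρ / ((R : ℝ) ^ k + 1) with hμ
  have hμ0 : 0 < μ := by positivity
  obtain ⟨n₂, hn₂⟩ := exists_paths_in_boxes hl2 L hd hε₂0 hμ0
  obtain ⟨n₃, hn₃⟩ := exists_nat_gt ((R : ℝ) ^ k * (L * m) / ε₁)
  rw [div_lt_iff₀ hε₁0] at hn₃
  refine ⟨max n₁ (max n₂ n₃), fun V _ _ _ Ω hn hdeg hnon => ?_⟩
  have hn1 : n₁ ≤ Fintype.card V := (le_max_left _ _).trans hn
  have hn2 : n₂ ≤ Fintype.card V := ((le_max_left _ _).trans (le_max_right _ _)).trans hn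
  have hn3 : (n₃ : ℝ) ≤ Fintype.card V := by
    exact_mod_cast ((le_max_right _ _).trans (le_max_right _ _)).trans hn
  have hN : (0 : ℝ) < Fintype.card V := by exact_mod_cast Fintype.card_pos
  set N : ℝ := (Fintype.card V : ℝ) with hNdef
  set c := m * (1 + ε₁) with hc
  have hc0 : 0 < c := by positivity
  have hl := hlight V Ω hn1 hdeg (by
    intro B hB
    have := hnon B hB
    rw [Fintype.card_fin]
    convert this)
  obtain ⟨x, hx0, hxΩ, hxb, hx1, hxl⟩ := exists_fractional_tiling (posWt k l) Ω hρ
    (c := c) (by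
      intro y hy hs
      have := hl y hy hs
      convert this)
  obtain ⟨ι, _, _, χ, hι, hirr⟩ := hR V Ω
  have hbad := sum_bad_colour_vectors_le Ω χ (μ := μ) hd.le (by positivity) hμ0.le x hx0 hxΩ hxb
    hirr
  rw [← hNdef, Fintype.card_fin] at hbad hxb
  set X : (Fin k → ι) → ℝ := fun a => ∑ z with (fun i => χ (z i)) = a, x z with hX
  have hX0 : ∀ a, 0 ≤ X a := fun a => sum_nonneg fun z _ => hx0 z
  set good : (Fin k → ι) → Prop := fun a => ¬ Irregular Ω ε₂ (ε₁ * ρ) χ a ∧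
        ε₁ * ρ * ∏ i, (#(colClass χ (a i)) : ℝ) ≤ #(boxPart Ω fun i => colClass χ (a i)) ∧
        μ * N ^ k ≤ ∏ i, (#(colClass χ (a i)) : ℝ) with hgood
  have hbad' : ∑ a with ¬ good a, X a ≤ 3 * ε₁ := by
    refine hbad.trans ?_
    have e1 : 1 / (ρ * N ^ k) * N ^ k = 1 / ρ := by field_simp
    rw [e1]
    have e2 : (Fintype.card ι : ℝ) ^ k * μ ≤ ε₁ * ρ := by
      have e3 : (Fintype.card ι : ℝ) ^ k ≤ (R : ℝ) ^ k + 1 := by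
        have : (Fintype.card ι : ℝ) ≤ R := by exact_mod_cast hι
        have := pow_le_pow_left₀ (by positivity) this k
        linarith
      calc _ ≤ ((R : ℝ) ^ k + 1) * μ := by gcongr
        _ = ε₁ * ρ := by rw [hμ]; field_simp
    rw [mul_one_div, div_le_iff₀ hρ]
    linarith
  have hXtot : ∑ a, X a = 1 := by
    rw [← hx1, hX]
    exact sum_fiberwise univ (fun (z : Fin k → V) i => χ (z i)) x
  have hgoodX : 1 - 3 * ε₁ ≤ ∑ a with good a, X a := by
    have := sum_filter_add_sum_filter_not univ good X
    rw [hXtot] at this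
    linarith
  set β := (1 - ε₂) * N / (c * (L + 2)) with hβ
  have hβ0 : 0 ≤ β := div_nonneg (mul_nonneg (by linarith) hN.le) (by positivity)
  set num : (Fin k → ι) → ℕ := fun a => ⌊β * X a⌋₊ with hnum
  have hnum1 : ∀ a, (num a : ℝ) ≤ β * X a := fun a => Nat.floor_le (mul_nonneg hβ0 (hX0 a))
  have hnum2 : ∀ a, β * X a - 1 ≤ num a := fun a => (Nat.sub_one_lt_floor _).le
  set S : Finset (Fin k → ι) := {a | good a} with hS
  set as := S.toList.flatMap fun a => List.replicate (num a) a with has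
  have hload : ∀ j, ∑ a, X a * ∑ i, (if a i = j then posWt k l i else 0) ≤
      #(colClass χ j) * (c / N) := by
    intro j
    have e1 := sum_mul_vertexLoad (posWt k l) x (fun v => if χ v = j then 1 else 0)
    simp only [ite_mul, one_mul, zero_mul, mul_ite, mul_one, mul_zero] at e1
    have e2 : ∑ a, X a * ∑ i, (if a i = j then posWt k l i else 0) =
        ∑ z, x z * ∑ i, if χ (z i) = j then posWt k l i else 0 := by
      rw [← sum_fiberwise univ (fun (z : Fin k → V) i => χ (z i))]
      refine sum_congr rfl fun a _ => ?_
      rw [hX]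
      dsimp only
      rw [sum_mul]
      refine sum_congr rfl fun z hz => ?_
      have := (mem_filter.1 hz).2
      subst this
      rfl
    rw [e2, ← e1, ← sum_filter]
    refine (sum_le_card_nsmul _ _ _ fun v _ => hxl v).trans (le_of_eq ?_)
    rw [nsmul_eq_mul]
    rfl
  obtain ⟨Ps, hlen, hPs, hnd, -⟩ := hn₂ V Ω hn2 ι χ as (by
      intro a ha
      rw [has, List.mem_flatMap] at ha
      obtain ⟨b, hb, hab⟩ := ha
      rw [List.eq_of_mem_replicate hab]
      exact (mem_filter.1 (mem_toList.1 hb)).2) (by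
      intro j
      rw [has, sum_map_flatMap_replicate]
      calc ∑ a ∈ S, (num a : ℝ) * colourUse k l L a j
          ≤ ∑ a ∈ S, β * X a * colourUse k l L a j := by
            refine sum_le_sum fun a _ => ?_
            exact mul_le_mul_of_nonneg_right (hnum1 a) (colourUse_nonneg L a j)
        _ ≤ ∑ a, β * X a * colourUse k l L a j := by
            refine sum_le_sum_of_subset_of_nonneg (subset_univ _) fun a _ _ => ?_
            exact mul_nonneg (mul_nonneg hβ0 (hX0 a)) (colourUse_nonneg L a j)
        _ = β * (L + 2) * ∑ a, X a * ∑ i, (if a i = j then posWt k l i else 0) := by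
            rw [mul_sum]
            refine sum_congr rfl fun a _ => ?_
            have : colourUse k l L a j =
                (L + 2) * ∑ i, (if a i = j then posWt k l i else 0) := by
              unfold colourUse
              rw [mul_sum]
              refine sum_congr rfl fun i _ => ?_
              rw [mul_ite, mul_zero]
            rw [this]
            ring
        _ ≤ β * (L + 2) * (#(colClass χ j) * (c / N)) :=
            mul_le_mul_of_nonneg_left (hload j) (mul_nonneg hβ0 (by positivity))
        _ = _ := by
            rw [hβ]
            field_simp)
  refine ⟨Ps, hPs, hnd, ?_⟩
  have hflat : Ps.flatten.length = as.length * (l + L * (k - l)) := by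
    rw [List.length_flatten, ← hlen]
    have : ∀ t : List (List V), (∀ P ∈ t, P.length = l + L * (k - l)) →
        (t.map List.length).sum = t.length * (l + L * (k - l)) := by
      intro t
      induction t with
      | nil => simp
      | cons P t ih =>
        intro h
        rw [List.map_cons, List.sum_cons, ih fun Q hQ => h Q (List.mem_cons_of_mem _ hQ),
          h P List.mem_cons_self, List.length_cons]
        ring
    exact this Ps fun P hP => (hPs P hP).1
  have hasl : (as.length : ℝ) = ∑ a ∈ S, (num a : ℝ) := by
    have := sum_map_flatMap_replicate S num (fun _ => 1)
    simp only [mul_one] at this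
    rw [← this, ← has]
    simp
  have hScard : (#S : ℝ) ≤ (R : ℝ) ^ k := by
    have h1 := card_le_univ S
    rw [Fintype.card_fun, Fintype.card_fin] at h1
    have h2 : #S ≤ R ^ k := h1.trans (Nat.pow_le_pow_left hι k)
    exact_mod_cast h2
  have hasge : β * (1 - 3 * ε₁) - (R : ℝ) ^ k ≤ as.length := by
    rw [hasl]
    calc _ ≤ β * ∑ a ∈ S, X a - #S := by gcongr
      _ = ∑ a ∈ S, (β * X a - 1) := by rw [sum_sub_distrib, ← mul_sum]; simp
      _ ≤ _ := sum_le_sum fun a _ => hnum2 a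
  have hLm : (as.length : ℝ) * (L * m) ≤ Ps.flatten.length := by
    rw [hflat]
    have e1 : ((k - l : ℕ) : ℝ) = m := by rw [Nat.cast_sub (by omega)]
    push_cast
    rw [e1]
    gcongr
    linarith [(Nat.cast_nonneg l : (0 : ℝ) ≤ l)]
  refine le_trans ?_ hLm
  have hm0 : 0 < m := by linarith
  have hL0 : (0 : ℝ) ≤ L := Nat.cast_nonneg L
  have hβL : (1 - ε₁) ^ 3 * N ≤ β * (L * m) := by
    have e1 : β * (L * m) = (1 - ε₂) * N * L / ((1 + ε₁) * (L + 2)) := by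
      rw [hβ, hc]; field_simp
    rw [e1, le_div_iff₀ (by positivity)]
    have e2 : (1 - ε₁) * (L + 2) ≤ L := by linarith
    have e3 : (1 - ε₁) * (1 + ε₁) ≤ 1 := by nlinarith
    have e4 : 0 ≤ 1 - ε₁ := by linarith
    calc (1 - ε₁) ^ 3 * N * ((1 + ε₁) * (L + 2)) =
          (1 - ε₁) * N * (((1 - ε₁) * (1 + ε₁)) * ((1 - ε₁) * (L + 2))) := by ring
      _ ≤ (1 - ε₁) * N * (1 * L) := by
          refine mul_le_mul_of_nonneg_left ?_ (mul_nonneg e4 hN.le)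
          exact mul_le_mul e3 e2 (mul_nonneg e4 (by positivity)) (by norm_num)
      _ ≤ (1 - ε₂) * N * (1 * L) := by gcongr
      _ = _ := by ring
  have hRL : (R : ℝ) ^ k * (L * m) ≤ ε₁ * N := by
    refine hn₃.le.trans ?_
    rw [mul_comm]
    gcongr
  have hpoly := one_sub_six_mul_le hε₁1
  calc (1 - ε) * N ≤ (1 - 6 * ε₁) * N - ε₁ * N := by
        linarith [mul_le_mul_of_nonneg_right hε₁ε hN.le, mul_nonneg hε₁0.le hN.le]
    _ ≤ (1 - ε₁) ^ 3 * (1 - 3 * ε₁) * N - ε₁ * N := by gcongr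
    _ = (1 - ε₁) ^ 3 * N * (1 - 3 * ε₁) - ε₁ * N := by ring
    _ ≤ β * (L * m) * (1 - 3 * ε₁) - (R : ℝ) ^ k * (L * m) := by
        refine sub_le_sub ?_ hRL
        exact mul_le_mul_of_nonneg_right hβL (by linarith)
    _ = (β * (1 - 3 * ε₁) - (R : ℝ) ^ k) * (L * m) := by ring
    _ ≤ _ := by gcongr

end PathTiling

section LinkSpec

variable {α : Type*} {l : ℕ}

theorem nextHead_spec {z : List α} {ss : List (List α)} (hz : z.length = l)
    (hs : ∀ s ∈ ss, l ≤ s.length) :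
    (nextHead l z ss).length = l ∧ (nextHead l z ss).Subset (z ++ ss.flatten) := by
  cases ss with
  | nil => exact ⟨hz, by intro v hv; simpa [nextHead] using hv⟩
  | cons s ss =>
    refine ⟨by simpa [nextHead] using hs s (by simp), fun v hv => ?_⟩
    have : v ∈ s := List.mem_of_mem_take hv
    simp [this]

theorem nextHead_nodup {z : List α} {ss : List (List α)} (h : (z ++ ss.flatten).Nodup) :
    (nextHead l z ss).Nodup := by
  cases ss with
  | nil => simpa [nextHead] using h
  | cons s ss =>
    have h1 : s.Nodup := by
      rw [List.flatten_cons] at h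
      exact (h.of_append_right).of_append_left
    exact h1.sublist (List.take_sublist _ _)

/-- The overlaps to be connected are disjoint. -/
theorem linkReqs_spec {z : List α} (ss : List (List α)) (hz : z.length = l)
    (hs : ∀ s ∈ ss, l ≤ s.length) (hnd : (z ++ ss.flatten).Nodup) :
    ∀ r ∈ linkReqs l z ss, r.1.length = l ∧ r.2.length = l ∧ r.1.Nodup ∧ r.2.Nodup ∧
      r.1.Disjoint r.2 := by
  induction ss with
  | nil => simp [linkReqs]
  | cons s ss ih =>
    have hs' : ∀ t ∈ ss, l ≤ t.length := fun t ht => hs t (by simp [ht])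
    have hp : (s ++ (z ++ ss.flatten)).Nodup := by
      refine (List.Perm.nodup_iff ?_).1 hnd
      rw [List.flatten_cons, ← List.append_assoc, ← List.append_assoc]
      exact List.perm_append_comm.append_right _
    have hnd' := hp.of_append_right
    intro r hr
    rw [linkReqs, List.mem_cons] at hr
    rcases hr with rfl | hr
    · obtain ⟨h1, h2⟩ := nextHead_spec hz hs'
      refine ⟨length_lastPart (hs s (by simp)), h1,
        (hp.of_append_left).sublist (List.drop_sublist _ _), nextHead_nodup hnd', ?_⟩
      intro v hv1 hv2
      exact List.disjoint_of_nodup_append hp (List.mem_of_mem_drop hv1) (h2 hv2)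
    · exact ih hs' hnd' r hr

theorem exists_chunks (M t : ℕ) (L : List α) (h : L.length = M * t) :
    ∃ Ts : List (Fin M → α), Ts.length = t ∧ Ts.flatMap List.ofFn = L := by
  induction t generalizing L with
  | zero => exact ⟨[], rfl, by simpa using (List.length_eq_zero_iff.1 (by simpa using h)).symm⟩
  | succ t ih =>
    rw [Nat.mul_succ] at h
    obtain ⟨Ts, hT1, hT2⟩ := ih (L.drop M) (by simp [h])
    have hM : (L.take M).length = M := by simp [h]
    refine ⟨(fun i => (L.take M).get (i.cast hM.symm)) :: Ts, by simp [hT1], ?_⟩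
    rw [List.flatMap_cons, hT2]
    conv_rhs => rw [← List.take_append_drop M L]
    congr 1
    refine List.ext_get (by simp [h]) fun i h1 h2 => by simp

end LinkSpec

section Swap

variable {V κ : Type*} [Fintype κ] [DecidableEq κ] [Fintype V] [DecidableEq V] {k l : ℕ}

theorem flatten_map_map_perm {P : List (List κ)} (hP : P.flatten.Perm univ.toList) (X : κ → V) :
    (P.map (List.map X)).flatten.Perm (tupList X) := by
  rw [← List.map_flatten]
  exact hP.map X

theorem exists_absorbing_segments {E : Finset (Finset V)} {P : List (List κ)} {M : ℕ}
    (hP : P.flatten.Perm univ.toList) (Xs : List (κ → V)) (os : List (Option (Fin M → V)))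
    (hX : ∀ X ∈ Xs, ∀ s ∈ P, IsSeg k l (EdgeList E) (s.map X))
    (h : List.Forall₂ (fun X o => ∀ T ∈ o, IsAbsorber k l E P T X) Xs os) :
    ∃ ss, List.Forall₂ (SameEnds l) (Xs.flatMap fun X => P.map (List.map X)) ss ∧
      (∀ s ∈ ss, IsSeg k l (EdgeList E) s) ∧
      ss.flatten.Perm (Xs.flatMap tupList ++ os.reduceOption.flatMap List.ofFn) := by
  induction h with
  | nil => exact ⟨[], by simp, by simp, by simp⟩
  | @cons X o Xs os ho _ ih =>
    obtain ⟨ss, h1, h2, h3⟩ := ih fun Y hY => hX Y (by simp [hY])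
    cases o with
    | none =>
      refine ⟨P.map (List.map X) ++ ss, ?_, ?_, ?_⟩
      · rw [List.flatMap_cons]
        exact List.rel_append (List.forall₂_same.2 fun s _ => ⟨rfl, rfl⟩) h1
      · intro s hs
        rcases List.mem_append.1 hs with hs | hs
        · obtain ⟨t, ht, rfl⟩ := List.mem_map.1 hs
          exact hX X (by simp) t ht
        · exact h2 s hs
      · rw [List.flatten_append, List.flatMap_cons, List.reduceOption_cons_of_none,
          List.append_assoc]
        exact (flatten_map_map_perm hP X).append h3
    | some T =>
      obtain ⟨-, tt, t1, t2, t3⟩ := ho T rfl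
      refine ⟨tt ++ ss, ?_, ?_, ?_⟩
      · rw [List.flatMap_cons]
        exact List.rel_append t1 h1
      · intro s hs
        rcases List.mem_append.1 hs with hs | hs
        · exact t2 s hs
        · exact h2 s hs
      · rw [List.flatten_append, List.flatMap_cons, List.reduceOption_cons_of_some,
          List.flatMap_cons]
        refine (t3.append h3).trans ?_
        rw [List.append_assoc, List.append_assoc]
        refine List.Perm.append_left _ ?_
        rw [← List.append_assoc, ← List.append_assoc]
        exact List.perm_append_comm.append_right _

end Swap

section Assemble

variable {κ : Type*} [Fintype κ] [DecidableEq κ] {k l n : ℕ}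

/-- Segments, an absorbing family and connectors yield a Hamiltonian cycle. -/
theorem hasHamCycle_of_absorbing {E : Finset (Finset (Fin n))} (hlk : l < k)
    {P : List (List κ)} {M t : ℕ} (hP : P.flatten.Perm univ.toList)
    (s : List (Fin n)) (ss cs₁ cs₂ : List (List (Fin n))) (Xs : List (κ → Fin n))
    (hsk : k ≤ s.length) (hs : ∀ w ∈ s :: ss, IsSeg k l (EdgeList E) w)
    (hX : ∀ X ∈ Xs, ∀ w ∈ P, IsSeg k l (EdgeList E) (w.map X))
    (hc₁ : List.Forall₂ (fun r c => IsSeg k l (EdgeList E) (r.1 ++ c ++ r.2))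
      (linkReqs l (nextHead l (s.take l) (Xs.flatMap fun X => P.map (List.map X))) (s :: ss)) cs₁)
    (hc₂ : List.Forall₂ (fun r c => IsSeg k l (EdgeList E) (r.1 ++ c ++ r.2))
      (linkReqs l (s.take l) (Xs.flatMap fun X => P.map (List.map X))) cs₂)
    {L : List (Fin n)}
    (hL : L.Perm ((s :: ss).flatten ++ Xs.flatMap tupList ++ (cs₁.flatten ++ cs₂.flatten)))
    (hnd : L.Nodup) (hlen : L.length + M * t = n)
    (habs : ∀ T : Fin M → Fin n, (∀ i, T i ∉ L) →
      t ≤ Xs.countP fun X => @decide (IsAbsorber k l E P T X) (Classical.dec _)) :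
    HasHamCycle k l E := by
  classical
  set W := (univ \ L.toFinset).toList with hW
  have hWlen : W.length = M * t := by
    rw [hW, length_toList, card_sdiff_of_subset (subset_univ _), List.toFinset_card_of_nodup hnd,
      card_univ, Fintype.card_fin]
    omega
  obtain ⟨Ts, hTs, hTW⟩ := exists_chunks M t W hWlen
  obtain ⟨os, ho, hop⟩ := exists_assignment (fun T X => IsAbsorber k l E P T X) Ts Xs (by
    intro T hT
    rw [hTs]
    convert habs T fun i hi => ?_
    have : T i ∈ W := by
      rw [← hTW, List.mem_flatMap]
      exact ⟨T, hT, by simp⟩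
    rw [hW, mem_toList, mem_sdiff, List.mem_toFinset] at this
    exact this.2 hi)
  obtain ⟨tt, h1, h2, h3⟩ := exists_absorbing_segments hP Xs os hX ho
  have h4 : tt.flatten.Perm (Xs.flatMap tupList ++ W) := by
    refine h3.trans (List.Perm.append_left _ ?_)
    rw [← hTW]
    exact hop.flatMap_right _
  have hperm : ((s :: (ss ++ tt)).flatten ++ (cs₁ ++ cs₂).flatten).Perm (L ++ W) := by
    rw [← List.cons_append, List.flatten_append, List.flatten_append]
    have e1 := ((h4.append_left (s :: ss).flatten).append_right (cs₁.flatten ++ cs₂.flatten))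
    refine e1.trans ?_
    have e2 := hL.symm.append_right W
    refine List.Perm.trans ?_ e2
    simp only [List.append_assoc]
    refine List.Perm.append_left _ (List.Perm.append_left _ ?_)
    rw [← List.append_assoc cs₁.flatten]
    exact List.perm_append_comm
  refine hasHamCycle_of_links hlk s (ss ++ tt) (cs₁ ++ cs₂) hsk ?_ ?_ ?_ ?_
  · intro w hw
    rw [← List.cons_append, List.mem_append] at hw
    rcases hw with hw | hw
    · exact hs w hw
    · exact h2 w hw
  · rw [← List.cons_append, linkReqs_append, ← linkReqs_congr h1, ← nextHead_congr h1]
    exact List.rel_append hc₁ hc₂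
  · rw [hperm.nodup_iff, List.nodup_append']
    refine ⟨hnd, nodup_toList _, fun v hv hw => ?_⟩
    rw [hW, mem_toList, mem_sdiff, List.mem_toFinset] at hw
    exact hw.2 hv
  · intro v
    rw [hperm.mem_iff, List.mem_append]
    by_cases hv : v ∈ L
    · exact Or.inl hv
    · exact Or.inr (by rw [hW, mem_toList, mem_sdiff, List.mem_toFinset]; exact ⟨mem_univ _, hv⟩)

end Assemble

section Avoid

variable {V : Type*} [Fintype V] [DecidableEq V]

theorem two_mul_card_le_card_pairs {E : Finset (Finset V)} {k : ℕ} (hk : 2 ≤ k)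
    (hE : ∀ e ∈ E, #e = k) {S : Finset V} (hS : #S = k - 2) :
    2 * #{e ∈ E | S ⊆ e} ≤ #{p : V × V | insert p.1 (insert p.2 S) ∈ E} := by
  rw [card_eq_sum_card_fiberwise (s := {p : V × V | insert p.1 (insert p.2 S) ∈ E})
    (t := {e ∈ E | S ⊆ e}) (f := fun p => insert p.1 (insert p.2 S)) (by
      intro p hp
      have := (mem_filter.1 hp).2
      exact mem_filter.2 ⟨this, (subset_insert _ _).trans (subset_insert _ _)⟩)]
  rw [mul_comm, ← smul_eq_mul]
  refine card_nsmul_le_sum _ _ _ fun e he => ?_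
  obtain ⟨he, hSe⟩ := mem_filter.1 he
  have h2 : #(e \ S) = 2 := by
    rw [card_sdiff_of_subset hSe, hE e he]; omega
  obtain ⟨a, b, hab, habS⟩ := card_eq_two.1 h2
  have hins : insert a (insert b S) = e := by
    rw [← sdiff_union_of_subset hSe, habS]
    ext x; simp
  have hins' : insert b (insert a S) = e := by rw [insert_comm, hins]
  have hsub : {(a, b), (b, a)} ⊆ ({p ∈ ({p : V × V | insert p.1 (insert p.2 S) ∈ E} :
      Finset (V × V)) | insert p.1 (insert p.2 S) = e}) := by
    intro p hp
    rw [mem_insert, mem_singleton] at hp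
    rcases hp with rfl | rfl
    · simp [hins, he]
    · simp [hins', he]
  refine le_trans ?_ (card_le_card hsub)
  rw [card_pair]
  intro h
  exact hab (Prod.mk.inj h).1

theorem card_pairs_meeting_le (F : Finset V) :
    #{p : V × V | p.1 ∈ F ∨ p.2 ∈ F} ≤ 2 * #F * Fintype.card V := by
  have : ({p : V × V | p.1 ∈ F ∨ p.2 ∈ F} : Finset (V × V)) ⊆ F ×ˢ univ ∪ univ ×ˢ F := by
    intro p hp
    simpa using hp
  refine (card_le_card this).trans ((card_union_le _ _).trans ?_)
  rw [card_product, card_product, card_univ]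
  exact le_of_eq (by ring)

/-- Pairs outside a small set completing `k - 2` vertices to an edge. -/
theorem card_pairs_avoiding_ge {k : ℕ} (hk : 2 ≤ k) {E : Finset (Finset V)}
    (hE : ∀ e ∈ E, #e = k) (F : Finset V) {i₀ i₁ : Fin k} (hi : i₀ ≠ i₁)
    (z : Fin k → {v // v ∉ F}) (hz : Function.Injective z) {a : ℝ}
    (hdeg : ∀ S : Finset V, #S = k - 2 → a ≤ 2 * #{e ∈ E | S ⊆ e}) :
    a - 2 * #F * Fintype.card V ≤
      #{p : {v // v ∉ F} × {v // v ∉ F} |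
        (univ.image fun i => (setTwo i₀ i₁ z p i).1) ∈ E} := by
  set S : Finset V := (univ \ {i₀, i₁} : Finset (Fin k)).image fun i => (z i).1 with hS
  have hScard : #S = k - 2 := by
    rw [hS, card_image_of_injective _
      (show Function.Injective fun i => (z i).1 from Subtype.val_injective.comp hz),
      card_sdiff_of_subset (subset_univ _), card_pair hi, card_univ, Fintype.card_fin]
  have himg : ∀ p : {v // v ∉ F} × {v // v ∉ F},
      (univ.image fun i => (setTwo i₀ i₁ z p i).1) = insert p.1.1 (insert p.2.1 S) := by
    intro p
    ext x
    simp only [mem_image, mem_univ, true_and, mem_insert, hS, mem_sdiff, mem_singleton, not_or]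
    constructor
    · rintro ⟨i, rfl⟩
      by_cases h1 : i = i₁
      · subst h1; right; left; simp [setTwo]
      by_cases h0 : i = i₀
      · subst h0; left; simp [setTwo, Function.update_of_ne hi]
      · right; right
        exact ⟨i, ⟨h0, h1⟩, by simp [setTwo, Function.update_of_ne h1, Function.update_of_ne h0]⟩
    · rintro (rfl | rfl | ⟨i, ⟨h0, h1⟩, rfl⟩)
      · exact ⟨i₀, by simp [setTwo, Function.update_of_ne hi]⟩
      · exact ⟨i₁, by simp [setTwo]⟩
      · exact ⟨i, by simp [setTwo, Function.update_of_ne h1, Function.update_of_ne h0]⟩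
  simp only [himg]
  have h1 := two_mul_card_le_card_pairs hk hE hScard
  have h2 := card_pairs_meeting_le F
  have h3 : ({p : V × V | insert p.1 (insert p.2 S) ∈ E} : Finset (V × V)) ⊆
      ({p : V × V | p.1 ∈ F ∨ p.2 ∈ F} : Finset (V × V)) ∪
        ({p : {v // v ∉ F} × {v // v ∉ F} | insert p.1.1 (insert p.2.1 S) ∈ E} :
          Finset ({v // v ∉ F} × {v // v ∉ F})).image fun p => (p.1.1, p.2.1) := by
    intro p hp
    have hp := (mem_filter.1 hp).2
    rw [mem_union, mem_filter, mem_image]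
    by_cases hF : p.1 ∈ F ∨ p.2 ∈ F
    · exact Or.inl ⟨mem_univ _, hF⟩
    · rw [not_or] at hF
      exact Or.inr ⟨(⟨p.1, hF.1⟩, ⟨p.2, hF.2⟩), by simpa using hp, rfl⟩
  have h4 := (card_le_card h3).trans ((card_union_le _ _).trans
    (Nat.add_le_add_left card_image_le _))
  have h5 := h1.trans (h4.trans (Nat.add_le_add_right h2 _))
  have h6 : (2 * #{e ∈ E | S ⊆ e} : ℝ) ≤ 2 * #F * Fintype.card V +
      #{p : {v // v ∉ F} × {v // v ∉ F} | insert p.1.1 (insert p.2.1 S) ∈ E} := by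
    exact_mod_cast h5
  linarith [hdeg S hScard]

theorem card_edges_inside_le {k : ℕ} {E : Finset (Finset V)} (hE : ∀ e ∈ E, #e = k)
    (F : Finset V) (B : Finset {v // v ∉ F}) :
    #{e ∈ E | e ⊆ B.map (Function.Embedding.subtype _)} ≤
      #{z : Fin k → {v // v ∉ F} | (univ.image fun i => (z i).1) ∈ E ∧ ∀ i, z i ∈ B} := by
  refine (card_le_card ?_).trans (card_image_le (f := fun z => univ.image fun i => (z i).1))
  intro e he
  obtain ⟨he, hB⟩ := mem_filter.1 he
  obtain ⟨f⟩ : Nonempty (Fin k ≃ e) := by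
    refine Fintype.card_eq.1 ?_
    rw [Fintype.card_fin, Fintype.card_coe, hE e he]
  have hmem : ∀ i, ∃ h : (f i).1 ∉ F, (⟨(f i).1, h⟩ : {v // v ∉ F}) ∈ B := by
    intro i
    obtain ⟨b, hb, hbe⟩ := mem_map.1 (hB (f i).2)
    simp only [Function.Embedding.subtype_apply] at hbe
    refine ⟨by rw [← hbe]; exact b.2, ?_⟩
    have : (⟨(f i).1, by rw [← hbe]; exact b.2⟩ : {v // v ∉ F}) = b := Subtype.ext hbe.symm
    rw [this]
    exact hb
  have himg : (univ.image fun i => (f i).1) = e := by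
    ext x
    simp only [mem_image, mem_univ, true_and]
    constructor
    · rintro ⟨i, rfl⟩; exact (f i).2
    · intro hx; exact ⟨f.symm ⟨x, hx⟩, by simp⟩
  refine mem_image.2 ⟨fun i => ⟨(f i).1, (hmem i).1⟩, mem_filter.2 ⟨mem_univ _, ?_, ?_⟩, ?_⟩
  · rw [himg]; exact he
  · intro i; exact (hmem i).2
  · exact himg

end Avoid

section TilingAvoiding

/-- A hypergraph with large pair degrees which is not extremal has, outside any small set, an
almost perfect tiling by long paths. -/
theorem exists_path_tiling_avoiding {k l : ℕ} (hk : 4 ≤ k) (hl1 : 1 ≤ l) (hl2 : 2 * l < k)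
    {δ ρ' : ℝ} (hδ : 0 < δ) (hρ' : 0 < ρ') :
    ∃ γ : ℝ, 0 < γ ∧ ∀ ε : ℝ, 0 < ε → ∃ L₀ : ℕ, ∀ L : ℕ, L₀ ≤ L → ∃ n₀ : ℕ,
      ∀ (V : Type) [Fintype V] [DecidableEq V] (E : Finset (Finset V)),
      n₀ ≤ Fintype.card V → (∀ e ∈ E, #e = k) →
      (∀ S : Finset V, #S = k - 2 →
        (1 - (1 - 1 / (2 * ((k : ℝ) - l))) ^ 2 - γ) * (Fintype.card V : ℝ) ^ 2 ≤
          2 * #{e ∈ E | S ⊆ e}) →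
      (∀ B : Finset V, (1 - 1 / (2 * ((k : ℝ) - l)) - δ) * Fintype.card V ≤ #B →
        ρ' * (Fintype.card V : ℝ) ^ k ≤ #{e ∈ E | e ⊆ B}) →
      ∀ F : Finset V, (#F : ℝ) ≤ γ * Fintype.card V →
      ∃ Ps : List (List V),
        (∀ P ∈ Ps, P.length = l + L * (k - l) ∧ IsPath k l (EdgeList E) P) ∧
        Ps.flatten.Nodup ∧ (∀ v ∈ Ps.flatten, v ∉ F) ∧
        (1 - ε) * Fintype.card V - #F ≤ (Ps.flatten.length : ℝ) := by
  obtain ⟨γ₀, hγ₀, H⟩ := exists_path_tiling hk hl1 hl2 (i₀ := ⟨0, by omega⟩)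
    (i₁ := ⟨k - 1, by omega⟩) rfl rfl (half_pos hδ) hρ'
  set m : ℝ := (k : ℝ) - l with hm
  have hm3 : 3 ≤ m := by
    have h1 : l + 3 ≤ k := by omega
    have h2 : (l : ℝ) + 3 ≤ k := by exact_mod_cast h1
    linarith
  set b : ℝ := 1 - 1 / (2 * m) with hb
  have hb1 : b < 1 := by rw [hb]; linarith [show 0 < 1 / (2 * m) by positivity]
  have hb0 : 0 < b := by
    rw [hb, sub_pos, div_lt_one (by positivity)]; linarith
  have hc : 0 < 1 - b ^ 2 := by nlinarith
  set γ := min (min (γ₀ / 3) ((1 - b ^ 2) / 3)) (min (δ / 2) (1 / 2)) with hγ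
  have hγ0 : 0 < γ := by positivity
  have g1 : γ ≤ γ₀ / 3 := (min_le_left _ _).trans (min_le_left _ _)
  have g2 : γ ≤ (1 - b ^ 2) / 3 := (min_le_left _ _).trans (min_le_right _ _)
  have g3 : γ ≤ δ / 2 := (min_le_right _ _).trans (min_le_left _ _)
  have g4 : γ ≤ 1 / 2 := (min_le_right _ _).trans (min_le_right _ _)
  refine ⟨γ, hγ0, fun ε hε => ?_⟩
  obtain ⟨L₀, H⟩ := H ε hε
  refine ⟨L₀, fun L hL => ?_⟩
  obtain ⟨n₀, H⟩ := H L hL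
  refine ⟨2 * n₀ + 1, fun V _ _ E hn hE hdeg hnon F hF => ?_⟩
  classical
  set N : ℝ := (Fintype.card V : ℝ) with hN
  have hN1 : 2 * (n₀ : ℝ) + 1 ≤ N := by rw [hN]; exact_mod_cast hn
  have hN0 : 0 < N := by linarith [(Nat.cast_nonneg n₀ : (0 : ℝ) ≤ n₀)]
  have hU : (Fintype.card {v // v ∉ F} : ℝ) = N - #F := by
    rw [Fintype.card_subtype_compl, Nat.cast_sub (Fintype.card_subtype_le _), Fintype.card_coe]
  have hUge : (1 - γ) * N ≤ Fintype.card {v // v ∉ F} := by rw [hU]; linarith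
  have hUle : (Fintype.card {v // v ∉ F} : ℝ) ≤ N := by
    rw [hU]; linarith [(Nat.cast_nonneg #F : (0 : ℝ) ≤ #F)]
  have hUhalf : N / 2 ≤ Fintype.card {v // v ∉ F} := by nlinarith
  set M : ℝ := (Fintype.card {v // v ∉ F} : ℝ) with hM
  have hM0 : 0 < M := by linarith
  have : Nonempty {v // v ∉ F} := by
    rw [← Fintype.card_pos_iff]
    rw [hM] at hM0
    exact_mod_cast hM0
  have hn₀ : n₀ ≤ Fintype.card {v // v ∉ F} := by
    have : (n₀ : ℝ) ≤ M := by linarith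
    rw [hM] at this
    exact_mod_cast this
  set Ω : Finset (Fin k → {v // v ∉ F}) := {z | (univ.image fun i => (z i).1) ∈ E} with hΩ
  obtain ⟨Ps, hPs, hnd, hcov⟩ := H {v // v ∉ F} Ω hn₀ (by
    intro z hz
    have h1 := card_pairs_avoiding_ge (by omega) hE F (i₀ := ⟨0, by omega⟩)
      (i₁ := ⟨k - 1, by omega⟩) (by intro h; have := congrArg Fin.val h; simp at this; omega)
      z hz hdeg
    have h2 : (1 - b ^ 2 - γ₀) * M ^ 2 ≤ (1 - b ^ 2 - γ) * N ^ 2 - 2 * #F * N := by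
      have e1 : 2 * #F * N ≤ 2 * (γ * N) * N := by gcongr
      have e2 : (1 - b ^ 2 - 3 * γ) * M ^ 2 ≤ (1 - b ^ 2 - 3 * γ) * N ^ 2 := by
        have : 0 ≤ 1 - b ^ 2 - 3 * γ := by linarith
        gcongr
      have e3 : (1 - b ^ 2 - γ₀) * M ^ 2 ≤ (1 - b ^ 2 - 3 * γ) * M ^ 2 := by
        gcongr; linarith
      linarith
    refine (h2.trans h1).trans (le_of_eq ?_)
    congr 2
    ext p
    simp [hΩ]) (by
    intro B hB
    have h1 := hnon (B.map (Function.Embedding.subtype _)) (by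
      rw [card_map]
      refine le_trans ?_ hB
      have e1 : (b - δ / 2) * ((1 - γ) * N) ≤ (b - δ / 2) * M ∨ b - δ / 2 < 0 := by
        rcases le_or_gt 0 (b - δ / 2) with h | h
        · exact Or.inl (mul_le_mul_of_nonneg_left hUge h)
        · exact Or.inr h
      rcases e1 with e1 | e1
      · nlinarith [mul_pos hγ0 hN0]
      · have e2 : (b - δ / 2) * N ≤ (b - δ / 2) * M := mul_le_mul_of_nonpos_left hUle e1.le
        nlinarith)
    have h2 : ρ' * M ^ k ≤ ρ' * N ^ k := by gcongr
    refine h2.trans (h1.trans ?_)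
    have h3 := card_edges_inside_le hE F B
    have h4 : ({z : Fin k → {v // v ∉ F} | (univ.image fun i => (z i).1) ∈ E ∧ ∀ i, z i ∈ B} :
        Finset _) ⊆ {z ∈ Ω | ∀ i, z i ∈ B} := by
      intro z hz
      simpa [hΩ] using hz
    exact_mod_cast h3.trans (card_le_card h4))
  refine ⟨Ps.map (List.map Subtype.val), ?_, ?_, ?_, ?_⟩
  · intro P hP
    obtain ⟨Q, hQ, rfl⟩ := List.mem_map.1 hP
    refine ⟨by rw [List.length_map]; exact (hPs Q hQ).1, ?_⟩
    rw [isPath_map]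
    refine (hPs Q hQ).2.mono fun w _ hw => ?_
    obtain ⟨z, hz, hzw⟩ := mem_image.1 hw
    have hz := (mem_filter.1 hz).2
    have : (w.map Subtype.val).toFinset = univ.image fun i => (z i).1 := by
      have e1 : (w.map Subtype.val).toFinset = w.toFinset.image Subtype.val := by
        ext x; simp
      rw [e1, ← hzw, image_image]
      rfl
    show (w.map Subtype.val).toFinset ∈ E
    rw [this]
    exact hz
  · rw [← List.map_flatten]
    exact hnd.map Subtype.val_injective
  · rw [← List.map_flatten]
    intro v hv
    obtain ⟨u, -, rfl⟩ := List.mem_map.1 hv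
    exact u.2
  · rw [← List.map_flatten, List.length_map]
    refine le_trans ?_ hcov
    rw [← hM, hU]
    nlinarith [mul_nonneg hε.le (Nat.cast_nonneg #F : (0 : ℝ) ≤ #F)]

end TilingAvoiding

section NonExtremal

theorem pow_le_mul_choose {n k : ℕ} (hn : 2 * k ≤ n) :
    (n : ℝ) ^ k ≤ 2 ^ k * k.factorial * n.choose k := by
  have h1 := Nat.pow_sub_le_descFactorial n k
  rw [Nat.descFactorial_eq_factorial_mul_choose] at h1
  have h2 : n ^ k ≤ 2 ^ k * (k.factorial * n.choose k) := by
    calc n ^ k ≤ (2 * (n + 1 - k)) ^ k := Nat.pow_le_pow_left (by omega) k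
      _ = 2 ^ k * (n + 1 - k) ^ k := mul_pow _ _ _
      _ ≤ _ := Nat.mul_le_mul_left _ h1
  rw [← mul_assoc] at h2
  exact_mod_cast h2

theorem mul_choose_pred_le {n k : ℕ} (hk : 1 ≤ k) (hn : 2 * k ≤ n) :
    n * n.choose (k - 1) ≤ 2 * k * n.choose k := by
  obtain ⟨j, rfl⟩ : ∃ j, k = j + 1 := ⟨k - 1, by omega⟩
  have h := Nat.choose_succ_right_eq n j
  simp only [Nat.add_sub_cancel]
  calc n * n.choose j ≤ 2 * (n - j) * n.choose j := Nat.mul_le_mul_right _ (by omega)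
    _ = 2 * (n.choose (j + 1) * (j + 1)) := by rw [h]; ring
    _ = _ := by ring

theorem card_edges_through_le {V : Type*} [Fintype V] [DecidableEq V] {E : Finset (Finset V)}
    {k : ℕ} (hE : ∀ e ∈ E, #e = k) (D : Finset V) :
    #{e ∈ E | ¬ Disjoint e D} ≤ #D * (Fintype.card V).choose (k - 1) := by
  have h1 : ({e ∈ E | ¬ Disjoint e D} : Finset (Finset V)) ⊆
      D.biUnion fun v => {e ∈ E | v ∈ e} := by
    intro e he
    obtain ⟨he, hd⟩ := mem_filter.1 he
    obtain ⟨v, hv, hvD⟩ := not_disjoint_iff.1 hd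
    exact mem_biUnion.2 ⟨v, hvD, mem_filter.2 ⟨he, hv⟩⟩
  refine (card_le_card h1).trans (card_biUnion_le_card_mul _ _ _ fun v _ => ?_)
  rw [← card_univ, ← card_powersetCard]
  refine card_le_card_of_injOn (fun e => e.erase v) ?_ ?_
  · intro e he
    obtain ⟨he, hv⟩ := mem_filter.1 he
    rw [mem_coe, mem_powersetCard, card_erase_of_mem hv, hE e he]
    exact ⟨subset_univ _, rfl⟩
  · intro e he f hf hef
    have := congrArg (insert v) hef
    simpa [insert_erase (mem_filter.1 he).2, insert_erase (mem_filter.1 hf).2] using this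

/-- In a hypergraph that is not extremal, every set of almost the extremal size spans many
edges. -/
theorem card_edges_inside_ge_of_not_isExtremal {k l n : ℕ} (hk : 1 ≤ k) (hlk : l < k) {ξ : ℝ}
    (hξ : 0 < ξ) (hn : 2 * k ≤ n) {E : Finset (Finset (Fin n))} (hE : ∀ e ∈ E, #e = k)
    (hext : ¬ IsExtremal k l ξ E) (B : Finset (Fin n))
    (hB : (1 - 1 / (2 * ((k : ℝ) - l)) - ξ / (4 * k)) * n ≤ #B) :
    ξ / (2 * (2 ^ k * k.factorial)) * (n : ℝ) ^ k ≤ #{e ∈ E | e ⊆ B} := by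
  have hk0 : (0 : ℝ) < k := by exact_mod_cast hk
  set b := (2 * (k - l) - 1) * n / (2 * (k - l)) with hb
  have hm : ((k - l : ℕ) : ℝ) = (k : ℝ) - l := Nat.cast_sub hlk.le
  have hm0 : (0 : ℝ) < (k : ℝ) - l := by
    rw [← hm]; exact_mod_cast Nat.sub_pos_of_lt hlk
  have hbr : (b : ℝ) ≤ (1 - 1 / (2 * ((k : ℝ) - l))) * n := by
    have h1 := Nat.div_mul_le_self ((2 * (k - l) - 1) * n) (2 * (k - l))
    rw [← hb] at h1
    have h2 : (b : ℝ) * (2 * ((k - l : ℕ) : ℝ)) ≤ (2 * ((k - l : ℕ) : ℝ) - 1) * n := by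
      have h3 : ((2 * (k - l) - 1 : ℕ) : ℝ) = 2 * ((k - l : ℕ) : ℝ) - 1 := by
        rw [Nat.cast_sub (by omega)]; push_cast; ring
      rw [← h3]
      exact_mod_cast h1
    rw [hm] at h2
    have h4 : (1 - 1 / (2 * ((k : ℝ) - l))) * n = (2 * ((k : ℝ) - l) - 1) * n / (2 * (k - l)) := by
      field_simp
    rw [h4, le_div_iff₀ (by positivity)]
    exact h2
  have hbn : b ≤ n := by
    have h1 : (2 * (k - l) - 1) * n ≤ n * (2 * (k - l)) := by
      rw [mul_comm]; exact Nat.mul_le_mul_left _ (by omega)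
    exact Nat.div_le_of_le_mul (by rw [mul_comm (2 * (k - l)) n]; exact h1)
  have hmany : ∀ B' : Finset (Fin n), #B' = b → ξ * n.choose k < #{e ∈ E | e ⊆ B'} := by
    intro B' hB'
    by_contra h
    exact hext ⟨B', hB', not_lt.1 h⟩
  have hpow : ξ / (2 * (2 ^ k * k.factorial)) * (n : ℝ) ^ k ≤ ξ / 2 * n.choose k := by
    have hf : (0 : ℝ) < 2 ^ k * k.factorial := by positivity
    calc ξ / (2 * (2 ^ k * k.factorial)) * (n : ℝ) ^ k
        ≤ ξ / (2 * (2 ^ k * k.factorial)) * (2 ^ k * k.factorial * n.choose k) := by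
          gcongr
          exact pow_le_mul_choose hn
      _ = _ := by field_simp
  refine hpow.trans ?_
  have hC : (0 : ℝ) ≤ n.choose k := by positivity
  rcases le_total b #B with h | h
  · obtain ⟨B', hB', hcard⟩ := exists_subset_card_eq h
    have h1 := hmany B' hcard
    have h2 : #{e ∈ E | e ⊆ B'} ≤ #{e ∈ E | e ⊆ B} := by
      refine card_le_card fun e he => ?_
      rw [mem_filter] at he ⊢
      exact ⟨he.1, he.2.trans hB'⟩
    have h3 : (#{e ∈ E | e ⊆ B'} : ℝ) ≤ #{e ∈ E | e ⊆ B} := by exact_mod_cast h2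
    nlinarith
  · obtain ⟨B', hB', hcard⟩ := exists_superset_card_eq (s := B) h (by simpa using hbn)
    have h1 := hmany B' hcard
    have h2 : #{e ∈ E | e ⊆ B'} ≤ #{e ∈ E | e ⊆ B} + #{e ∈ E | ¬ Disjoint e (B' \ B)} := by
      refine (card_le_card fun e he => ?_).trans (card_union_le _ _)
      rw [mem_filter] at he
      rw [mem_union, mem_filter, mem_filter]
      by_cases hd : Disjoint e (B' \ B)
      · refine Or.inl ⟨he.1, fun v hv => ?_⟩
        by_contra hvB
        exact (disjoint_left.1 hd hv) (mem_sdiff.2 ⟨he.2 hv, hvB⟩)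
      · exact Or.inr ⟨he.1, hd⟩
    have h3 := card_edges_through_le hE (B' \ B)
    rw [Fintype.card_fin] at h3
    have h4 : (#(B' \ B) : ℝ) ≤ ξ / (4 * k) * n := by
      rw [card_sdiff_of_subset hB', Nat.cast_sub (card_le_card hB'), hcard]
      linarith
    have h5 : ((n : ℝ) * n.choose (k - 1)) ≤ 2 * k * n.choose k := by
      exact_mod_cast mul_choose_pred_le hk hn
    have h6 : (#(B' \ B) : ℝ) * n.choose (k - 1) ≤ ξ / 2 * n.choose k := by
      calc (#(B' \ B) : ℝ) * n.choose (k - 1) ≤ ξ / (4 * k) * n * n.choose (k - 1) := by gcongr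
        _ = ξ / (4 * k) * (n * n.choose (k - 1)) := by ring
        _ ≤ ξ / (4 * k) * (2 * k * n.choose k) := by gcongr
        _ = _ := by field_simp; ring
    have h7 : (#{e ∈ E | e ⊆ B'} : ℝ) ≤ #{e ∈ E | e ⊆ B} + #(B' \ B) * n.choose (k - 1) := by
      exact_mod_cast h2.trans (Nat.add_le_add_left h3 _)
    linarith

end NonExtremal

section Components

variable {V : Type*} [Fintype V] [DecidableEq V] {k l s : ℕ}

theorem ofFn_perm_tupList (C : Fin s → V) : (List.ofFn C).Perm (tupList C) := by
  have h : (List.ofFn (id : Fin s → Fin s)).Perm univ.toList :=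
    perm_univ_of_length (by simp [List.mem_ofFn]) (by simp)
  have := h.map C
  rwa [List.map_ofFn] at this

theorem flatten_map_ofFn_perm (Cs : List (Fin s → V)) :
    (Cs.map List.ofFn).flatten.Perm (Cs.flatMap tupList) := by
  induction Cs with
  | nil => simp
  | cons C Cs ih =>
    rw [List.map_cons, List.flatten_cons, List.flatMap_cons]
    exact (ofFn_perm_tupList C).append ih

/-- Every pair of disjoint `l`-tuples is joined by many connecting `s`-tuples. -/
def HasConnectors (k l s : ℕ) (α : ℝ) (E : Finset (Finset V)) : Prop :=
  ∀ A B : List V, A.length = l → B.length = l → A.Nodup → B.Nodup → A.Disjoint B →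
    ∃ G : Finset (Fin s → V), α * (Fintype.card V : ℝ) ^ Fintype.card (Fin s) ≤ #G ∧
      ∀ C ∈ G, IsSeg k l (EdgeList E) (A ++ List.ofFn C ++ B)

/-- Prescribed vertices are covered by disjoint edges. -/
theorem exists_cover [Nonempty V] {E : Finset (Finset V)} (hk : 3 ≤ k) (hE : ∀ e ∈ E, #e = k)
    {c₀ : ℝ} (hc₀ : 0 ≤ c₀)
    (hdeg : ∀ S : Finset V, #S = k - 2 → c₀ * (Fintype.card V : ℝ) ^ 2 ≤ #{e ∈ E | S ⊆ e})
    (hn : 2 * k ≤ Fintype.card V) (D F : Finset V) (hDF : Disjoint D F)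
    (hnum : (k : ℝ) * (#F + #D + k * #D + k) < c₀ / 2 ^ k * Fintype.card V) :
    ∃ Bs : List (List V), Bs.length = #D ∧ (∀ w ∈ Bs, w.length = k ∧ w.toFinset ∈ E) ∧
      Bs.flatten.Nodup ∧ (∀ v ∈ Bs.flatten, v ∉ F) ∧ ∀ v ∈ D, v ∈ Bs.flatten := by
  set A : V → Finset (Fin (k - 1) → V) := fun v => {h | ([v] ++ List.ofFn h).toFinset ∈ E}
    with hA
  have hcast : ((k - 1 : ℕ) : ℝ) ≤ k := by exact_mod_cast Nat.sub_le k 1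
  obtain ⟨Cs, hCs, hnd, hF⟩ := exists_disjoint_tuples (D.toList.map A) (F ∪ D)
    (α := c₀ / 2 ^ k) (by
      intro X hX
      obtain ⟨v, -, rfl⟩ := List.mem_map.1 hX
      rw [Fintype.card_fin]
      exact card_extend_list_ge hE hc₀ hdeg hn (k - 1) (by omega) [v] (List.nodup_singleton v)
        (by simp; omega)) (by
      refine lt_of_le_of_lt ?_ hnum
      rw [Fintype.card_fin, List.length_map, length_toList]
      have h1 : (#(F ∪ D) : ℝ) ≤ #F + #D := by exact_mod_cast card_union_le _ _
      gcongr)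
  rw [List.forall₂_map_left_iff] at hCs
  have key : ∀ (Ds : List V) (Cs : List (Fin (k - 1) → V)),
      List.Forall₂ (fun v C => C ∈ A v) Ds Cs → ∃ Bs : List (List V), Bs.length = Ds.length ∧
        (∀ w ∈ Bs, w.length = k ∧ w.toFinset ∈ E) ∧ Bs.flatten.Perm (Ds ++ Cs.flatMap tupList) := by
    intro Ds Cs h
    induction h with
    | nil => exact ⟨[], by simp⟩
    | @cons v C Ds Cs hC _ ih =>
      obtain ⟨Bs, h1, h2, h3⟩ := ih
      refine ⟨(v :: List.ofFn C) :: Bs, by simp [h1], ?_, ?_⟩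
      · intro w hw
        rcases List.mem_cons.1 hw with rfl | hw
        · exact ⟨by simp; omega, by simpa [hA] using hC⟩
        · exact h2 w hw
      · rw [List.flatten_cons, List.flatMap_cons, List.cons_append, List.cons_append]
        refine List.Perm.cons v ?_
        refine ((ofFn_perm_tupList C).append h3).trans ?_
        rw [← List.append_assoc, ← List.append_assoc]
        exact List.perm_append_comm.append_right _
  obtain ⟨Bs, h1, h2, h3⟩ := key D.toList Cs hCs
  refine ⟨Bs, by rw [h1, length_toList], h2, ?_, ?_, ?_⟩
  · rw [h3.nodup_iff, List.nodup_append']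
    refine ⟨nodup_toList _, hnd, fun v hv hw => hF v hw ?_⟩
    exact mem_union_right _ (mem_toList.1 hv)
  · intro v hv
    rw [h3.mem_iff, List.mem_append, mem_toList] at hv
    rcases hv with hv | hv
    · exact disjoint_left.1 hDF hv
    · exact fun h => hF v hv (mem_union_left _ h)
  · intro v hv
    rw [h3.mem_iff, List.mem_append, mem_toList]
    exact Or.inl hv

/-- Disjoint connectors for a list of requests. -/
theorem exists_disjoint_connectors [Nonempty V] {E : Finset (Finset V)} {α : ℝ}
    (h : HasConnectors k l s α E) (reqs : List (List V × List V))
    (hreq : ∀ r ∈ reqs, r.1.length = l ∧ r.2.length = l ∧ r.1.Nodup ∧ r.2.Nodup ∧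
      r.1.Disjoint r.2) (F : Finset V)
    (hnum : (s : ℝ) * (#F + s * reqs.length + s) < α * Fintype.card V) :
    ∃ cs : List (List V),
      List.Forall₂ (fun r c => IsSeg k l (EdgeList E) (r.1 ++ c ++ r.2)) reqs cs ∧
      (∀ c ∈ cs, c.length = s) ∧ cs.flatten.Nodup ∧ ∀ v ∈ cs.flatten, v ∉ F := by
  classical
  have hG : ∀ r ∈ reqs, ∃ G : Finset (Fin s → V),
      α * (Fintype.card V : ℝ) ^ Fintype.card (Fin s) ≤ #G ∧
      ∀ C ∈ G, IsSeg k l (EdgeList E) (r.1 ++ List.ofFn C ++ r.2) := fun r hr =>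
    h r.1 r.2 (hreq r hr).1 (hreq r hr).2.1 (hreq r hr).2.2.1 (hreq r hr).2.2.2.1
      (hreq r hr).2.2.2.2
  have hG' : ∀ r : List V × List V, ∃ G : Finset (Fin s → V), r ∈ reqs →
      α * (Fintype.card V : ℝ) ^ Fintype.card (Fin s) ≤ #G ∧
      ∀ C ∈ G, IsSeg k l (EdgeList E) (r.1 ++ List.ofFn C ++ r.2) := by
    intro r
    by_cases hr : r ∈ reqs
    · obtain ⟨G, hG⟩ := hG r hr
      exact ⟨G, fun _ => hG⟩
    · exact ⟨∅, fun h => absurd h hr⟩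
  choose G hG using hG'
  obtain ⟨Cs, hCs, hnd, hF⟩ := exists_disjoint_tuples (reqs.map G) F (α := α) (by
    intro X hX
    obtain ⟨r, hr, rfl⟩ := List.mem_map.1 hX
    exact (hG r hr).1) (by
      rw [Fintype.card_fin, List.length_map]
      exact hnum)
  have hp := flatten_map_ofFn_perm Cs
  refine ⟨Cs.map List.ofFn, ?_, ?_, hp.nodup_iff.2 hnd, fun v hv => hF v (hp.mem_iff.1 hv)⟩
  · rw [List.forall₂_map_left_iff] at hCs
    rw [List.forall₂_map_right_iff]
    have : ∀ (rs : List (List V × List V)) (Cs : List (Fin s → V)), (∀ r ∈ rs, r ∈ reqs) →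
        List.Forall₂ (fun r C => C ∈ G r) rs Cs →
        List.Forall₂ (fun r C => IsSeg k l (EdgeList E) (r.1 ++ List.ofFn C ++ r.2)) rs Cs := by
      intro rs Cs hrs h
      induction h with
      | nil => exact List.Forall₂.nil
      | cons hC _ ih =>
        exact List.Forall₂.cons ((hG _ (hrs _ (by simp))).2 _ hC)
          (ih fun r hr => hrs r (by simp [hr]))
    exact this reqs Cs (fun _ h => h) hCs
  · intro c hc
    obtain ⟨C, -, rfl⟩ := List.mem_map.1 hc
    simp

open Classical in
/-- A reservoir of connectors. -/
theorem exists_reservoir [Nonempty V] {E : Finset (Finset V)} {α : ℝ} (hα : 0 < α)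
    (h : HasConnectors k l s α E) (F : Finset V) (N : ℕ)
    (hnum : (s : ℝ) * (#F + s * N + s) ≤ α / 2 * Fintype.card V)
    (hexp : (Fintype.card V : ℝ) ^ (2 * l) < Real.exp (α / 8 * N)) :
    ∃ Cs : List (Fin s → V), Cs.length ≤ N ∧ (Cs.flatMap tupList).Nodup ∧
      (∀ v ∈ Cs.flatMap tupList, v ∉ F) ∧
      ∀ A B : List V, A.length = l → B.length = l → A.Nodup → B.Nodup → A.Disjoint B →
        α / 8 * N ≤ Cs.countP fun C => IsSeg k l (EdgeList E) (A ++ List.ofFn C ++ B) := by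
  set T : Finset ((Fin l → V) × (Fin l → V)) :=
    {t | (List.ofFn t.1).Nodup ∧ (List.ofFn t.2).Nodup ∧
      (List.ofFn t.1).Disjoint (List.ofFn t.2)} with hT
  have hG : ∀ t : (Fin l → V) × (Fin l → V), ∃ G : Finset (Fin s → V), t ∈ T →
      α * (Fintype.card V : ℝ) ^ Fintype.card (Fin s) ≤ #G ∧
      ∀ C ∈ G, IsSeg k l (EdgeList E) (List.ofFn t.1 ++ List.ofFn C ++ List.ofFn t.2) := by
    intro t
    by_cases ht : t ∈ T
    · obtain ⟨-, h1, h2, h3⟩ := mem_filter.1 ht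
      obtain ⟨G, hG⟩ := h (List.ofFn t.1) (List.ofFn t.2) (by simp) (by simp) h1 h2 h3
      exact ⟨G, fun _ => hG⟩
    · exact ⟨∅, fun h => absurd h ht⟩
  choose G hG using hG
  obtain ⟨Cs, hlen, hnd, hF, -, hcnt⟩ := exists_family T G hα (fun t ht => (hG t ht).1) F N
    (by rw [Fintype.card_fin]; exact hnum) (by
      refine lt_of_le_of_lt ?_ hexp
      have h1 := card_le_univ T
      rw [Fintype.card_prod, Fintype.card_fun, Fintype.card_fin, ← pow_add, ← two_mul] at h1
      exact_mod_cast h1)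
  refine ⟨Cs, hlen, hnd, hF, fun A B hA hB hAn hBn hAB => ?_⟩
  have hAf : List.ofFn (fun i : Fin l => A.get (i.cast hA.symm)) = A := by
    refine List.ext_get (by simp [hA]) fun i h1 h2 => by simp
  have hBf : List.ofFn (fun i : Fin l => B.get (i.cast hB.symm)) = B := by
    refine List.ext_get (by simp [hB]) fun i h1 h2 => by simp
  have ht : ((fun i : Fin l => A.get (i.cast hA.symm)), fun i : Fin l => B.get (i.cast hB.symm)) ∈
      T := by
    rw [hT, mem_filter]
    refine ⟨mem_univ _, ?_⟩
    dsimp only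
    rw [hAf, hBf]
    exact ⟨hAn, hBn, hAB⟩
  refine (hcnt _ ht).trans ?_
  unfold cntIn
  norm_cast
  refine List.countP_mono_left fun C _ hC => ?_
  have := (hG _ ht).2 C (by simpa using hC)
  dsimp only at this
  rw [hAf, hBf] at this
  simpa using this

open Classical in
/-- A family of disjoint absorbers. -/
theorem exists_absorbing_family {κ : Type*} [Fintype κ] [DecidableEq κ] [Nonempty V]
    {E : Finset (Finset V)} {P : List (List κ)} {M : ℕ} {α : ℝ} (hα : 0 < α) (bad : Finset V)
    (h : ∀ T : Fin M → V, (∀ i, T i ∉ bad) → ∃ G : Finset (κ → V),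
      α * (Fintype.card V : ℝ) ^ Fintype.card κ ≤ #G ∧ ∀ X ∈ G, IsAbsorber k l E P T X) (N : ℕ)
    (hnum : (Fintype.card κ : ℝ) * (Fintype.card κ * N + Fintype.card κ) ≤ α / 2 * Fintype.card V)
    (hexp : (Fintype.card V : ℝ) ^ M < Real.exp (α / 8 * N)) :
    ∃ Xs : List (κ → V), Xs.length ≤ N ∧ (Xs.flatMap tupList).Nodup ∧
      (∀ X ∈ Xs, ∀ w ∈ P, IsSeg k l (EdgeList E) (w.map X)) ∧
      ∀ T : Fin M → V, (∀ i, T i ∉ bad) →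
        α / 8 * N ≤ Xs.countP fun X => IsAbsorber k l E P T X := by
  set 𝒯 : Finset (Fin M → V) := {T | ∀ i, T i ∉ bad} with h𝒯
  have hG : ∀ T : Fin M → V, ∃ G : Finset (κ → V), T ∈ 𝒯 →
      α * (Fintype.card V : ℝ) ^ Fintype.card κ ≤ #G ∧ ∀ X ∈ G, IsAbsorber k l E P T X := by
    intro T
    by_cases hT : T ∈ 𝒯
    · obtain ⟨G, hG⟩ := h T (mem_filter.1 hT).2
      exact ⟨G, fun _ => hG⟩
    · exact ⟨∅, fun h => absurd h hT⟩
  choose G hG using hG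
  obtain ⟨Xs, hlen, hnd, -, hmem, hcnt⟩ := exists_family 𝒯 G hα (fun T hT => (hG T hT).1) ∅ N
    (by simpa using hnum) (by
      refine lt_of_le_of_lt ?_ hexp
      have h1 := card_le_univ 𝒯
      rw [Fintype.card_fun, Fintype.card_fin] at h1
      exact_mod_cast h1)
  refine ⟨Xs, hlen, hnd, ?_, ?_⟩
  · intro X hX w hw
    obtain ⟨T, hT, hXT⟩ := hmem X hX
    exact ((hG T hT).2 X hXT).1 w hw
  · intro T hT
    have hT' : T ∈ 𝒯 := mem_filter.2 ⟨mem_univ _, hT⟩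
    refine (hcnt T hT').trans ?_
    unfold cntIn
    norm_cast
    refine List.countP_mono_left fun X _ hX => ?_
    have := (hG T hT').2 X (by simpa using hX)
    simpa using this

/-- The number of tiles can be adjusted modulo `k`. -/
theorem exists_residue (a : ℤ) {T k : ℕ} (j : ℕ) (hk : 0 < k) (hT : k ≤ T) :
    ∃ T' : ℕ, T' ≤ T ∧ T < T' + k ∧ (k : ℤ) ∣ a - T' * (k * j + 1) := by
  set r := ((T - a) % k).toNat with hr
  have hk' : (0 : ℤ) < k := by exact_mod_cast hk
  have h0 : 0 ≤ (T - a) % (k : ℤ) := Int.emod_nonneg _ hk'.ne'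
  have h1 : (T - a) % (k : ℤ) < k := Int.emod_lt_of_pos _ hk'
  have hr' : (r : ℤ) = (T - a) % (k : ℤ) := Int.toNat_of_nonneg h0
  have hrk : r < k := by omega
  refine ⟨T - r, Nat.sub_le _ _, by omega, ?_⟩
  rw [Nat.cast_sub (by omega), hr']
  have h2 := Int.mul_ediv_add_emod ((T : ℤ) - a) k
  refine ⟨-((T - a) / k) - (T - (T - a) % k) * j, ?_⟩
  have : a = T - (k * ((T - a) / k) + (T - a) % k) := by rw [h2]; ring
  linear_combination this

end Components

section Skeleton

variable {V κ : Type*} [Fintype V] [DecidableEq V] [Fintype κ] [DecidableEq κ] {k l s : ℕ}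

theorem length_flatten_of_forall {α : Type*} {Ls : List (List α)} {c : ℕ}
    (h : ∀ w ∈ Ls, w.length = c) : Ls.flatten.length = Ls.length * c := by
  induction Ls with
  | nil => simp
  | cons w Ls ih =>
    rw [List.flatten_cons, List.length_append, ih fun w hw => h w (by simp [hw]), h w (by simp),
      List.length_cons]
    ring

theorem dvd_length_flatten_add {α : Type*} {Ls : List (List α)} {m s : ℕ}
    (h : ∀ w ∈ Ls, m ∣ w.length + s) : m ∣ Ls.flatten.length + s * Ls.length := by
  induction Ls with
  | nil => simp
  | cons w Ls ih =>
    have : (w :: Ls).flatten.length + s * (w :: Ls).length =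
        w.length + s + (Ls.flatten.length + s * Ls.length) := by
      rw [List.flatten_cons, List.length_append, List.length_cons]
      ring
    rw [this]
    exact (h w (by simp)).add (ih fun w hw => h w (by simp [hw]))

theorem forall₂_append_left {α β : Type*} {R : α → β → Prop} {as bs : List α} {cs : List β}
    (h : List.Forall₂ R (as ++ bs) cs) :
    List.Forall₂ R as (cs.take as.length) ∧ List.Forall₂ R bs (cs.drop as.length) := by
  have h' : List.Forall₂ (flip R) cs (as ++ bs) := List.Forall₂.flip h
  exact ⟨(List.forall₂_take_append _ _ _ h').flip, (List.forall₂_drop_append _ _ _ h').flip⟩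

theorem flatten_segments_perm {P : List (List κ)} (hP : P.flatten.Perm univ.toList)
    (Xs : List (κ → V)) :
    (Xs.flatMap fun X => P.map (List.map X)).flatten.Perm (Xs.flatMap tupList) := by
  induction Xs with
  | nil => simp
  | cons X Xs ih =>
    rw [List.flatMap_cons, List.flatten_append, List.flatMap_cons]
    exact (flatten_map_map_perm hP X).append ih

open Classical in
/-- A covering of the bad vertices, an absorbing family, and connectors between them. -/
theorem exists_skeleton [Nonempty V] {E : Finset (Finset V)} (hk : 3 ≤ k) (hlk : l < k)
    (hE : ∀ e ∈ E, #e = k) {c₀ : ℝ} (hc₀ : 0 ≤ c₀)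
    (hdeg : ∀ S : Finset V, #S = k - 2 → c₀ * (Fintype.card V : ℝ) ^ 2 ≤ #{e ∈ E | S ⊆ e})
    (hn : 2 * k ≤ Fintype.card V) (hsl : (k - l) ∣ s + l)
    {αc : ℝ} (hcon : HasConnectors k l s αc E)
    {P : List (List κ)} {M : ℕ} (hP : P.flatten.Perm univ.toList) (hP0 : P ≠ [])
    {αa : ℝ} (hαa : 0 < αa) (bad : Finset V)
    (habs : ∀ T : Fin M → V, (∀ i, T i ∉ bad) → ∃ G : Finset (κ → V),
      αa * (Fintype.card V : ℝ) ^ Fintype.card κ ≤ #G ∧ ∀ X ∈ G, IsAbsorber k l E P T X)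
    {N : ℕ} (hN : 0 < N)
    (hnum : (Fintype.card κ : ℝ) * (Fintype.card κ * N + Fintype.card κ) ≤
      αa / 2 * Fintype.card V)
    (hexp : (Fintype.card V : ℝ) ^ M < Real.exp (αa / 8 * N))
    (hbad : #bad + N * Fintype.card κ < Fintype.card V)
    (hcov : (k : ℝ) * ((N * Fintype.card κ : ℕ) + (#bad + 1 : ℕ) + k * (#bad + 1 : ℕ) + k) <
      c₀ / 2 ^ k * Fintype.card V)
    (hdir : (s : ℝ) * (((#bad + 1) * k + N * Fintype.card κ : ℕ) +
      s * (#bad + N * P.length : ℕ) + s) < αc * Fintype.card V) :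
    ∃ (w₀ : List V) (Bs : List (List V)) (Xs : List (κ → V)) (cs cs' : List (List V))
      (U : List V),
      U = (w₀ :: Bs).flatten ++ Xs.flatMap tupList ++ (cs.flatten ++ cs'.flatten) ∧
      w₀.length = k ∧ (∀ w ∈ w₀ :: Bs, IsSeg k l (EdgeList E) w) ∧
      (∀ X ∈ Xs, ∀ w ∈ P, IsSeg k l (EdgeList E) (w.map X)) ∧
      List.Forall₂ (fun r c => IsSeg k l (EdgeList E) (r.1 ++ c ++ r.2))
        (linkReqs l (nextHead l (w₀.take l) (Xs.flatMap fun X => P.map (List.map X))) Bs) cs ∧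
      List.Forall₂ (fun r c => IsSeg k l (EdgeList E) (r.1 ++ c ++ r.2))
        (linkReqs l (w₀.take l) (Xs.flatMap fun X => P.map (List.map X))) cs' ∧
      U.Nodup ∧ (k - l) ∣ U.length + s ∧
      U.length ≤ (#bad + 1) * (k + s) + N * (Fintype.card κ + P.length * s) ∧
      (∃ z, z = nextHead l (nextHead l (w₀.take l) (Xs.flatMap fun X => P.map (List.map X))) Bs ∧
        z.length = l ∧ (z ++ w₀).Nodup ∧ z ⊆ U) ∧
      ∀ T : Fin M → V, (∀ i, T i ∉ U) →
        αa / 8 * N ≤ Xs.countP fun X => IsAbsorber k l E P T X := by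
  obtain ⟨Xs, hX1, hX2, hX3, hX4⟩ := exists_absorbing_family hαa bad habs N hnum hexp
  set Fam := (Xs.flatMap tupList).toFinset with hFam
  have hXlen : (Xs.flatMap tupList).length = Xs.length * Fintype.card κ := by
    rw [List.flatMap]
    rw [length_flatten_of_forall (c := Fintype.card κ)]
    · simp
    · intro w hw
      obtain ⟨X, -, rfl⟩ := List.mem_map.1 hw
      exact length_tupList
  have hFamc : #Fam ≤ N * Fintype.card κ := by
    refine (List.toFinset_card_le _).trans ?_
    rw [hXlen]
    exact Nat.mul_le_mul_right _ hX1
  obtain ⟨v₀, hv₀⟩ : ∃ v₀, v₀ ∉ bad ∪ Fam := by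
    by_contra! h
    have : #(bad ∪ Fam) = Fintype.card V := by
      rw [Finset.eq_univ_iff_forall.2 h, card_univ]
    have := card_union_le bad Fam
    omega
  rw [mem_union, not_or] at hv₀
  have hXne : Xs ≠ [] := by
    rintro rfl
    have := hX4 (fun _ => v₀) fun _ => hv₀.1
    have h2 : (0 : ℝ) < αa / 8 * N := by positivity
    simp at this
    linarith
  set D := insert v₀ (bad \ Fam) with hD
  have hDF : Disjoint D Fam := by
    rw [hD, disjoint_insert_left]
    exact ⟨hv₀.2, sdiff_disjoint⟩
  have hDc : #D ≤ #bad + 1 := (card_insert_le _ _).trans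
    (Nat.add_le_add_right (card_le_card sdiff_subset) 1)
  have hD0 : 0 < #D := card_pos.2 ⟨v₀, mem_insert_self _ _⟩
  obtain ⟨Bs', hB1, hB2, hB3, hB4, hB5⟩ := exists_cover hk hE hc₀ hdeg hn D Fam hDF (by
    refine lt_of_le_of_lt ?_ hcov
    gcongr)
  obtain ⟨w₀, Bs, rfl⟩ : ∃ w₀ Bs, Bs' = w₀ :: Bs := by
    cases Bs' with
    | nil => simp at hB1; omega
    | cons w Bs => exact ⟨w, Bs, rfl⟩
  have hBlen : Bs.length ≤ #bad := by
    rw [List.length_cons] at hB1; omega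
  set S := Xs.flatMap fun X => P.map (List.map X) with hS
  have hSseg : ∀ w ∈ S, IsSeg k l (EdgeList E) w := by
    intro w hw
    obtain ⟨X, hX, hw⟩ := List.mem_flatMap.1 hw
    obtain ⟨u, hu, rfl⟩ := List.mem_map.1 hw
    exact hX3 X hX u hu
  have hBseg : ∀ w ∈ w₀ :: Bs, IsSeg k l (EdgeList E) w := fun w hw =>
    isSeg_edge hlk (hB2 w hw).1 (hB2 w hw).2
  have hSlen : S.length = Xs.length * P.length := by
    rw [hS, List.length_flatMap]
    simp
  have hSne : S ≠ [] := by
    rw [← List.length_pos_iff, hSlen]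
    exact Nat.mul_pos (List.length_pos_iff.2 hXne) (List.length_pos_iff.2 hP0)
  have hw₀ : w₀.length = k := (hB2 w₀ (by simp)).1
  have hnd1 : ((w₀ :: Bs).flatten ++ Xs.flatMap tupList).Nodup :=
    hB3.append hX2 fun v hv hv' => hB4 v hv (by rw [hFam, List.mem_toFinset]; exact hv')
  have hperm : S.flatten.Perm (Xs.flatMap tupList) := flatten_segments_perm hP Xs
  have hnd2 : (w₀ ++ (Bs ++ S).flatten).Nodup := by
    refine (List.Perm.nodup_iff ?_).2 hnd1
    rw [List.flatten_append, ← List.append_assoc, ← List.flatten_cons]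
    exact hperm.append_left _
  have hnd3 : (w₀.take l ++ (Bs ++ S).flatten).Nodup :=
    hnd2.sublist ((List.take_sublist _ _).append_right _)
  have hl0 : (w₀.take l).length = l := by rw [List.length_take, hw₀]; omega
  have hlen : ∀ w ∈ Bs ++ S, l ≤ w.length := by
    intro w hw
    rcases List.mem_append.1 hw with hw | hw
    · exact (hBseg w (by simp [hw])).le_length
    · exact (hSseg w hw).le_length
  set F := ((w₀ :: Bs).flatten ++ Xs.flatMap tupList).toFinset with hF
  have hBflat : (w₀ :: Bs).flatten.length = (Bs.length + 1) * k := by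
    rw [length_flatten_of_forall fun w hw => (hB2 w hw).1, List.length_cons]
  have hFc : #F ≤ (#bad + 1) * k + N * Fintype.card κ := by
    refine (List.toFinset_card_le _).trans ?_
    rw [List.length_append, hBflat, hXlen]
    gcongr
  have hreqlen : (linkReqs l (w₀.take l) (Bs ++ S)).length ≤ #bad + N * P.length := by
    rw [length_linkReqs, List.length_append, hSlen]
    gcongr
  obtain ⟨ds, hd1, hd2, hd3, hd4⟩ := exists_disjoint_connectors hcon
    (linkReqs l (w₀.take l) (Bs ++ S)) (linkReqs_spec _ hl0 hlen hnd3) F (by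
      refine lt_of_le_of_lt ?_ hdir
      gcongr)
  rw [linkReqs_append] at hd1
  set a := (linkReqs l (nextHead l (w₀.take l) S) Bs).length with ha
  obtain ⟨hda, hdb⟩ := forall₂_append_left hd1
  rw [← ha] at hda hdb
  have hdlen : ds.length = Bs.length + Xs.length * P.length := by
    rw [← hd1.length_eq, List.length_append, length_linkReqs, length_linkReqs, hSlen]
  have hdcat : (ds.take a).flatten ++ (ds.drop a).flatten = ds.flatten := by
    rw [← List.flatten_append, List.take_append_drop]
  have hdflat : ds.flatten.length = ds.length * s := length_flatten_of_forall hd2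
  have hK : P.flatten.length = Fintype.card κ := by
    rw [hP.length_eq, length_toList, card_univ]
  have hm : k - l ∣ Fintype.card κ + s * P.length := by
    obtain ⟨X, hX⟩ := List.exists_mem_of_ne_nil _ hXne
    rw [← hK]
    refine dvd_length_flatten_add fun w hw => ?_
    obtain ⟨q, hq⟩ := (hX3 X hX w hw).1
    rw [List.length_map] at hq
    rw [hq]
    have : l + q * (k - l) + s = q * (k - l) + (s + l) := by ring
    rw [this]
    exact (Dvd.intro_left _ rfl).add hsl
  refine ⟨w₀, Bs, Xs, ds.take a, ds.drop a, _, rfl, hw₀, hBseg, hX3, hda, hdb, ?_, ?_, ?_,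
    ⟨_, rfl, ?_⟩, ?_⟩
  · rw [hdcat]
    exact hnd1.append hd3 fun v hv hv' => hd4 v hv' (by rw [hF, List.mem_toFinset]; exact hv)
  · rw [hdcat, List.length_append, List.length_append, hBflat, hXlen, hdflat, hdlen]
    have h1 : k - l ∣ k + s := by
      have : k + s = (k - l) + (s + l) := by omega
      rw [this]
      exact (dvd_refl _).add hsl
    have : (Bs.length + 1) * k + Xs.length * Fintype.card κ +
        (Bs.length + Xs.length * P.length) * s + s =
        (Bs.length + 1) * (k + s) + Xs.length * (Fintype.card κ + s * P.length) := by ring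
    rw [this]
    exact (h1.mul_left _).add (hm.mul_left _)
  · rw [hdcat, List.length_append, List.length_append, hBflat, hXlen, hdflat, hdlen]
    have h1 : (Bs.length + 1) * (k + s) ≤ (#bad + 1) * (k + s) := by gcongr
    have h2 : Xs.length * (Fintype.card κ + P.length * s) ≤
      N * (Fintype.card κ + P.length * s) := by gcongr
    have h3 : (0:ℕ) ≤ s := s.zero_le
    nlinarith
  · have hz : nextHead l (nextHead l (w₀.take l) S) Bs = nextHead l [] (Bs ++ S) ∧
        nextHead l (w₀.take l) (Bs ++ S) = nextHead l [] (Bs ++ S) := by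
      cases Bs with
      | nil =>
        cases hS' : S with
        | nil => exact absurd hS' hSne
        | cons x xs => exact ⟨rfl, rfl⟩
      | cons x xs => exact ⟨rfl, rfl⟩
    have hsub : nextHead l [] (Bs ++ S) ⊆ (Bs ++ S).flatten := by
      cases hBS : Bs ++ S with
      | nil => simp [nextHead]
      | cons x xs =>
        intro v hv
        rw [List.flatten_cons]
        exact List.mem_append_left _ (List.mem_of_mem_take hv)
    refine ⟨?_, ?_, ?_⟩
    · rw [hz.1, ← hz.2]
      exact (nextHead_spec hl0 hlen).1
    · have h1 := nextHead_nodup (l := l) hnd3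
      rw [hz.2] at h1
      rw [hz.1]
      refine h1.append hnd2.of_append_left fun v hv hv' => ?_
      exact List.disjoint_of_nodup_append hnd2 hv' (hsub hv)
    · rw [hz.1]
      intro v hv
      have h1 := hsub hv
      rw [List.flatten_append, List.mem_append] at h1
      rw [List.mem_append, List.mem_append, List.flatten_cons, List.mem_append]
      rcases h1 with h1 | h1
      · exact Or.inl (Or.inl (Or.inr h1))
      · exact Or.inl (Or.inr (hperm.mem_iff.1 h1))
  · intro T hT
    refine hX4 T fun i hi => hT i ?_
    rw [List.mem_append, List.mem_append]
    by_cases h : T i ∈ Fam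
    · exact Or.inl (Or.inr (List.mem_toFinset.1 h))
    · exact Or.inl (Or.inl (hB5 _ (mem_insert_of_mem (mem_sdiff.2 ⟨hi, h⟩))))

end Skeleton

section Closing

variable {κ : Type*} [Fintype κ] [DecidableEq κ] {k l s n : ℕ}

open Classical in
/-- A skeleton is completed to a Hamiltonian cycle by path tiles and a reservoir. -/
theorem hasHamCycle_of_skeleton [Nonempty (Fin n)] {E : Finset (Finset (Fin n))} (hk : 0 < k)
    (hlk : l < k) (hl : 0 < l) (hmn : (k - l) ∣ n) {q : ℕ} (hq : s + l = q * (k - l))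
    {α : ℝ} (hα : 0 < α) (hcon : HasConnectors k l s α E)
    {P : List (List κ)} {M : ℕ} (hP : P.flatten.Perm univ.toList) (hM : M = k * (k - l))
    {w₀ : List (Fin n)} {Bs : List (List (Fin n))} {Xs : List (κ → Fin n)}
    {cs cs' : List (List (Fin n))} {U : List (Fin n)}
    (hU : U = (w₀ :: Bs).flatten ++ Xs.flatMap tupList ++ (cs.flatten ++ cs'.flatten))
    (hw₀ : w₀.length = k) (hB : ∀ w ∈ w₀ :: Bs, IsSeg k l (EdgeList E) w)
    (hX : ∀ X ∈ Xs, ∀ w ∈ P, IsSeg k l (EdgeList E) (w.map X))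
    (hcs : List.Forall₂ (fun r c => IsSeg k l (EdgeList E) (r.1 ++ c ++ r.2))
      (linkReqs l (nextHead l (w₀.take l) (Xs.flatMap fun X => P.map (List.map X))) Bs) cs)
    (hcs' : List.Forall₂ (fun r c => IsSeg k l (EdgeList E) (r.1 ++ c ++ r.2))
      (linkReqs l (w₀.take l) (Xs.flatMap fun X => P.map (List.map X))) cs')
    (hnd : U.Nodup) (hdvd : (k - l) ∣ U.length + s) {z : List (Fin n)}
    (hz : z = nextHead l (nextHead l (w₀.take l) (Xs.flatMap fun X => P.map (List.map X))) Bs)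
    (hzl : z.length = l) (hznd : (z ++ w₀).Nodup) (hzU : z ⊆ U) {c : ℝ}
    (habs : ∀ T : Fin M → Fin n, (∀ i, T i ∉ U) →
      c ≤ Xs.countP fun X => IsAbsorber k l E P T X)
    {N : ℕ} (hnum : (s : ℝ) * (U.length + s * N + s) ≤ α / 2 * n)
    (hexp : (n : ℝ) ^ (2 * l) < Real.exp (α / 8 * N)) {L j : ℕ} (hL : L + q = k * j + 1)
    {γ ε : ℝ}
    (htile : ∀ F : Finset (Fin n), (#F : ℝ) ≤ γ * n → ∃ Ps : List (List (Fin n)),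
      (∀ P ∈ Ps, P.length = l + L * (k - l) ∧ IsPath k l (EdgeList E) P) ∧ Ps.flatten.Nodup ∧
      (∀ v ∈ Ps.flatten, v ∉ F) ∧ (1 - ε) * n - #F ≤ Ps.flatten.length)
    (hγ : (U.length : ℝ) + s * N ≤ γ * n)
    (hreq : 1 + (n : ℝ) / (l + L * (k - l) : ℕ) ≤ α / 8 * N)
    (hkT : (k : ℝ) * (l + L * (k - l) : ℕ) ≤ (1 - ε) * n - γ * n)
    (hleft : ε * n + s * N + k * (l + L * (k - l) : ℕ) ≤ c) : HasHamCycle k l E := by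
  set τ := l + L * (k - l) with hτ
  have hτ0 : 0 < τ := by omega
  have hτ0' : (0 : ℝ) < τ := by exact_mod_cast hτ0
  obtain ⟨Cs, hC1, hC2, hC3, hC4⟩ := exists_reservoir hα hcon U.toFinset N (by
    rw [Fintype.card_fin]
    refine le_trans ?_ hnum
    have := List.toFinset_card_le U
    gcongr) (by rwa [Fintype.card_fin])
  have hClen : (Cs.flatMap tupList).length ≤ s * N := by
    rw [List.flatMap, length_flatten_of_forall (c := s)]
    · rw [List.length_map, mul_comm]
      gcongr
    · intro w hw
      obtain ⟨X, -, rfl⟩ := List.mem_map.1 hw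
      rw [length_tupList, Fintype.card_fin]
  set F := (U ++ Cs.flatMap tupList).toFinset with hF
  have hFc : (#F : ℝ) ≤ U.length + s * N := by
    have : #F ≤ U.length + s * N := (List.toFinset_card_le _).trans (by
      rw [List.length_append]
      exact Nat.add_le_add_left hClen _)
    exact_mod_cast this
  obtain ⟨Ps, hP1, hP2, hP3, hP4⟩ := htile F (hFc.trans hγ)
  have hPlen : Ps.flatten.length = Ps.length * τ := length_flatten_of_forall fun w hw => (hP1 w hw).1
  have hPn : Ps.length * τ ≤ n := by
    rw [← hPlen]
    simpa using hP2.length_le_card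
  have hPn' : (Ps.length : ℝ) * τ ≤ n := by exact_mod_cast hPn
  rw [hPlen] at hP4
  push_cast at hP4
  have hTk : k ≤ Ps.length := by
    have : (k : ℝ) * τ ≤ Ps.length * τ := by linarith
    exact_mod_cast le_of_mul_le_mul_right this hτ0'
  obtain ⟨n', hn'⟩ := hmn
  obtain ⟨R, hR⟩ := hdvd
  obtain ⟨T', hT1, hT2, hT3⟩ := exists_residue ((n' : ℤ) - R) j hk hTk
  set tiles := Ps.take T' with htiles
  have htl : tiles.length = T' := by rw [htiles, List.length_take, min_eq_left hT1]
  have htsub : tiles.flatten.Sublist Ps.flatten := (List.take_sublist _ _).flatten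
  have htm : ∀ w ∈ tiles, w.length = τ ∧ IsPath k l (EdgeList E) w := fun w hw =>
    hP1 w (List.mem_of_mem_take hw)
  have htseg : ∀ w ∈ tiles, IsSeg k l (EdgeList E) w := fun w hw =>
    ⟨⟨L, (htm w hw).1⟩, (htm w hw).2⟩
  have htU : U.Disjoint tiles.flatten := fun v hv hv' => hP3 v (htsub.subset hv') (by
    rw [hF, List.mem_toFinset]
    exact List.mem_append_left _ hv)
  have hw₀U : w₀ ⊆ U := by
    intro v hv
    rw [hU]
    simp [hv]
  have hreqs := linkReqs_spec (l := l) (z := z) (w₀ :: tiles) hzl (by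
    intro w hw
    rcases List.mem_cons.1 hw with rfl | hw
    · omega
    · exact (htseg w hw).le_length) (by
    rw [List.flatten_cons, ← List.append_assoc]
    refine hznd.append (hP2.sublist htsub) fun v hv hv' => ?_
    rcases List.mem_append.1 hv with hv | hv
    · exact htU (hzU hv) hv'
    · exact htU (hw₀U hv) hv')
  obtain ⟨Ys, rest, hY1, hY2⟩ := exists_assignment_list
    (fun (r : List (Fin n) × List (Fin n)) (C : Fin s → Fin n) =>
      IsSeg k l (EdgeList E) (r.1 ++ List.ofFn C ++ r.2))
    (linkReqs l z (w₀ :: tiles)) Cs (by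
      intro r hr
      obtain ⟨h1, h2, h3, h4, h5⟩ := hreqs r hr
      have h6 := hC4 r.1 r.2 h1 h2 h3 h4 h5
      have h7 : (T' : ℝ) ≤ n / τ := by
        rw [le_div_iff₀ hτ0']
        refine le_trans ?_ hPn'
        gcongr
      rw [length_linkReqs, List.length_cons, htl]
      have h8 : ((T' + 1 : ℕ) : ℝ) ≤ Cs.countP fun C =>
          decide (IsSeg k l (EdgeList E) (r.1 ++ List.ofFn C ++ r.2)) := by
        push_cast
        linarith
      exact_mod_cast h8)
  have hYlen : Ys.length = T' + 1 := by
    rw [← hY1.length_eq, length_linkReqs, List.length_cons, htl]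
  have hYperm : (Ys.flatMap tupList ++ rest.flatMap tupList).Perm (Cs.flatMap tupList) := by
    rw [← List.flatMap_append]
    exact hY2.flatMap_right _
  have hYnd : (Ys.flatMap tupList).Nodup := (hYperm.nodup_iff.2 hC2).of_append_left
  have hYsub : Ys.flatMap tupList ⊆ Cs.flatMap tupList := fun v hv =>
    hYperm.mem_iff.1 (List.mem_append_left _ hv)
  have hYl : (Ys.flatMap tupList).length = (T' + 1) * s := by
    rw [List.flatMap, length_flatten_of_forall (c := s), List.length_map, hYlen]
    intro w hw
    obtain ⟨X, -, rfl⟩ := List.mem_map.1 hw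
    rw [length_tupList, Fintype.card_fin]
  set W := U ++ tiles.flatten ++ Ys.flatMap tupList with hW
  have hWnd : W.Nodup := by
    refine (hnd.append (hP2.sublist htsub) htU).append hYnd fun v hv hv' => ?_
    rcases List.mem_append.1 hv with hv | hv
    · exact hC3 v (hYsub hv') (List.mem_toFinset.2 hv)
    · refine hP3 v (htsub.subset hv) ?_
      rw [hF, List.mem_toFinset]
      exact List.mem_append_right _ (hYsub hv')
  have hWlen : W.length = U.length + T' * τ + (T' + 1) * s := by
    rw [hW, List.length_append, List.length_append, hYl,
      length_flatten_of_forall fun w hw => (htm w hw).1, htl]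
  have hWn : W.length ≤ n := by simpa using hWnd.length_le_card
  obtain ⟨t, ht⟩ : ∃ t, W.length + M * t = n := by
    have hdv : ((M : ℕ) : ℤ) ∣ (n : ℤ) - W.length := by
      obtain ⟨x, hx⟩ := hT3
      refine ⟨x, ?_⟩
      have e1 : (n : ℤ) = ((k - l : ℕ) : ℤ) * n' := by exact_mod_cast hn'
      have e2 : (U.length : ℤ) + s = ((k - l : ℕ) : ℤ) * R := by exact_mod_cast hR
      have e3 : (s : ℤ) + l = q * ((k - l : ℕ) : ℤ) := by exact_mod_cast hq
      have e4 : (L : ℤ) + q = k * j + 1 := by exact_mod_cast hL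
      have e5 : (τ : ℤ) = l + L * ((k - l : ℕ) : ℤ) := by exact_mod_cast hτ
      rw [hWlen, hM]
      push_cast [e5]
      generalize ((k - l : ℕ) : ℤ) = m at *
      linear_combination e1 - e2 - T' * e3 - T' * m * e4 + m * hx
    rw [← Nat.cast_sub hWn, Int.natCast_dvd_natCast] at hdv
    obtain ⟨t, ht⟩ := hdv
    exact ⟨t, by omega⟩
  have hM0 : 0 < M := by
    rw [hM]
    exact Nat.mul_pos hk (by omega)
  refine hasHamCycle_of_absorbing hlk hP w₀ (tiles ++ Bs) (Ys.map List.ofFn ++ cs) cs' Xs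
    hw₀.ge ?_ hX ?_ hcs' (L := W) ?_ hWnd ht ?_
  · intro w hw
    rcases List.mem_cons.1 hw with rfl | hw
    · exact hB _ (by simp)
    · rcases List.mem_append.1 hw with hw | hw
      · exact htseg w hw
      · exact hB w (by simp [hw])
  · rw [← List.cons_append, linkReqs_append, ← hz]
    exact List.rel_append (List.forall₂_map_right_iff.2 hY1) hcs
  · rw [List.perm_iff_count]
    intro a
    simp only [hW, hU, List.flatten_cons, List.flatten_append, List.count_append,
      (flatten_map_ofFn_perm Ys).count_eq a]
    omega
  · intro T hT
    have h1 := habs T fun i hi => hT i (by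
      rw [hW, List.append_assoc]
      exact List.mem_append_left _ hi)
    have h2 : (t : ℝ) ≤ c := by
      have h3 : (W.length : ℝ) + M * t = n := by exact_mod_cast ht
      have h4 : (1 : ℝ) * t ≤ M * t := by
        gcongr
        exact_mod_cast hM0
      have h5 : (W.length : ℝ) = U.length + T' * τ + (T' + 1) * s := by exact_mod_cast hWlen
      have h6 : (Ps.length : ℝ) * τ ≤ (T' + k) * τ := by
        gcongr
        exact_mod_cast hT2.le
      have h7 : (0 : ℝ) ≤ (T' + 1) * s := by positivity
      linarith
    have h3 := h2.trans h1
    exact_mod_cast h3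

end Closing

section Constants

theorem eventually_le_mul (C : ℝ) {a : ℝ} (ha : 0 < a) :
    ∀ᶠ n : ℕ in Filter.atTop, C ≤ a * n :=
  (tendsto_natCast_atTop_atTop.const_mul_atTop ha).eventually_ge_atTop C

theorem eventually_pow_lt_exp (M : ℕ) {a : ℝ} (ha : 0 < a) :
    ∀ᶠ n : ℕ in Filter.atTop, (n : ℝ) ^ M < Real.exp (a * n) := by
  have h := (isLittleO_pow_exp_pos_mul_atTop M ha).bound (c := 1 / 2) (by norm_num)
  filter_upwards [tendsto_natCast_atTop_atTop.eventually h] with n hn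
  have h1 : (0 : ℝ) < Real.exp (a * n) := Real.exp_pos _
  rw [Real.norm_eq_abs, Real.norm_eq_abs, abs_of_pos h1] at hn
  have h2 := le_abs_self ((n : ℝ) ^ M)
  linarith

theorem floor_mul_bounds {ν : ℝ} (hν : 0 ≤ ν) {n : ℕ} (hn : 2 ≤ ν * n) :
    (⌊ν * n⌋₊ : ℝ) ≤ ν * n ∧ ν / 2 * n ≤ ⌊ν * n⌋₊ := by
  refine ⟨Nat.floor_le (by positivity), ?_⟩
  have := Nat.lt_floor_add_one (ν * n)
  linarith

theorem pow_lt_exp_floor {ν a : ℝ} (ha : 0 < a) (hν : 0 ≤ ν) {n M : ℕ}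
    (hn : 2 ≤ ν * n) (h : (n : ℝ) ^ M < Real.exp (a / 8 * (ν / 2) * n)) :
    (n : ℝ) ^ M < Real.exp (a / 8 * ⌊ν * n⌋₊) := by
  refine h.trans_le (Real.exp_le_exp.2 ?_)
  rw [mul_assoc]
  exact mul_le_mul_of_nonneg_left (floor_mul_bounds hν hn).2 (by positivity)

/-- The degree condition in normalized form. -/
theorem degree_bounds {m c γ : ℝ} (hm : 1 ≤ m) (hc : c = (4 * m - 1) / (4 * m ^ 2)) (hγ : 0 < γ)
    {n : ℕ} {d : ℝ} (hn : 4 ≤ n) (hn' : 2 * c ≤ γ * n)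
    (h : (c - min (γ / 2) (c / 4)) * (n.choose 2 : ℝ) ≤ d) :
    (1 - (1 - 1 / (2 * m)) ^ 2 - γ) * (n : ℝ) ^ 2 ≤ 2 * d ∧ c / 4 * (n : ℝ) ^ 2 ≤ d := by
  have hc0 : 0 < c := by
    rw [hc]
    apply div_pos <;> nlinarith
  have e : 1 - (1 - 1 / (2 * m)) ^ 2 = c := by
    rw [hc]
    field_simp
    ring
  rw [e]
  rw [Nat.cast_choose_two] at h
  have hn4 : (4 : ℝ) ≤ n := by exact_mod_cast hn
  have h0 : (0 : ℝ) ≤ n * (n - 1) / 2 := by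
    have : (0 : ℝ) ≤ n - 1 := by linarith
    positivity
  constructor
  · have h1 : (c - γ / 2) * ((n : ℝ) * (n - 1) / 2) ≤ d :=
      (mul_le_mul_of_nonneg_right (by linarith [min_le_left (γ / 2) (c / 4)]) h0).trans h
    have h2 : 2 * c * n ≤ γ * n * n := mul_le_mul_of_nonneg_right hn' (by linarith)
    have h3 : 0 ≤ γ * n := by positivity
    nlinarith
  · have h1 : (c - c / 4) * ((n : ℝ) * (n - 1) / 2) ≤ d :=
      (mul_le_mul_of_nonneg_right (by linarith [min_le_right (γ / 2) (c / 4)]) h0).trans h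
    have h2 : 0 ≤ c * n * (n - 4) := mul_nonneg (by positivity) (by linarith)
    have h3 : 0 ≤ c * n := by positivity
    nlinarith

end Constants

set_option maxHeartbeats 2000000 in
theorem stmt1 (ξ : ℝ) (hξ0 : 0 < ξ) (hξ1 : ξ < 1)
    (k l : ℕ) (hk : 4 ≤ k) (hl1 : 1 ≤ l) (hl2 : 2 * l < k) :
    ∃ γ : ℝ, 0 < γ ∧ ∃ n₀ : ℕ, ∀ n : ℕ, n₀ ≤ n → (k - l) ∣ n →
      ∀ E : Finset (Finset (Fin n)), (∀ e ∈ E, e.card = k) →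
        ¬ IsExtremal k l ξ E →
        (∀ S : Finset (Fin n), S.card = k - 2 →
          ((4 * ((k : ℝ) - l) - 1) / (4 * ((k : ℝ) - l) ^ 2) - γ) * (Nat.choose n 2) ≤
            (degH E S : ℝ)) →
        HasHamCycle k l E := by
  have hlk : l < k := by omega
  have hkr : (4 : ℝ) ≤ k := by exact_mod_cast hk
  have hm1 : (1 : ℝ) ≤ (k : ℝ) - l := by
    have : (l : ℝ) + 1 ≤ k := by exact_mod_cast hlk
    linarith
  set c : ℝ := (4 * ((k : ℝ) - l) - 1) / (4 * ((k : ℝ) - l) ^ 2) with hc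
  have hc0 : 0 < c := by
    rw [hc]
    apply div_pos <;> nlinarith
  obtain ⟨γ, hγ, htile⟩ := exists_path_tiling_avoiding hk hl1 hl2
    (δ := ξ / (4 * k)) (ρ' := ξ / (2 * (2 ^ k * k.factorial))) (by positivity) (by positivity)
  refine ⟨min (γ / 2) (c / 4), by positivity, ?_⟩
  obtain ⟨s, q, hq, αc, hαc, nc, hcon⟩ := exists_connectors hk hl1 hl2 (c₀ := c / 4) (by positivity)
  have hq0 : 0 < q := by
    rcases Nat.eq_zero_or_pos q with rfl | h
    · omega
    · exact h
  have hs0 : 1 ≤ s := by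
    have : k - l ≤ q * (k - l) := Nat.le_mul_of_pos_left _ hq0
    omega
  have hs0' : (1 : ℝ) ≤ s := by exact_mod_cast hs0
  obtain ⟨θ, hθ0, hθ1, hθ2, hθ3, hθ4⟩ : ∃ θ : ℝ, 0 < θ ∧ (k : ℝ) * θ ≤ c / 4 / 2 ^ k / 2 ∧
      (s : ℝ) * θ ≤ αc / 4 ∧ θ ≤ γ ∧ θ ≤ 1 / 4 := by
    refine ⟨min (c / 4 / 2 ^ k / 2 / k) (min (αc / 4 / s) (min γ (1 / 4))), by positivity,
      ?_, ?_, ?_, ?_⟩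
    · rw [← le_div_iff₀' (by positivity)]
      exact min_le_left _ _
    · rw [← le_div_iff₀' (by positivity)]
      exact (min_le_right _ _).trans (min_le_left _ _)
    · exact (min_le_right _ _).trans ((min_le_right _ _).trans (min_le_left _ _))
    · exact (min_le_right _ _).trans ((min_le_right _ _).trans (min_le_right _ _))
  obtain ⟨μ, hμ0, hμ1⟩ : ∃ μ : ℝ, 0 < μ ∧ μ * (k + s) = θ / 4 :=
    ⟨θ / 4 / (k + s), by positivity, div_mul_cancel₀ _ (by positivity)⟩
  obtain ⟨κ, _, _, P, M, hM, hP0, hP, αa, hαa, na, habs⟩ := exists_absorbers hk hl1 hl2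
    (c₀ := c / 4) (μ := μ) (by positivity) hμ0
  set K := Fintype.card κ with hK
  set p := P.length with hp
  obtain ⟨ν₁, hν₁, hν₁1, hν₁2⟩ : ∃ ν : ℝ, 0 < ν ∧ ν * (K + p * s) ≤ θ / 4 ∧
      (K : ℝ) * (K * ν) ≤ αa / 4 := by
    refine ⟨min (θ / 4 / (K + p * s + 1)) (αa / 4 / (K * K + 1)), by positivity, ?_, ?_⟩
    · have h1 : min (θ / 4 / (K + p * s + 1)) (αa / 4 / (K * K + 1)) * (K + p * s + 1) ≤
        θ / 4 := by
        rw [← le_div_iff₀ (by positivity)]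
        exact min_le_left _ _
      exact (mul_le_mul_of_nonneg_left (by linarith) (by positivity)).trans h1
    · have h1 : min (θ / 4 / (K + p * s + 1)) (αa / 4 / (K * K + 1)) * (K * K + 1) ≤
        αa / 4 := by
        rw [← le_div_iff₀ (by positivity)]
        exact min_le_right _ _
      refine le_trans ?_ h1
      have : (0 : ℝ) ≤ min (θ / 4 / (K + p * s + 1)) (αa / 4 / (K * K + 1)) := by positivity
      nlinarith
  obtain ⟨ν₂, hν₂, hν₂1, hν₂2⟩ : ∃ ν : ℝ, 0 < ν ∧ (s : ℝ) * ν ≤ θ / 8 ∧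
      (s : ℝ) * ν ≤ αa * ν₁ / 64 := by
    refine ⟨min (θ / 8) (αa * ν₁ / 64) / s, by positivity, ?_, ?_⟩
    · rw [mul_div_cancel₀ _ (by positivity)]
      exact min_le_left _ _
    · rw [mul_div_cancel₀ _ (by positivity)]
      exact min_le_right _ _
  set ε := min (1 / 4) (αa * ν₁ / 64) with hε
  have hε0 : 0 < ε := by positivity
  obtain ⟨L₀, hL₀⟩ := htile ε hε0
  obtain ⟨L, j, hLj, hL1, hL2⟩ : ∃ L j : ℕ, L + q = k * j + 1 ∧ L₀ ≤ L ∧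
      32 / (αc * ν₂) ≤ (L : ℝ) := by
    obtain ⟨x, hx⟩ := exists_nat_ge (32 / (αc * ν₂))
    set j := L₀ + q + x with hj
    have hkj : j ≤ k * j := Nat.le_mul_of_pos_left _ (by omega)
    refine ⟨k * j + 1 - q, j, by omega, by omega, hx.trans ?_⟩
    have : x ≤ k * j + 1 - q := by omega
    exact_mod_cast this
  obtain ⟨nt, hnt⟩ := hL₀ L hL1
  set τ := l + L * (k - l) with hτ
  have hev := (((((((((Filter.eventually_ge_atTop (max (max nc na) (max nt (2 * k)))).and
    (eventually_le_mul (2 * c) hγ)).and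
    (eventually_le_mul ((K : ℝ) * K) (a := αa / 4) (by positivity))).and
    (eventually_le_mul ((k : ℝ) + s) (a := θ / 8) (by positivity))).and
    (eventually_le_mul 2 hν₁)).and (eventually_le_mul 2 hν₂)).and
    ((eventually_pow_lt_exp M (a := αa / 8 * (ν₁ / 2)) (by positivity)).and
    (eventually_pow_lt_exp (2 * l) (a := αc / 8 * (ν₂ / 2)) (by positivity)))).and
    (eventually_le_mul 1 (a := αc * ν₂ / 32) (by positivity))).and
    ((eventually_le_mul ((k : ℝ) * τ) (a := αa * ν₁ / 64) (by positivity)).and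
    (eventually_le_mul ((k : ℝ) * τ) (a := 1 / 2) (by positivity))))
  obtain ⟨n₀, hn₀⟩ := Filter.eventually_atTop.1 hev
  refine ⟨n₀, fun n hn hmn E hE hext hdeg => ?_⟩
  obtain ⟨⟨⟨⟨⟨⟨⟨⟨hbig, e1⟩, e2⟩, e3⟩, e4⟩, e5⟩, e6, e7⟩, e8⟩, e9, e10⟩ := hn₀ n hn
  clear hev hn₀
  simp only [max_le_iff] at hbig
  obtain ⟨⟨hnc, hna⟩, hnt', hn2k⟩ := hbig
  have hn0 : 0 < n := by omega
  have hnr : (0 : ℝ) < n := by exact_mod_cast hn0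
  have : Nonempty (Fin n) := ⟨⟨0, hn0⟩⟩
  have hdeg' := fun S hS => degree_bounds hm1 hc hγ (by omega) e1 (hdeg S hS)
  have hdegc : ∀ S : Finset (Fin n), #S = k - 2 →
      c / 4 * (Fintype.card (Fin n) : ℝ) ^ 2 ≤ #{e ∈ E | S ⊆ e} := by
    intro S hS
    rw [Fintype.card_fin]
    exact (hdeg' S hS).2
  obtain ⟨bad, hbad, hbad'⟩ := habs (Fin n) E (by rwa [Fintype.card_fin]) hE hdegc
  have hcon' : HasConnectors k l s αc E := hcon (Fin n) E (by rwa [Fintype.card_fin]) hE hdegc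
  rw [Fintype.card_fin] at hbad
  set N₁ := ⌊ν₁ * n⌋₊ with hN₁
  set N₂ := ⌊ν₂ * n⌋₊ with hN₂
  obtain ⟨hN₁u, hN₁l⟩ := floor_mul_bounds hν₁.le e4
  obtain ⟨hN₂u, hN₂l⟩ := floor_mul_bounds hν₂.le e5
  rw [← hN₁] at hN₁u hN₁l
  rw [← hN₂] at hN₂u hN₂l
  have hu : ((#bad : ℝ) + 1) * (k + s) + N₁ * (K + p * s) ≤ 5 / 8 * θ * n := by
    have h1 : ((#bad : ℝ) + 1) * (k + s) ≤ (μ * n + 1) * (k + s) := by gcongr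
    have h2 : (N₁ : ℝ) * (K + p * s) ≤ ν₁ * n * (K + p * s) := by gcongr
    have h3 : ν₁ * (K + p * s) * n ≤ θ / 4 * n := by gcongr
    have h4 : (μ * n + 1) * (k + s) = μ * (k + s) * n + (k + s) := by ring
    rw [h4, hμ1] at h1
    linarith
  have hsN₂ : (s : ℝ) * N₂ ≤ θ / 8 * n := by
    calc (s : ℝ) * N₂ ≤ s * (ν₂ * n) := by gcongr
      _ = s * ν₂ * n := by ring
      _ ≤ _ := by gcongr
  have hsN₂' : (s : ℝ) * N₂ ≤ αa * ν₁ / 64 * n := by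
    calc (s : ℝ) * N₂ ≤ s * (ν₂ * n) := by gcongr
      _ = s * ν₂ * n := by ring
      _ ≤ _ := by gcongr
  have hps : (0 : ℝ) ≤ N₁ * (p * s) := by positivity
  obtain ⟨w₀, Bs, Xs, cs, cs', U, hU, hw₀, hB, hX, hcs, hcs', hnd, hdvd, hUlen,
    ⟨z, hz, hzl, hznd, hzU⟩, hcnt⟩ := exists_skeleton (s := s) (by omega) hlk hE
      (c₀ := c / 4) (by positivity) hdegc (by rwa [Fintype.card_fin]) ⟨q, by rw [hq, mul_comm]⟩
      hcon' hP hP0 hαa bad hbad' (N := N₁) (by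
        have : (0 : ℝ) < N₁ := lt_of_lt_of_le (by positivity) hN₁l
        exact_mod_cast this) (by
        rw [Fintype.card_fin, ← hK]
        have h1 : (K : ℝ) * (K * N₁) ≤ K * (K * (ν₁ * n)) := by gcongr
        have h2 : (K : ℝ) * (K * ν₁) * n ≤ αa / 4 * n := by gcongr
        linarith) (by
        rw [Fintype.card_fin]
        exact pow_lt_exp_floor hαa hν₁.le e4 e6) (by
        rw [Fintype.card_fin, ← hK]
        have h1 : ((#bad + N₁ * K : ℕ) : ℝ) < n := by
          push_cast
          have : (#bad : ℝ) * 1 ≤ (#bad + 1) * (k + s) := by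
            gcongr <;> linarith
          have : θ * n ≤ 1 / 4 * n := by gcongr
          linarith
        exact_mod_cast h1) (by
        rw [Fintype.card_fin, ← hK]
        push_cast
        have h1 : (N₁ : ℝ) * K + (#bad + 1) + k * (#bad + 1) + k ≤ θ * n := by
          have : ((#bad : ℝ) + 1) * (k + 1) ≤ (#bad + 1) * (k + s) := by gcongr
          linarith [mul_pos hθ0 hnr]
        calc (k : ℝ) * (N₁ * K + (#bad + 1) + k * (#bad + 1) + k) ≤ k * (θ * n) := by gcongr
          _ = k * θ * n := by ring
          _ ≤ c / 4 / 2 ^ k / 2 * n := by gcongr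
          _ < _ := by
            have : 0 < c / 4 / 2 ^ k * n := by positivity
            linarith) (by
        rw [Fintype.card_fin, ← hK, ← hp]
        push_cast
        have h1 : ((#bad : ℝ) + 1) * k + N₁ * K + s * (#bad + N₁ * p) + s ≤ θ * n := by
          linarith [mul_pos hθ0 hnr]
        calc (s : ℝ) * (((#bad : ℝ) + 1) * k + N₁ * K + s * (#bad + N₁ * p) + s) ≤
            s * (θ * n) := by gcongr
          _ = s * θ * n := by ring
          _ ≤ αc / 4 * n := by gcongr
          _ < _ := by
            have : 0 < αc * n := by positivity
            linarith)
  have hUr : (U.length : ℝ) ≤ 5 / 8 * θ * n := by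
    refine le_trans ?_ hu
    exact_mod_cast hUlen
  have hsn : (s : ℝ) ≤ θ / 8 * n := by linarith
  refine hasHamCycle_of_skeleton (by omega) hlk hl1 hmn hq hαc hcon' hP hM hU hw₀ hB hX hcs hcs'
    hnd hdvd hz hzl hznd hzU hcnt (N := N₂) ?_ (pow_lt_exp_floor hαc hν₂.le e5 e7) hLj
    (γ := θ) (ε := ε) ?_ ?_ ?_ ?_ ?_
  · have h1 : (U.length : ℝ) + s * N₂ + s ≤ θ * n := by
      linarith [mul_pos hθ0 hnr]
    calc (s : ℝ) * (U.length + s * N₂ + s) ≤ s * (θ * n) := by gcongr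
      _ = s * θ * n := by ring
      _ ≤ αc / 4 * n := by gcongr
      _ ≤ _ := by
        have : 0 < αc * n := by positivity
        linarith
  · intro F hF
    have h1 := hnt (Fin n) E (by rwa [Fintype.card_fin]) hE (by
      intro S hS
      rw [Fintype.card_fin]
      exact (hdeg' S hS).1) (by
      intro B hB
      rw [Fintype.card_fin] at hB ⊢
      exact card_edges_inside_ge_of_not_isExtremal (by omega) hlk hξ0 hn2k hE hext B hB) F (by
      rw [Fintype.card_fin]
      exact hF.trans (by gcongr))
    rwa [Fintype.card_fin] at h1
  · linarith [mul_pos hθ0 hnr]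
  · have hLpos : (0 : ℝ) < L := lt_of_lt_of_le (by positivity) hL2
    have hLτ : (L : ℝ) ≤ τ := by
      have : L ≤ τ := by
        have : L * 1 ≤ L * (k - l) := Nat.mul_le_mul_left _ (by omega)
        omega
      exact_mod_cast this
    have h1 : (n : ℝ) / τ ≤ αc * ν₂ / 32 * n := by
      calc (n : ℝ) / τ ≤ n / L := by gcongr
        _ ≤ n / (32 / (αc * ν₂)) := by gcongr
        _ = _ := by field_simp
    have h2 : αc / 8 * (ν₂ / 2 * n) ≤ αc / 8 * N₂ := by gcongr
    linarith
  · have h1 : ε * n ≤ 1 / 4 * n := by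
      gcongr
      exact min_le_left _ _
    have h2 : θ * n ≤ 1 / 4 * n := by gcongr
    linarith
  · have h1 : ε * n ≤ αa * ν₁ / 64 * n := by
      gcongr
      exact min_le_right _ _
    have h2 : αa / 8 * (ν₁ / 2 * n) ≤ αa / 8 * N₁ := by gcongr
    have : 0 < αa * ν₁ * n := by positivity
    linarith
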